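/- Let (W, S) be a finite (spherical) Coxeter system and let w ∈ W. The Hurwitz action of the braid group is transitive on Red_T(w) if and only if w is a parabolic quasi-Coxeter element, i.e. some reduced reflection factorization of w generates a parabolic subgroup of W. -/

import Mathlib

/-- The reflection length `ℓ_T w` of `w` in a Coxeter system: the least `k` such that
`w` is a product of `k` reflections. -/
noncomputable def reflLen {B W : Type*} [Group W] {M : CoxeterMatrix B}
    (cs : CoxeterSystem M W) (w : W) : ℕ :=
  sInf {k | ∃ l : List W, l.length = k ∧ (∀ t ∈ l, cs.IsReflection t) ∧ l.prod = w}

/-- `Red_T w`: the set of reduced reflection factorizations of `w`, i.e. tuples of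
reflections of length `ℓ_T w` with product `w`. -/
noncomputable def RedT {B W : Type*} [Group W] {M : CoxeterMatrix B}
    (cs : CoxeterSystem M W) (w : W) : Set (List W) :=
  {l | l.length = reflLen cs w ∧ (∀ t ∈ l, cs.IsReflection t) ∧ l.prod = w}

/-- A Hurwitz move: replace two consecutive entries `(t, t')` of a tuple by
`(t t' t⁻¹, t)`. -/
def HurwitzMove {W : Type*} [Group W] (a b : List W) : Prop :=
  ∃ (l₁ l₂ : List W) (t t' : W),
    a = l₁ ++ t :: t' :: l₂ ∧ b = l₁ ++ (t * t' * t⁻¹) :: t :: l₂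

/-- Two tuples are Hurwitz equivalent if they are connected by a finite sequence of
Hurwitz moves and their inverses. -/
def HurwitzEquiv {W : Type*} [Group W] : List W → List W → Prop :=
  Relation.ReflTransGen fun a b => HurwitzMove a b ∨ HurwitzMove b a

/-- A parabolic subgroup of a Coxeter system: a conjugate `u ⟨S'⟩ u⁻¹` of the subgroup
generated by a subset `S'` of the simple reflections. -/
def IsParabolic {B W : Type*} [Group W] {M : CoxeterMatrix B}
    (cs : CoxeterSystem M W) (P : Subgroup W) : Prop :=
  ∃ (u : W) (S' : Set B),
    P = (Subgroup.closure (cs.simple '' S')).map (MulAut.conj u).toMonoidHom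

namespace HurwitzRS

open scoped RealInnerProductSpace

section Basics

variable {V : Type*} [NormedAddCommGroup V] [InnerProductSpace ℝ V]

/-- The orthogonal reflection in the hyperplane orthogonal to `α`. -/
noncomputable def rf (α : V) : V ≃ₗᵢ[ℝ] V := (ℝ ∙ α)ᗮ.reflection

theorem rf_apply {α : V} (h : ⟪α, α⟫ = 2) (v : V) : rf α v = v - ⟪α, v⟫ • α := by
  have h0 : ‖α‖ ^ 2 = 2 := by rw [← real_inner_self_eq_norm_sq, h]
  rw [rf, Submodule.reflection_orthogonal_apply, Submodule.reflection_singleton_apply]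
  simp only [RCLike.ofReal_real_eq_id, id]
  rw [h0, two_smul, ← add_smul]
  have : ⟪α, v⟫ / 2 + ⟪α, v⟫ / 2 = ⟪α, v⟫ := by ring
  rw [this]; abel

theorem rf_neg (α : V) : rf (-α) = rf α := by
  unfold rf
  have : (ℝ ∙ (-α)) = (ℝ ∙ α) := by
    simpa using Submodule.span_neg ({α} : Set V) (R := ℝ)
  simp only [this]

theorem rf_rf (α v : V) : rf α (rf α v) = v := by
  simp [rf]

theorem rf_mul_self (α : V) : rf α * rf α = 1 := by
  ext v; exact rf_rf α v

theorem rf_inv (α : V) : (rf α)⁻¹ = rf α := inv_eq_of_mul_eq_one_left (rf_mul_self α)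

theorem rf_self (α : V) : rf α α = -α := by
  rw [rf, Submodule.reflection_orthogonalComplement_singleton_eq_neg]

theorem mul_app (g h : V ≃ₗᵢ[ℝ] V) (x : V) : (g * h) x = g (h x) := rfl

theorem app_inv_app (g : V ≃ₗᵢ[ℝ] V) (x : V) : g (g⁻¹ x) = x := by
  rw [← mul_app, mul_inv_cancel]; rfl

theorem inner_map (g : V ≃ₗᵢ[ℝ] V) (x y : V) : ⟪g x, g y⟫ = ⟪x, y⟫ := g.inner_map_map x y

theorem inner_inv (g : V ≃ₗᵢ[ℝ] V) (x y : V) : ⟪g⁻¹ x, y⟫ = ⟪x, g y⟫ := by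
  rw [← inner_map g, app_inv_app]

theorem rf_apply' (α v : V) : rf α v = v - (2 * (⟪α, v⟫ / ‖α‖ ^ 2)) • α := by
  rw [rf, Submodule.reflection_orthogonal_apply, Submodule.reflection_singleton_apply]
  simp only [RCLike.ofReal_real_eq_id, id]
  rw [two_smul, two_mul, ← add_smul, neg_sub]

theorem rf_conj (g : V ≃ₗᵢ[ℝ] V) (α : V) : rf (g α) = g * rf α * g⁻¹ := by
  ext v
  rw [rf_apply', mul_app, mul_app, rf_apply', map_sub, map_smul, app_inv_app,
    real_inner_comm (g⁻¹ v) α, inner_inv, real_inner_comm (g α), g.norm_map]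

theorem rf_rf_conj (a b : V) : rf (rf a b) = rf a * rf b * rf a := by
  rw [rf_conj _ b, rf_inv]

theorem inner_rf_rf (a x y : V) : ⟪rf a x, rf a y⟫ = ⟪x, y⟫ := inner_map _ _ _

theorem inner_rf_left (a x y : V) : ⟪rf a x, y⟫ = ⟪x, rf a y⟫ := by
  rw [← inner_rf_rf a, rf_rf]

/-- The product of the reflections in the vectors of a list. -/
noncomputable def pr (L : List V) : V ≃ₗᵢ[ℝ] V := (L.map rf).prod

@[simp] theorem pr_nil : pr ([] : List V) = 1 := rfl
@[simp] theorem pr_cons (a : V) (L : List V) : pr (a :: L) = rf a * pr L := by simp [pr]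
@[simp] theorem pr_append (L L' : List V) : pr (L ++ L') = pr L * pr L' := by simp [pr]

theorem pr_reverse (L : List V) : pr L.reverse = (pr L)⁻¹ := by
  induction L with
  | nil => simp
  | cons a L ih => simp [ih, rf_inv]

/-- The span of a list of vectors. -/
def sp (L : List V) : Submodule ℝ V := Submodule.span ℝ {x | x ∈ L}

theorem mem_sp {L : List V} {a : V} (h : a ∈ L) : a ∈ sp L := Submodule.subset_span h

@[simp] theorem sp_nil : sp ([] : List V) = ⊥ := by simp [sp]

theorem sp_cons (a : V) (L : List V) : sp (a :: L) = (ℝ ∙ a) ⊔ sp L := by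
  rw [sp, sp, ← Submodule.span_union]; congr 1; ext; simp

theorem sp_append (L L' : List V) : sp (L ++ L') = sp L ⊔ sp L' := by
  rw [sp, sp, sp, ← Submodule.span_union]; congr 1; ext; simp

theorem sp_le {L : List V} {U : Submodule ℝ V} : sp L ≤ U ↔ ∀ a ∈ L, a ∈ U :=
  Submodule.span_le

theorem sp_mono {L L' : List V} (h : ∀ a ∈ L, a ∈ L') : sp L ≤ sp L' :=
  sp_le.2 fun a ha => mem_sp (h a ha)

theorem sub_rf_mem (a v : V) : v - rf a v ∈ Submodule.span ℝ {a} := by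
  rw [rf, Submodule.reflection_orthogonal_apply, Submodule.reflection_singleton_apply,
    sub_neg_eq_add, add_sub_cancel]
  exact nsmul_mem (Submodule.smul_mem _ _ (Submodule.mem_span_singleton_self (R := ℝ) a)) 2

theorem sub_pr_mem (L : List V) (v : V) : v - pr L v ∈ sp L := by
  induction L with
  | nil => simp
  | cons a L ih =>
    have : v - pr (a :: L) v = (v - pr L v) + (pr L v - rf a (pr L v)) := by
      simp
    rw [this, sp_cons]
    exact add_mem (Submodule.mem_sup_right ih) (Submodule.mem_sup_left (sub_rf_mem _ _))

theorem rf_fix {a v : V} (h : ⟪a, v⟫ = 0) : rf a v = v := by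
  rw [rf]
  exact Submodule.reflection_mem_subspace_eq_self (Submodule.mem_orthogonal_singleton_iff_inner_right.2 h)

theorem pr_fix {L : List V} {v : V} (h : ∀ a ∈ L, ⟪a, v⟫ = 0) : pr L v = v := by
  induction L with
  | nil => simp
  | cons a L ih =>
    rw [pr_cons, mul_app, ih fun b hb => h b (by simp [hb]),
      rf_fix (h a (by simp))]

theorem pr_mem {L : List V} {v : V} {U : Submodule ℝ V} (hL : ∀ a ∈ L, a ∈ U) (h : v ∈ U) :
    pr L v ∈ U := by
  have := sub_pr_mem L v
  have h2 := sub_mem h (sp_le.2 hL this)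
  simpa using h2

/-- Linear independence of a list of vectors. -/
def Ind : List V → Prop
  | [] => True
  | a :: L => a ∉ sp L ∧ Ind L

instance fd_sp (L : List V) : FiniteDimensional ℝ (sp L) :=
  FiniteDimensional.span_of_finite ℝ (List.finite_toSet L)

theorem finrank_sp_cons_le (a : V) (L : List V) :
    Module.finrank ℝ (sp (a :: L)) ≤ Module.finrank ℝ (sp L) + 1 := by
  rw [sp_cons]
  have := Submodule.finrank_add_le_finrank_add_finrank (ℝ ∙ a) (sp L)
  have h2 := finrank_span_le_card (R := ℝ) ({a} : Set V)
  simp at h2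
  omega

theorem finrank_sp_le (L : List V) : Module.finrank ℝ (sp L) ≤ L.length := by
  induction L with
  | nil => simp
  | cons a L ih => have := finrank_sp_cons_le a L; simp; omega

theorem ind_iff (L : List V) : Ind L ↔ Module.finrank ℝ (sp L) = L.length := by
  induction L with
  | nil => simp [Ind]
  | cons a L ih =>
    rw [Ind, ih]
    have h1 := finrank_sp_cons_le a L
    have h2 := finrank_sp_le L
    simp only [List.length_cons]
    constructor
    · rintro ⟨h, h3⟩
      have : sp L < sp (a :: L) := by
        refine lt_of_le_of_ne (sp_mono (by simp +contextual)) fun h4 => h ?_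
        rw [h4]; exact mem_sp (by simp)
      have := Submodule.finrank_lt_finrank_of_lt this
      omega
    · intro h3
      refine ⟨fun h => ?_, by omega⟩
      have : sp (a :: L) = sp L := by
        rw [sp_cons, sup_eq_right]; simpa using h
      rw [this] at h3; omega

end Basics

end HurwitzRS

namespace HurwitzRS

open scoped RealInnerProductSpace

section Fixed

variable {V : Type*} [NormedAddCommGroup V] [InnerProductSpace ℝ V]

/-- The fixed space of a linear isometry. -/
def Fx (g : V ≃ₗᵢ[ℝ] V) : Submodule ℝ V :=
  LinearMap.ker (LinearMap.id - g.toLinearEquiv.toLinearMap)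

theorem mem_Fx {g : V ≃ₗᵢ[ℝ] V} {v : V} : v ∈ Fx g ↔ g v = v := by
  simp only [Fx, LinearMap.mem_ker, LinearMap.sub_apply, LinearMap.id_apply, sub_eq_zero]
  exact eq_comm

theorem sub_mem_orth (g : V ≃ₗᵢ[ℝ] V) (x : V) : x - g x ∈ (Fx g)ᗮ := by
  rw [Submodule.mem_orthogonal]
  intro u hu
  rw [mem_Fx] at hu
  rw [inner_sub_right, sub_eq_zero]
  conv_rhs => rw [← hu, inner_map]

theorem exists_sub_eq [FiniteDimensional ℝ V] {g : V ≃ₗᵢ[ℝ] V} {α : V} (h : α ∈ (Fx g)ᗮ) :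
    ∃ x, x - g x = α := by
  set φ : V →ₗ[ℝ] V := LinearMap.id - g.toLinearEquiv.toLinearMap with hφ
  have h1 : LinearMap.range φ ≤ (Fx g)ᗮ := by
    rintro _ ⟨x, rfl⟩; exact sub_mem_orth g x
  have h2 := LinearMap.finrank_range_add_finrank_ker φ
  have h3 := (Fx g).finrank_add_finrank_orthogonal
  have h4 : LinearMap.range φ = (Fx g)ᗮ := by
    apply Submodule.eq_of_le_of_finrank_eq h1
    change _ + Module.finrank ℝ (Fx g) = _ at h2
    omega
  rw [← h4] at h
  exact h

theorem inner_eq_zero_of_rf_fix {a v : V} (h : rf a v = v) : ⟪a, v⟫ = 0 := by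
  rw [rf, Submodule.reflection_eq_self_iff] at h
  exact Submodule.mem_orthogonal_singleton_iff_inner_right.1 h

theorem orth_of_pr_fix {L : List V} (hL : Ind L) {x : V} (h : pr L x = x) :
    ∀ a ∈ L, ⟪a, x⟫ = 0 := by
  induction L with
  | nil => simp
  | cons a L ih =>
    obtain ⟨ha, hL⟩ := hL
    rw [pr_cons, mul_app] at h
    have h1 := sub_pr_mem L x
    have h2 := sub_rf_mem a (pr L x)
    rw [h] at h2
    have h3 : pr L x = x := by
      obtain ⟨c, hc⟩ := Submodule.mem_span_singleton.1 h2
      by_cases hc0 : c = 0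
      · rw [hc0, zero_smul, eq_comm, sub_eq_zero] at hc; exact hc
      · exfalso; apply ha
        have : a = c⁻¹ • (pr L x - x) := by rw [← hc, smul_smul, inv_mul_cancel₀ hc0, one_smul]
        rw [this, ← neg_sub, smul_neg]
        exact neg_mem (Submodule.smul_mem _ _ h1)
    rw [h3] at h
    intro b hb
    rcases List.mem_cons.1 hb with rfl | hb
    · exact inner_eq_zero_of_rf_fix h
    · exact ih hL h3 b hb

theorem mem_sp_orth {L : List V} {x : V} : x ∈ (sp L)ᗮ ↔ ∀ a ∈ L, ⟪a, x⟫ = 0 := by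
  constructor
  · intro h a ha; exact (Submodule.mem_orthogonal _ _).1 h a (mem_sp ha)
  · intro h
    rw [Submodule.mem_orthogonal]
    intro u hu
    induction hu using Submodule.span_induction with
    | mem a ha => exact h a ha
    | zero => simp
    | add u v _ _ hu hv => rw [inner_add_left, hu, hv, add_zero]
    | smul c u _ hu => rw [inner_smul_left, hu, mul_zero]

theorem Fx_eq_orth {L : List V} (hL : Ind L) : Fx (pr L) = (sp L)ᗮ := by
  ext x
  rw [mem_Fx, mem_sp_orth]
  exact ⟨fun h => orth_of_pr_fix hL h, pr_fix⟩

theorem Fx_orth_le [FiniteDimensional ℝ V] (L : List V) : (Fx (pr L))ᗮ ≤ sp L := by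
  rw [← Submodule.orthogonal_orthogonal (sp L)]
  apply Submodule.orthogonal_le
  intro x hx
  rw [mem_Fx]; exact pr_fix (mem_sp_orth.1 hx)

theorem sp_eq_Fx_orth [FiniteDimensional ℝ V] {L : List V} (hL : Ind L) :
    sp L = (Fx (pr L))ᗮ := by
  rw [Fx_eq_orth hL, Submodule.orthogonal_orthogonal]

theorem ind_of_pr_eq [FiniteDimensional ℝ V] {L L' : List V} (hL : Ind L) (h : pr L = pr L')
    (hl : L'.length ≤ L.length) : sp L' = sp L ∧ Ind L' ∧ L'.length = L.length := by
  have h1 : sp L ≤ sp L' := by rw [sp_eq_Fx_orth hL, h]; exact Fx_orth_le L'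
  have h2 := finrank_sp_le L'
  have h3 := (ind_iff L).1 hL
  have h4 := Submodule.finrank_mono h1
  have h5 : sp L = sp L' := Submodule.eq_of_le_of_finrank_eq h1 (by omega)
  refine ⟨h5.symm, ?_, by omega⟩
  rw [ind_iff, ← h5]; omega

theorem length_eq_of_pr_eq [FiniteDimensional ℝ V] {L L' : List V} (hL : Ind L) (hL' : Ind L')
    (h : pr L = pr L') : L'.length = L.length := by
  rw [← (ind_iff L).1 hL, ← (ind_iff L').1 hL', sp_eq_Fx_orth hL, sp_eq_Fx_orth hL', h]

end Fixed

section Gen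

variable {V : Type*} [NormedAddCommGroup V] [InnerProductSpace ℝ V]

/-- The closure of a set of vectors under the reflections in its elements. -/
inductive Gen (X : Set V) : V → Prop
  | base {a : V} (h : a ∈ X) : Gen X a
  | step {a b : V} (ha : Gen X a) (hb : Gen X b) : Gen X (rf a b)

theorem Gen.neg {X : Set V} {a : V} (h : Gen X a) : Gen X (-a) := by
  rw [← rf_self]; exact Gen.step h h

theorem Gen.le {X : Set V} {P : V → Prop} (h : ∀ a ∈ X, P a)
    (hP : ∀ a b, P a → P b → P (rf a b)) {v : V} (hv : Gen X v) : P v := by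
  induction hv with
  | base hx => exact h _ hx
  | step _ _ h1 h2 => exact hP _ _ h1 h2

theorem Gen.trans {X Y : Set V} (h : ∀ a ∈ X, Gen Y a) {v : V} (hv : Gen X v) : Gen Y v :=
  Gen.le h (fun _ _ => Gen.step) hv

theorem Gen.mono {X Y : Set V} (h : X ⊆ Y) {v : V} (hv : Gen X v) : Gen Y v :=
  Gen.trans (fun _ ha => Gen.base (h ha)) hv

theorem rf_mem_sub {U : Submodule ℝ V} {a b : V} (ha : a ∈ U) (hb : b ∈ U) : rf a b ∈ U := by
  rw [rf_apply']; exact sub_mem hb (U.smul_mem _ ha)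

theorem Gen.mem_span {X : Set V} {v : V} (hv : Gen X v) : v ∈ Submodule.span ℝ X :=
  Gen.le (fun _ ha => Submodule.subset_span ha) (fun _ _ => rf_mem_sub) hv

theorem Gen.norm {X : Set V} (hX : ∀ a ∈ X, ⟪a, a⟫ = (2 : ℝ)) {v : V} (hv : Gen X v) :
    ⟪v, v⟫ = (2 : ℝ) :=
  Gen.le (P := fun v => ⟪v, v⟫ = (2 : ℝ)) hX (fun _ _ _ h => by rw [inner_rf_rf, h]) hv

/-- The reflection in an element of `Gen X` is a product of reflections in elements of `X`. -/
theorem Gen.exists_word {X : Set V} {v : V} (hv : Gen X v) :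
    ∃ L : List V, (∀ a ∈ L, a ∈ X) ∧ pr L = rf v := by
  induction hv with
  | @base a h => exact ⟨[a], by simpa, by simp⟩
  | @step a b _ _ h1 h2 =>
    obtain ⟨L1, h1, e1⟩ := h1
    obtain ⟨L2, h2, e2⟩ := h2
    refine ⟨L1 ++ L2 ++ L1, ?_, ?_⟩
    · intro x hx
      simp only [List.mem_append] at hx
      rcases hx with (hx | hx) | hx
      exacts [h1 x hx, h2 x hx, h1 x hx]
    · rw [pr_append, pr_append, e1, e2, rf_rf_conj]

theorem Gen.exists_word_list {X : Set V} {M : List V} (hM : ∀ a ∈ M, Gen X a) :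
    ∃ L : List V, (∀ a ∈ L, a ∈ X) ∧ pr L = pr M := by
  induction M with
  | nil => exact ⟨[], by simp, rfl⟩
  | cons a M ih =>
    obtain ⟨L1, h1, e1⟩ := (hM a (by simp)).exists_word
    obtain ⟨L2, h2, e2⟩ := ih fun b hb => hM b (by simp [hb])
    refine ⟨L1 ++ L2, ?_, by rw [pr_append, e1, e2, pr_cons]⟩
    intro x hx
    rcases List.mem_append.1 hx with hx | hx
    exacts [h1 x hx, h2 x hx]

theorem span_orth {A B : Set V} (hAB : ∀ a ∈ A, ∀ b ∈ B, ⟪a, b⟫ = (0 : ℝ)) {x y : V}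
    (hx : x ∈ Submodule.span ℝ A) (hy : y ∈ Submodule.span ℝ B) : ⟪x, y⟫ = (0 : ℝ) := by
  induction hx using Submodule.span_induction with
  | mem a ha =>
    induction hy using Submodule.span_induction with
    | mem b hb => exact hAB a ha b hb
    | zero => simp
    | add u v _ _ hu hv => rw [inner_add_right, hu, hv, add_zero]
    | smul c u _ hu => rw [inner_smul_right, hu, mul_zero]
  | zero => simp
  | add u v _ _ hu hv => rw [inner_add_left, hu, hv, add_zero]
  | smul c u _ hu => rw [inner_smul_left, hu, mul_zero]

theorem gen_split {A B : Set V} (hAB : ∀ a ∈ A, ∀ b ∈ B, ⟪a, b⟫ = (0 : ℝ)) {v : V}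
    (hv : Gen (A ∪ B) v) : Gen A v ∨ Gen B v := by
  have key : ∀ a b, Gen A a → Gen B b → ⟪a, b⟫ = (0 : ℝ) := fun a b ha hb =>
    span_orth hAB ha.mem_span hb.mem_span
  induction hv with
  | base h => exact h.imp Gen.base Gen.base
  | @step a b _ _ h1 h2 =>
    rcases h1 with h1 | h1 <;> rcases h2 with h2 | h2
    · exact Or.inl (Gen.step h1 h2)
    · rw [rf_fix (key a b h1 h2)]; exact Or.inr h2
    · rw [rf_fix (by rw [real_inner_comm]; exact key b a h2 h1)]; exact Or.inl h2
    · exact Or.inr (Gen.step h1 h2)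

end Gen

section HV

variable {V : Type*} [NormedAddCommGroup V] [InnerProductSpace ℝ V]

/-- Hurwitz equivalence for lists of roots, up to changing signs. -/
inductive HV : List V → List V → Prop
  | refl (L) : HV L L
  | symm {L L'} : HV L L' → HV L' L
  | trans {L L' L''} : HV L L' → HV L' L'' → HV L L''
  | cons (a) {L L'} : HV L L' → HV (a :: L) (a :: L')
  | swap (a b L) : HV (a :: b :: L) (rf a b :: a :: L)
  | neg (a L) : HV (a :: L) (-a :: L)

theorem HV.length {L L' : List V} (h : HV L L') : L'.length = L.length := by
  induction h <;> simp_all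

theorem HV.pr {L L' : List V} (h : HV L L') : pr L' = pr L := by
  induction h with
  | refl => rfl
  | symm _ h => exact h.symm
  | trans _ _ h1 h2 => exact h2.trans h1
  | cons a _ h => simp [h]
  | swap a b L =>
    simp only [pr_cons, rf_rf_conj, ← mul_assoc]
    rw [mul_assoc (rf a * rf b), rf_mul_self, mul_one]
  | neg a L => simp [rf_neg]

theorem HV.forall_mem {P : V → Prop} (hP : ∀ a b, P a → P b → P (rf a b)) {L L' : List V}
    (h : HV L L') : (∀ a ∈ L, P a) ↔ ∀ a ∈ L', P a := by
  have hn : ∀ a, P a → P (-a) := fun a ha => by rw [← rf_self]; exact hP _ _ ha ha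
  induction h with
  | refl => rfl
  | symm _ h => exact h.symm
  | trans _ _ h1 h2 => exact h1.trans h2
  | cons a _ h => simp only [List.forall_mem_cons, h]
  | swap a b L =>
    simp only [List.forall_mem_cons]
    constructor
    · rintro ⟨h1, h2, h3⟩; exact ⟨hP _ _ h1 h2, h1, h3⟩
    · rintro ⟨h1, h2, h3⟩; refine ⟨h2, ?_, h3⟩; rw [← rf_rf a b]; exact hP _ _ h2 h1
  | neg a L =>
    simp only [List.forall_mem_cons]
    exact and_congr_left fun _ => ⟨hn a, fun h => by simpa using hn _ h⟩

theorem HV.gen {L L' : List V} (h : HV L L') (v : V) :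
    Gen {x | x ∈ L} v ↔ Gen {x | x ∈ L'} v := by
  constructor
  · exact Gen.trans ((HV.forall_mem (P := Gen {x | x ∈ L'}) (fun _ _ => Gen.step) h).2
      fun a ha => Gen.base ha)
  · exact Gen.trans ((HV.forall_mem (P := Gen {x | x ∈ L}) (fun _ _ => Gen.step) h).1
      fun a ha => Gen.base ha)

theorem HV.sp {L L' : List V} (h : HV L L') : sp L' = sp L := by
  apply le_antisymm
  · exact sp_le.2 ((HV.forall_mem (P := (· ∈ HurwitzRS.sp L)) (fun _ _ => rf_mem_sub) h).1 fun a => mem_sp)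
  · exact sp_le.2 ((HV.forall_mem (P := (· ∈ HurwitzRS.sp L')) (fun _ _ => rf_mem_sub) h).2 fun a => mem_sp)

theorem HV.ind {L L' : List V} (h : HV L L') (hL : Ind L) : Ind L' := by
  rw [ind_iff] at *; rw [h.sp, h.length, hL]

theorem HV.append_left (A : List V) {L L' : List V} (h : HV L L') : HV (A ++ L) (A ++ L') := by
  induction A with
  | nil => exact h
  | cons a A ih => exact HV.cons a ih

theorem HV.append_right (A : List V) {L L' : List V} (h : HV L L') : HV (L ++ A) (L' ++ A) := by
  induction h with
  | refl => exact HV.refl _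
  | symm _ h => exact h.symm
  | trans _ _ h1 h2 => exact h1.trans h2
  | cons a _ h => exact HV.cons a h
  | swap a b L => exact HV.swap a b _
  | neg a L => exact HV.neg a _

theorem HV.front (A : List V) (a : V) (B : List V) :
    HV (A ++ a :: B) (HurwitzRS.pr A a :: (A ++ B)) := by
  induction A with
  | nil => exact HV.refl _
  | cons b A ih => exact (HV.cons b ih).trans (HV.swap b _ _)

theorem HV.front_orth {A : List V} {b : V} (B : List V) (h : ∀ a ∈ A, ⟪a, b⟫ = (0 : ℝ)) :
    HV (A ++ b :: B) (b :: (A ++ B)) := by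
  have := HV.front A b B
  rwa [pr_fix h] at this

/-- Elements satisfying `p` can be moved to the front if they are orthogonal to the others. -/
theorem HV.filter {p : V → Prop} [DecidablePred p] {L : List V}
    (h : ∀ a ∈ L, ∀ b ∈ L, p a → ¬ p b → ⟪a, b⟫ = (0 : ℝ)) :
    HV L (L.filter (fun a => p a) ++ L.filter (fun a => ¬ p a)) := by
  induction L with
  | nil => exact HV.refl _
  | cons a L ih =>
    have ih := ih fun x hx y hy => h x (by simp [hx]) y (by simp [hy])
    by_cases ha : p a
    · simp only [ha, List.filter_cons, decide_true, if_true, not_true, decide_false]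
      exact HV.cons a ih
    · simp only [ha, List.filter_cons, decide_true, if_true, not_false_iff, decide_false]
      refine (HV.cons a ih).trans (HV.front_orth _ ?_).symm
      intro b hb
      simp only [List.mem_filter, decide_eq_true_eq] at hb
      exact h b (by simp [hb]) a (by simp) hb.2 ha

end HV

end HurwitzRS

namespace HurwitzRS

open scoped RealInnerProductSpace

section RootSystem

variable {V : Type*} [NormedAddCommGroup V] [InnerProductSpace ℝ V]

/-- A finite root system all of whose roots have squared norm two. -/
structure IsRS (Φ : Set V) : Prop where
  fin : Φ.Finite
  norm : ∀ a ∈ Φ, ⟪a, a⟫ = (2 : ℝ)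
  refl : ∀ a ∈ Φ, ∀ b ∈ Φ, rf a b ∈ Φ

theorem IsRS.neg {Φ : Set V} (h : IsRS Φ) {a : V} (ha : a ∈ Φ) : -a ∈ Φ := by
  rw [← rf_self]; exact h.refl a ha a ha

theorem IsRS.ne_zero {Φ : Set V} (h : IsRS Φ) {a : V} (ha : a ∈ Φ) : a ≠ 0 := by
  rintro rfl; have := h.norm _ ha; simp at this

theorem IsRS.gen_sub {Φ : Set V} (h : IsRS Φ) {X : Set V} (hX : X ⊆ Φ) {v : V} (hv : Gen X v) :
    v ∈ Φ :=
  Gen.le (P := (· ∈ Φ)) hX (fun a b ha hb => h.refl a ha b hb) hv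

theorem IsRS.gen {Φ : Set V} (h : IsRS Φ) {X : Set V} (hX : X ⊆ Φ) : IsRS {v | Gen X v} where
  fin := h.fin.subset fun _ hv => h.gen_sub hX hv
  norm a ha := h.norm a (h.gen_sub hX ha)
  refl _ ha _ hb := Gen.step ha hb

theorem IsRS.inter {Φ : Set V} (h : IsRS Φ) (U : Submodule ℝ V) : IsRS (Φ ∩ U) where
  fin := h.fin.subset Set.inter_subset_left
  norm a ha := h.norm a ha.1
  refl a ha b hb := ⟨h.refl a ha.1 b hb.1, rf_mem_sub ha.2 hb.2⟩

theorem IsRS.pr_mem {Φ : Set V} (h : IsRS Φ) {L : List V} (hL : ∀ a ∈ L, a ∈ Φ) {v : V}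
    (hv : v ∈ Φ) : pr L v ∈ Φ := by
  induction L with
  | nil => simpa
  | cons a L ih =>
    rw [pr_cons, mul_app]
    exact h.refl a (hL a (by simp)) _ (ih fun b hb => hL b (by simp [hb]))

/-- Proportional vectors of the same norm agree up to sign. -/
theorem eq_or_neg_of_smul {a b : V} (ha : ⟪a, a⟫ = (2 : ℝ)) (hb : ⟪b, b⟫ = (2 : ℝ)) {c : ℝ}
    (h : b = c • a) : b = a ∨ b = -a := by
  have : c * c = 1 := by
    rw [h, inner_smul_left, inner_smul_right, ha] at hb
    simp at hb; nlinarith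
  rcases mul_self_eq_one_iff.1 this with h1 | h1 <;> subst h1 <;> simp [h]

theorem exists_perturb {S : Set V} (hS : S.Finite) (f₀ f₁ : V) :
    ∃ ε : ℝ, 0 < ε ∧ ∀ b ∈ S, (0 < ⟪b, f₀⟫ → 0 < ⟪b, f₀ + ε • f₁⟫) ∧
      (⟪b, f₀⟫ < 0 → ⟪b, f₀ + ε • f₁⟫ < 0) := by
  have h : ∀ b ∈ S, ∀ᶠ ε : ℝ in nhdsWithin 0 (Set.Ioi 0),
      ((0 < ⟪b, f₀⟫ → 0 < ⟪b, f₀ + ε • f₁⟫) ∧ (⟪b, f₀⟫ < 0 → ⟪b, f₀ + ε • f₁⟫ < 0)) := by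
    intro b _
    have hc : Continuous fun ε : ℝ => ⟪b, f₀ + ε • f₁⟫ := by fun_prop
    have hc0 : Filter.Tendsto (fun ε : ℝ => ⟪b, f₀ + ε • f₁⟫) (nhdsWithin 0 (Set.Ioi 0))
        (nhds ⟪b, f₀⟫) := by
      have := hc.tendsto 0
      simp only [zero_smul, add_zero] at this
      exact this.mono_left nhdsWithin_le_nhds
    rcases lt_trichotomy ⟪b, f₀⟫ 0 with h | h | h
    · filter_upwards [hc0.eventually (gt_mem_nhds h)] with ε hε
      exact ⟨fun h' => absurd h' h.not_gt, fun _ => hε⟩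
    · exact Filter.Eventually.of_forall fun ε => ⟨fun h' => absurd h h'.ne', fun h' => absurd h h'.ne⟩
    · filter_upwards [hc0.eventually (lt_mem_nhds h)] with ε hε
      exact ⟨fun _ => hε, fun h' => absurd h' h.not_gt⟩
  have h2 := (Filter.eventually_all_finite hS).2 h
  obtain ⟨ε, hε, h3⟩ := (h2.and self_mem_nhdsWithin).exists
  exact ⟨ε, h3, hε⟩

/-- A subspace contains a vector avoiding finitely many hyperplanes not containing it. -/
theorem exists_generic (U : Submodule ℝ V) {S : Set V} (hS : S.Finite)
    (h : ∀ a ∈ S, ∃ y ∈ U, ⟪a, y⟫ ≠ (0 : ℝ)) : ∃ y ∈ U, ∀ a ∈ S, ⟪a, y⟫ ≠ (0 : ℝ) := by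
  induction S, hS using Set.Finite.induction_on with
  | empty => exact ⟨0, U.zero_mem, by simp⟩
  | @insert a S ha hS ih =>
    obtain ⟨y, hy, hyS⟩ := ih fun b hb => h b (by simp [hb])
    by_cases hay : ⟪a, y⟫ = (0 : ℝ)
    · obtain ⟨z, hz, haz⟩ := h a (by simp)
      obtain ⟨ε, hε, he⟩ := exists_perturb hS y z
      refine ⟨y + ε • z, U.add_mem hy (U.smul_mem _ hz), ?_⟩
      intro b hb
      rcases Set.mem_insert_iff.1 hb with rfl | hb
      · rw [inner_add_right, hay, inner_smul_right, zero_add]; exact mul_ne_zero hε.ne' haz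
      · rcases lt_or_gt_of_ne (hyS b hb) with h1 | h1
        · exact ((he b hb).2 h1).ne
        · exact ((he b hb).1 h1).ne'
    · refine ⟨y, hy, ?_⟩
      intro b hb
      rcases Set.mem_insert_iff.1 hb with rfl | hb
      exacts [hay, hyS b hb]

theorem IsRS.exists_regular {Φ : Set V} (hΦ : IsRS Φ) (f₀ : V) :
    ∃ f, (∀ b ∈ Φ, ⟪b, f⟫ ≠ (0 : ℝ)) ∧ ∀ b ∈ Φ, 0 < ⟪b, f₀⟫ → (0 : ℝ) < ⟪b, f⟫ := by
  obtain ⟨f₁, -, h1⟩ := exists_generic ⊤ hΦ.fin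
    (fun a ha => ⟨a, trivial, by rw [hΦ.norm a ha]; norm_num⟩)
  obtain ⟨ε, hε, he⟩ := exists_perturb hΦ.fin f₀ f₁
  refine ⟨f₀ + ε • f₁, fun b hb => ?_, fun b hb => (he b hb).1⟩
  rcases lt_trichotomy ⟪b, f₀⟫ 0 with h | h | h
  · exact ((he b hb).2 h).ne
  · rw [inner_add_right, h, inner_smul_right, zero_add]; exact mul_ne_zero hε.ne' (h1 b hb)
  · exact ((he b hb).1 h).ne'

/-- The nonnegative combinations of a finite set of vectors. -/
def cone (Δ : Finset V) : Set V := {v | ∃ c : V → ℝ, (∀ d ∈ Δ, 0 ≤ c d) ∧ v = ∑ d ∈ Δ, c d • d}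

theorem cone_add {Δ : Finset V} {x y : V} (hx : x ∈ cone Δ) (hy : y ∈ cone Δ) :
    x + y ∈ cone Δ := by
  obtain ⟨c, hc, rfl⟩ := hx
  obtain ⟨c', hc', rfl⟩ := hy
  refine ⟨fun d => c d + c' d, fun d hd => add_nonneg (hc d hd) (hc' d hd), ?_⟩
  simp only [add_smul, Finset.sum_add_distrib]

theorem cone_smul {Δ : Finset V} {x : V} (hx : x ∈ cone Δ) {t : ℝ} (ht : 0 ≤ t) :
    t • x ∈ cone Δ := by
  obtain ⟨c, hc, rfl⟩ := hx
  refine ⟨fun d => t * c d, fun d hd => mul_nonneg ht (hc d hd), ?_⟩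
  simp only [Finset.smul_sum, mul_smul]

theorem cone_zero (Δ : Finset V) : (0 : V) ∈ cone Δ := ⟨0, by simp, by simp⟩

theorem cone_self {Δ : Finset V} {d : V} (hd : d ∈ Δ) : d ∈ cone Δ := by
  classical
  refine ⟨fun e => if e = d then 1 else 0, fun e _ => ?_, ?_⟩
  · dsimp only; split_ifs <;> norm_num
  · simp [hd]

theorem cone_trans {Δ Δ' : Finset V} (h : ∀ d ∈ Δ, d ∈ cone Δ') {x : V} (hx : x ∈ cone Δ) :
    x ∈ cone Δ' := by
  obtain ⟨c, hc, rfl⟩ := hx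
  have : ∀ S : Finset V, S ⊆ Δ → ∑ d ∈ S, c d • d ∈ cone Δ' := by
    classical
    intro S
    induction S using Finset.induction_on with
    | empty => intro _; simpa using cone_zero Δ'
    | insert a S ha ih =>
      intro hS
      rw [Finset.sum_insert ha]
      have haΔ := hS (Finset.mem_insert_self a S)
      exact cone_add (cone_smul (h a haΔ) (hc a haΔ))
        (ih fun x hx => hS (Finset.mem_insert_of_mem hx))
  exact this Δ subset_rfl

theorem cone_mono {Δ Δ' : Finset V} (h : Δ ⊆ Δ') {x : V} (hx : x ∈ cone Δ) : x ∈ cone Δ' :=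
  cone_trans (fun _ hd => cone_self (h hd)) hx

theorem cone_inner_nonneg {Δ : Finset V} {f : V} (hf : ∀ d ∈ Δ, (0 : ℝ) ≤ ⟪d, f⟫) {x : V}
    (hx : x ∈ cone Δ) : (0 : ℝ) ≤ ⟪x, f⟫ := by
  obtain ⟨c, hc, rfl⟩ := hx
  rw [sum_inner]
  exact Finset.sum_nonneg fun d hd => by
    rw [inner_smul_left]; exact mul_nonneg (hc d hd) (hf d hd)

/-- Simple systems of a root system. -/
structure IsSimple (Φ : Set V) (Δ : Finset V) : Prop where
  sub : ∀ d ∈ Δ, d ∈ Φ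
  li : ∀ g : V → ℝ, ∑ d ∈ Δ, g d • d = 0 → ∀ d ∈ Δ, g d = 0
  pos : ∀ b ∈ Φ, b ∈ cone Δ ∨ -b ∈ cone Δ
  ex : ∃ f, ∀ d ∈ Δ, (0 : ℝ) < ⟪d, f⟫

theorem li_of_obtuse {Δ : Finset V} {f : V} (hf : ∀ d ∈ Δ, (0 : ℝ) < ⟪d, f⟫)
    (h : ∀ d ∈ Δ, ∀ e ∈ Δ, d ≠ e → ⟪d, e⟫ ≤ (0 : ℝ)) (g : V → ℝ)
    (hg : ∑ d ∈ Δ, g d • d = 0) : ∀ d ∈ Δ, g d = 0 := by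
  have key : ∀ g : V → ℝ, ∑ d ∈ Δ, g d • d = 0 → ∀ d ∈ Δ, g d ≤ 0 := by
    intro g hg
    set v := ∑ d ∈ Δ, max (g d) 0 • d with hv
    have hv' : v = ∑ d ∈ Δ, max (-g d) 0 • d := by
      rw [← sub_eq_zero, hv, ← Finset.sum_sub_distrib, ← hg]
      apply Finset.sum_congr rfl
      intro d _
      rw [← sub_smul]
      congr 1
      rcases le_total (g d) 0 with h | h
      · rw [max_eq_right h, max_eq_left (by linarith)]; ring
      · rw [max_eq_left h, max_eq_right (by linarith)]; ring
    have h1 : ⟪v, v⟫ ≤ (0 : ℝ) := by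
      nth_rewrite 1 [hv]
      rw [hv', sum_inner]
      apply Finset.sum_nonpos
      intro d hd
      rw [inner_sum]
      apply Finset.sum_nonpos
      intro e he
      rw [inner_smul_left, inner_smul_right]
      simp only [RCLike.conj_to_real]
      by_cases hde : d = e
      · subst hde
        rcases le_total (g d) 0 with h | h
        · rw [max_eq_right h]; simp
        · rw [max_eq_right (by linarith : -g d ≤ 0)]; simp
      · have h2 := h d hd e he hde
        have h3 := le_max_right (g d) 0
        have h4 := le_max_right (-g e) 0
        have := mul_nonneg h3 h4
        rw [← mul_assoc]
        exact mul_nonpos_of_nonneg_of_nonpos this h2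
    have h2 : v = 0 := by
      apply inner_self_eq_zero (𝕜 := ℝ).1
      exact le_antisymm h1 real_inner_self_nonneg
    have h3 : ⟪v, f⟫ = (0 : ℝ) := by rw [h2, inner_zero_left]
    rw [hv, sum_inner, Finset.sum_eq_zero_iff_of_nonneg] at h3
    · intro d hd
      have := h3 d hd
      rw [inner_smul_left] at this
      rcases mul_eq_zero.1 this with h4 | h4
      · simp only [RCLike.conj_to_real] at h4
        have := le_max_left (g d) 0
        linarith
      · exact absurd h4 (hf d hd).ne'
    · intro d hd
      rw [inner_smul_left]
      exact mul_nonneg (le_max_right _ _) (hf d hd).le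
  intro d hd
  apply le_antisymm (key g hg d hd)
  have := key (fun d => -g d) (by simp [hg]) d hd
  linarith

theorem IsRS.exists_simple {Φ : Set V} (hΦ : IsRS Φ) {f : V} (hf : ∀ b ∈ Φ, ⟪b, f⟫ ≠ (0 : ℝ)) :
    ∃ Δ, IsSimple Φ Δ ∧ ∀ d ∈ Δ, (0 : ℝ) < ⟪d, f⟫ := by
  classical
  have hfin : {b ∈ Φ | (0 : ℝ) < ⟪b, f⟫}.Finite := hΦ.fin.subset (Set.sep_subset _ _)
  set P := hfin.toFinset with hP
  have memP : ∀ b, b ∈ P ↔ b ∈ Φ ∧ (0 : ℝ) < ⟪b, f⟫ := by simp [hP]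
  have hne : (P.powerset.filter fun Δ => ∀ b ∈ P, b ∈ cone Δ).Nonempty :=
    ⟨P, by simpa using fun b hb => cone_self hb⟩
  obtain ⟨Δ, hΔ, hmin⟩ := Finset.exists_min_image _ Finset.card hne
  simp only [Finset.mem_filter, Finset.mem_powerset] at hΔ hmin
  obtain ⟨hΔP, hΔc⟩ := hΔ
  have hpos : ∀ d ∈ Δ, (0 : ℝ) < ⟪d, f⟫ := fun d hd => ((memP d).1 (hΔP hd)).2
  have hirr : ∀ d ∈ Δ, d ∉ cone (Δ.erase d) := by
    intro d hd h
    have h1 : ∀ b ∈ P, b ∈ cone (Δ.erase d) := fun b hb => by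
      refine cone_trans (fun e he => ?_) (hΔc b hb)
      by_cases hed : e = d
      · rwa [hed]
      · exact cone_self (Finset.mem_erase.2 ⟨hed, he⟩)
    have := hmin _ ⟨(Finset.erase_subset d Δ).trans hΔP, h1⟩
    have h2 := Finset.card_erase_lt_of_mem hd
    omega
  have key : ∀ d ∈ Δ, ∀ e ∈ Δ, d ≠ e → ∀ k : ℝ, 0 < k → ∀ x ∈ cone Δ, e ≠ k • d + x := by
    intro d hd e he hde k hk x hx heq
    obtain ⟨c, hc, rfl⟩ := hx
    rw [← Finset.add_sum_erase _ _ he] at heq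
    set y := ∑ x ∈ Δ.erase e, c x • x with hy
    have hyc : y ∈ cone (Δ.erase e) := ⟨c, fun d hd => hc d (Finset.mem_of_mem_erase hd), hy⟩
    have hzc : k • d + y ∈ cone (Δ.erase e) :=
      cone_add (cone_smul (cone_self (Finset.mem_erase.2 ⟨hde, hd⟩)) hk.le) hyc
    have hyf : (0 : ℝ) ≤ ⟪y, f⟫ :=
      cone_inner_nonneg (fun d hd => (hpos d (Finset.mem_of_mem_erase hd)).le) hyc
    rcases lt_or_ge (c e) 1 with h1 | h1
    · apply hirr e he
      have h2 : e = (1 - c e)⁻¹ • (k • d + y) := by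
        have h3 : (1 - c e) • e = k • d + y := by
          rw [sub_smul, one_smul]; nth_rewrite 1 [heq]; abel
        rw [← h3, smul_smul, inv_mul_cancel₀ (by linarith), one_smul]
      have h4 := cone_smul hzc (t := (1 - c e)⁻¹) (inv_nonneg.2 (by linarith))
      rwa [← h2] at h4
    · have h2 : ⟪e, f⟫ = k * ⟪d, f⟫ + (c e * ⟪e, f⟫ + ⟪y, f⟫) := by
        conv_lhs => rw [heq]
        rw [inner_add_left, inner_add_left, inner_smul_left, inner_smul_left]; rfl
      have h3 := mul_pos hk (hpos d hd)
      have h4 := hpos e he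
      nlinarith
  have hobt : ∀ d ∈ Δ, ∀ e ∈ Δ, d ≠ e → ⟪d, e⟫ ≤ (0 : ℝ) := by
    intro d hd e he hde
    by_contra! hk
    set k := ⟪d, e⟫ with hkd
    have hdΦ := ((memP d).1 (hΔP hd)).1
    have heΦ := ((memP e).1 (hΔP he)).1
    have h1 : rf d e = e - k • d := rf_apply (hΦ.norm d hdΦ) e
    have h2 := hΦ.refl d hdΦ e heΦ
    rcases lt_or_gt_of_ne (hf _ h2) with h3 | h3
    · have h4 : -rf d e ∈ cone Δ := hΔc _ ((memP _).2 ⟨hΦ.neg h2, by rw [inner_neg_left]; linarith⟩)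
      refine key e he d hd hde.symm k⁻¹ (inv_pos.2 hk) (k⁻¹ • -rf d e)
        (cone_smul h4 (inv_pos.2 hk).le) ?_
      rw [← smul_add, h1]
      simp only [neg_sub, add_sub_cancel]
      rw [smul_smul, inv_mul_cancel₀ hk.ne', one_smul]
    · have h4 : rf d e ∈ cone Δ := hΔc _ ((memP _).2 ⟨h2, h3⟩)
      exact key d hd e he hde k hk _ h4 (by rw [h1]; abel)
  refine ⟨Δ, ⟨fun d hd => ((memP d).1 (hΔP hd)).1, li_of_obtuse hpos hobt, ?_, f, hpos⟩, hpos⟩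
  intro b hb
  rcases lt_or_gt_of_ne (hf b hb) with h3 | h3
  · exact Or.inr (hΔc _ ((memP _).2 ⟨hΦ.neg hb, by rw [inner_neg_left]; linarith⟩))
  · exact Or.inl (hΔc _ ((memP _).2 ⟨hb, h3⟩))

end RootSystem

end HurwitzRS

namespace HurwitzRS

open scoped RealInnerProductSpace

section Simple

variable {V : Type*} [NormedAddCommGroup V] [InnerProductSpace ℝ V]

theorem IsSimple.coef_eq {Φ : Set V} {Δ : Finset V} (h : IsSimple Φ Δ) {g g' : V → ℝ}
    (e : ∑ d ∈ Δ, g d • d = ∑ d ∈ Δ, g' d • d) : ∀ d ∈ Δ, g d = g' d := by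
  intro d hd
  have := h.li (fun d => g d - g' d) (by
    simp only [sub_smul, Finset.sum_sub_distrib, e, sub_self]) d hd
  linarith

theorem IsSimple.nonneg_or {Φ : Set V} {Δ : Finset V} (h : IsSimple Φ Δ) {b : V} (hb : b ∈ Φ)
    {g : V → ℝ} (e : b = ∑ d ∈ Δ, g d • d) : (∀ d ∈ Δ, 0 ≤ g d) ∨ ∀ d ∈ Δ, g d ≤ 0 := by
  rcases h.pos b hb with ⟨c, hc, he⟩ | ⟨c, hc, he⟩
  · left
    intro d hd
    rw [h.coef_eq (e.symm.trans he) d hd]; exact hc d hd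
  · right
    intro d hd
    have : ∑ d ∈ Δ, g d • d = ∑ d ∈ Δ, (-c d) • d := by
      simp only [neg_smul, Finset.sum_neg_distrib, ← he, ← e, neg_neg]
    rw [h.coef_eq this d hd]; simpa using hc d hd

theorem sum_sub_single [DecidableEq V] {Δ : Finset V} {d : V} (hd : d ∈ Δ) (g : V → ℝ) (k : ℝ) :
    ∑ e ∈ Δ, g e • e - k • d = ∑ e ∈ Δ, (g e - if e = d then k else 0) • e := by
  simp only [sub_smul, Finset.sum_sub_distrib, ite_smul, zero_smul, Finset.sum_ite_eq', hd, if_true]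

/-- A simple reflection preserves the positivity of the other roots. -/
theorem IsSimple.refl_cone {Φ : Set V} {Δ : Finset V} (hΦ : IsRS Φ) (h : IsSimple Φ Δ) {d b : V}
    (hd : d ∈ Δ) (hb : b ∈ Φ) (hbc : b ∈ cone Δ) (hne : b ≠ d) : rf d b ∈ cone Δ := by
  classical
  obtain ⟨c, hc, he⟩ := hbc
  have hdΦ := h.sub d hd
  have h1 : rf d b = ∑ e ∈ Δ, (c e - if e = d then ⟪d, b⟫ else 0) • e := by
    rw [rf_apply (hΦ.norm d hdΦ), ← sum_sub_single hd, ← he]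
  rcases h.nonneg_or (hΦ.refl d hdΦ b hb) h1 with h2 | h2
  · exact ⟨_, h2, h1⟩
  · exfalso
    have h3 : ∀ e ∈ Δ, e ≠ d → c e = 0 := fun e he' hed => by
      have := h2 e he'; rw [if_neg hed] at this
      exact le_antisymm (by linarith) (hc e he')
    have h4 : b = c d • d := by
      rw [he]
      exact Finset.sum_eq_single d (fun e he' hed => by rw [h3 e he' hed, zero_smul])
        (fun h' => absurd hd h')
    rcases eq_or_neg_of_smul (hΦ.norm d hdΦ) (hΦ.norm b hb) h4 with h5 | h5
    · exact hne h5
    · have h6 : (c d + 1) • d = 0 := by rw [add_smul, one_smul, ← h4, h5, neg_add_cancel]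
      rcases smul_eq_zero.1 h6 with h7 | h7
      · have := hc d hd; linarith
      · exact hΦ.ne_zero hdΦ h7

theorem IsSimple.obtuse {Φ : Set V} {Δ : Finset V} (hΦ : IsRS Φ) (h : IsSimple Φ Δ) {d e : V}
    (hd : d ∈ Δ) (he : e ∈ Δ) (hne : d ≠ e) : ⟪d, e⟫ ≤ (0 : ℝ) := by
  classical
  obtain ⟨c, hc, h1⟩ := h.refl_cone hΦ hd (h.sub e he) (cone_self he) hne.symm
  have h2 : e - ⟪d, e⟫ • d = ∑ x ∈ Δ, c x • x := by
    rw [← h1, rf_apply (hΦ.norm d (h.sub d hd))]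
  have h3 : ∑ x ∈ Δ, ((if x = e then 1 else 0) - (if x = d then ⟪d, e⟫ else 0)) • x
      = ∑ x ∈ Δ, c x • x := by
    rw [← h2, ← sum_sub_single hd]; simp [he]
  have h4 := h.coef_eq h3 d hd
  simp only [if_neg hne, if_true] at h4
  have := hc d hd
  linarith

theorem IsSimple.not_both {Φ : Set V} {Δ : Finset V} (h : IsSimple Φ Δ) {b : V} (hb : b ∈ cone Δ)
    (hb' : -b ∈ cone Δ) : b = 0 := by
  obtain ⟨c, hc, he⟩ := hb
  obtain ⟨c', hc', he'⟩ := hb'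
  have h1 : ∑ d ∈ Δ, c d • d = ∑ d ∈ Δ, (-c' d) • d := by
    simp only [neg_smul, Finset.sum_neg_distrib, ← he, ← he', neg_neg]
  rw [he]
  apply Finset.sum_eq_zero
  intro d hd
  have := h.coef_eq h1 d hd
  rw [le_antisymm (by linarith [hc' d hd]) (hc d hd), zero_smul]

theorem sum_extend [DecidableEq V] {S Δ : Finset V} (h : S ⊆ Δ) (c : V → ℝ) :
    ∑ d ∈ S, c d • d = ∑ d ∈ Δ, (if d ∈ S then c d else 0) • d := by
  rw [← Finset.sum_subset h (f := fun d => (if d ∈ S then c d else 0) • d)]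
  · exact Finset.sum_congr rfl fun d hd => by simp [hd]
  · intro d _ hd; simp [hd]

/-- A root in the cone of a set of simple roots is generated by these simple roots. -/
theorem IsSimple.gen_of_cone {Φ : Set V} {Δ : Finset V} (hΦ : IsRS Φ) (h : IsSimple Φ Δ)
    {S : Finset V} (hS : S ⊆ Δ) {b : V} (hb : b ∈ Φ) (hbS : b ∈ cone S) : Gen ↑S b := by
  classical
  obtain ⟨f, hf⟩ := h.ex
  have key : ∀ n : ℕ, ∀ b ∈ Φ, b ∈ cone S → {x ∈ Φ | (⟪x, f⟫ : ℝ) < ⟪b, f⟫}.ncard < n →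
      Gen ↑S b := by
    intro n
    induction n with
    | zero => intro b _ _ h; omega
    | succ n ih =>
      intro b hb hbS hn
      obtain ⟨c, hc, he⟩ := id hbS
      have h1 : ∃ d ∈ S, (0 : ℝ) < ⟪d, b⟫ := by
        by_contra! hcon
        have h2 : ⟪b, b⟫ ≤ (0 : ℝ) := by
          nth_rewrite 1 [he]
          rw [sum_inner]
          exact Finset.sum_nonpos fun d hd => by
            rw [inner_smul_left]; exact mul_nonpos_of_nonneg_of_nonpos (hc d hd) (hcon d hd)
        rw [hΦ.norm b hb] at h2; norm_num at h2
      obtain ⟨d, hd, hdb⟩ := h1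
      by_cases hbd : b = d
      · rw [hbd]; exact Gen.base hd
      have hdΔ := hS hd
      have hdΦ := h.sub d hdΔ
      have h2 := hΦ.refl d hdΦ b hb
      have h3 := h.refl_cone hΦ hdΔ hb (cone_mono hS hbS) hbd
      have h4 : rf d b = b - ⟪d, b⟫ • d := rf_apply (hΦ.norm d hdΦ) b
      have h5 : rf d b = ∑ e ∈ S, (c e - if e = d then ⟪d, b⟫ else 0) • e := by
        rw [h4, ← sum_sub_single hd, ← he]
      have h6 : rf d b ∈ cone S := by
        refine ⟨_, ?_, h5⟩
        obtain ⟨c', hc', he'⟩ := h3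
        rw [h5, sum_extend hS] at he'
        intro e he
        have := h.coef_eq he' e (hS he)
        rw [if_pos he] at this
        rw [this]; exact hc' e (hS he)
      have h7 : (⟪rf d b, f⟫ : ℝ) < ⟪b, f⟫ := by
        rw [h4, inner_sub_left, inner_smul_left]
        have := mul_pos hdb (hf d hdΔ)
        simp only [RCLike.conj_to_real]; linarith
      have h8 : {x ∈ Φ | (⟪x, f⟫ : ℝ) < ⟪rf d b, f⟫}.ncard < {x ∈ Φ | (⟪x, f⟫ : ℝ) < ⟪b, f⟫}.ncard := by
        apply Set.ncard_lt_ncard _ (hΦ.fin.subset (Set.sep_subset _ _))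
        refine ⟨fun x hx => ⟨hx.1, hx.2.trans h7⟩, fun hsub => ?_⟩
        exact lt_irrefl _ (hsub ⟨h2, h7⟩).2
      have h9 := ih _ h2 h6 (by omega)
      have h10 := Gen.step (Gen.base hd) h9
      rwa [rf_rf] at h10
  exact key _ b hb hbS (Nat.lt_succ_self _)

theorem IsSimple.gen {Φ : Set V} {Δ : Finset V} (hΦ : IsRS Φ) (h : IsSimple Φ Δ) {b : V}
    (hb : b ∈ Φ) : Gen ↑Δ b := by
  rcases h.pos b hb with h1 | h1
  · exact h.gen_of_cone hΦ subset_rfl hb h1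
  · simpa using (h.gen_of_cone hΦ subset_rfl (hΦ.neg hb) h1).neg

theorem IsSimple.gen_of_span {Φ : Set V} {Δ : Finset V} (hΦ : IsRS Φ) (h : IsSimple Φ Δ)
    {S : Finset V} (hS : S ⊆ Δ) {b : V} (hb : b ∈ Φ) (hbS : b ∈ Submodule.span ℝ (S : Set V)) :
    Gen ↑S b := by
  classical
  rw [Submodule.mem_span_finset] at hbS
  obtain ⟨c, -, hc⟩ := hbS
  have h1 := hc.symm
  rw [sum_extend hS] at h1
  rcases h.nonneg_or hb h1 with h2 | h2
  · refine h.gen_of_cone hΦ hS hb ⟨c, fun d hd => ?_, hc.symm⟩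
    have := h2 d (hS hd); rwa [if_pos hd] at this
  · have : -b ∈ cone S := by
      refine ⟨fun d => -c d, fun d hd => ?_, by simp [← hc]⟩
      have := h2 d (hS hd); rw [if_pos hd] at this; linarith
    simpa using (h.gen_of_cone hΦ hS (hΦ.neg hb) this).neg

theorem IsSimple.exists_split {Φ : Set V} {Δ : Finset V} (hΦ : IsRS Φ) (h : IsSimple Φ Δ)
    {L : List V} (hL : ∀ a ∈ L, a ∈ Δ) {b : V} (hb : b ∈ Φ) (hbc : b ∈ cone Δ)
    (hneg : -pr L b ∈ cone Δ) : ∃ A d B, L = A ++ d :: B ∧ pr B b = d := by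
  induction L with
  | nil => exact absurd (h.not_both hbc hneg) (hΦ.ne_zero hb)
  | cons a L ih =>
    have hL' : ∀ a ∈ L, a ∈ Δ := fun b hb => hL b (by simp [hb])
    have hx : pr L b ∈ Φ := hΦ.pr_mem (fun a ha => h.sub a (hL' a ha)) hb
    rcases h.pos _ hx with h1 | h1
    · by_cases hxa : pr L b = a
      · exact ⟨[], a, L, rfl, hxa⟩
      · have h2 := h.refl_cone hΦ (hL a (by simp)) hx h1 hxa
        rw [pr_cons, mul_app] at hneg
        have h3 := h.not_both h2 hneg
        exact absurd h3 (hΦ.ne_zero (hΦ.refl a (h.sub a (hL a (by simp))) _ hx))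
    · obtain ⟨A, d, B, e, hd⟩ := ih hL' h1
      exact ⟨a :: A, d, B, by rw [e]; rfl, hd⟩

/-- A product of reflections fixing a regular vector is trivial. -/
theorem IsRS.free {Φ : Set V} (hΦ : IsRS Φ) {y : V} (hy : ∀ b ∈ Φ, ⟪b, y⟫ ≠ (0 : ℝ)) {L : List V}
    (hL : ∀ a ∈ L, a ∈ Φ) (h : pr L y = y) : pr L = 1 := by
  obtain ⟨Δ, hΔ, hpos⟩ := hΦ.exists_simple hy
  obtain ⟨L₁, hL₁, e₁⟩ := Gen.exists_word_list (X := (Δ : Set V)) fun a ha => hΔ.gen hΦ (hL a ha)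
  have key : ∀ n : ℕ, ∀ M : List V, M.length < n → (∀ a ∈ M, a ∈ Δ) → pr M y = y → pr M = 1 := by
    intro n
    induction n with
    | zero => intro M h; omega
    | succ n ih =>
      intro M hn hM hMy
      rcases M.eq_nil_or_concat with rfl | ⟨A', d, rfl⟩
      · rfl
      have hd : d ∈ Δ := hM d (by simp)
      have hA' : ∀ a ∈ A', a ∈ Δ := fun a ha => hM a (by simp [ha])
      have h1 : pr (A' ++ [d]) d = - pr A' d := by
        rw [pr_append, mul_app]; simp [rf_self]
      have h2 : (⟪pr (A' ++ [d]) d, y⟫ : ℝ) = ⟪d, y⟫ := by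
        conv_lhs => rw [← hMy]
        simp only [List.concat_eq_append]
        rw [inner_map]
      have h3 : -pr A' d ∈ cone Δ := by
        rcases hΔ.pos _ (hΦ.pr_mem (fun a ha => hΔ.sub a (hA' a ha)) (hΔ.sub d hd)) with h3 | h3
        · have h4 := cone_inner_nonneg (fun d hd => (hpos d hd).le) h3
          rw [h1, inner_neg_left] at h2
          have := hpos d hd
          linarith
        · exact h3
      obtain ⟨A, e, B, rfl, he⟩ := hΔ.exists_split hΦ hA' (hΔ.sub d hd) (cone_self hd) h3
      have h5 : pr ((A ++ e :: B).concat d) = pr (A ++ B) := by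
        rw [List.concat_eq_append, pr_append, pr_append, pr_cons, pr_append, ← he, rf_conj]
        simp only [pr_cons, pr_nil, mul_one, mul_assoc, inv_mul_cancel_left, rf_mul_self]
      rw [h5]
      rw [h5] at hMy
      refine ih _ ?_ ?_ hMy
      · simp at hn ⊢; omega
      · intro a ha
        apply hM
        simp only [List.mem_append, List.concat_eq_append, List.mem_cons] at ha ⊢; tauto
  rw [← e₁]
  exact key _ L₁ (Nat.lt_succ_self _) hL₁ (by rw [e₁, h])

theorem IsRS.exists_root_orth {Φ : Set V} (hΦ : IsRS Φ) {L : List V} (hL : ∀ a ∈ L, a ∈ Φ)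
    (h : pr L ≠ 1) : ∃ a ∈ Φ, a ∈ (Fx (pr L))ᗮ := by
  by_contra! hcon
  apply h
  obtain ⟨y, hy, hyΦ⟩ := exists_generic (Fx (pr L)) hΦ.fin fun a ha => by
    have := hcon a ha
    rw [Submodule.mem_orthogonal] at this
    push Not at this
    obtain ⟨u, hu, hne⟩ := this
    exact ⟨u, hu, by rwa [real_inner_comm]⟩
  exact hΦ.free hyΦ hL (mem_Fx.1 hy)

/-- A root whose reflection lies in the group generated by the reflections in `X` is generated
by `X`. -/
theorem IsRS.gen_of_rf_eq {Φ : Set V} (hΦ : IsRS Φ) {X : Set V} (hX : X ⊆ Φ) {b : V}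
    (hb : ⟪b, b⟫ = (2 : ℝ)) {L : List V} (hL : ∀ a ∈ L, Gen X a) (h : pr L = rf b) : Gen X b := by
  by_contra hcon
  have hΨ := hΦ.gen hX
  obtain ⟨y, hy, hyΨ⟩ := exists_generic (ℝ ∙ b)ᗮ hΨ.fin fun a ha => by
    refine ⟨a - (⟪b, a⟫ / 2) • b, ?_, ?_⟩
    · rw [Submodule.mem_orthogonal_singleton_iff_inner_right, inner_sub_right, inner_smul_right, hb]
      ring
    · intro h0
      have hne := hΨ.norm a ha
      rw [inner_sub_right, inner_smul_right, real_inner_comm b a, hne] at h0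
      have h1 : a = (⟪b, a⟫ / 2) • b := by
        rw [← sub_eq_zero, ← inner_self_eq_zero (𝕜 := ℝ)]
        simp only [inner_sub_left, inner_sub_right, inner_smul_left, inner_smul_right, hb, hne,
          real_inner_comm b a, RCLike.conj_to_real]
        nlinarith
      rcases eq_or_neg_of_smul hb hne h1 with h2 | h2
      · exact hcon (h2 ▸ ha)
      · have ha' : Gen X a := ha
        rw [h2] at ha'; exact hcon (by simpa using ha'.neg)
  rw [Submodule.mem_orthogonal_singleton_iff_inner_right] at hy
  have h1 := hΨ.free hyΨ hL (by rw [h, rf_fix hy])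
  have h2 := rf_self b
  rw [← h, h1] at h2
  have h3 : b = -b := h2
  have h4 : ⟪b, b⟫ = -(⟪b, b⟫ : ℝ) := by nth_rewrite 1 [h3]; rw [inner_neg_left]
  linarith

variable [FiniteDimensional ℝ V]

theorem finrank_Fx_orth_lt {g : V ≃ₗᵢ[ℝ] V} {a : V} (ha : ⟪a, a⟫ = (2 : ℝ)) (h : a ∈ (Fx g)ᗮ) :
    Module.finrank ℝ (Fx (rf a * g))ᗮ < Module.finrank ℝ (Fx g)ᗮ := by
  obtain ⟨x, hx⟩ := exists_sub_eq h
  have h1 : Fx g < Fx (rf a * g) := by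
    have hle : Fx g ≤ Fx (rf a * g) := by
      intro v hv
      rw [mem_Fx, mul_app, mem_Fx.1 hv]
      apply rf_fix
      rw [real_inner_comm]
      exact (Submodule.mem_orthogonal _ _).1 h v hv
    refine lt_of_le_of_ne hle fun he => ?_
    have hgx : g x = x - a := by rw [← hx]; abel
    have hxa : ⟪a, x⟫ = (1 : ℝ) := by
      have h2 : ⟪g x, g x⟫ = ⟪x, x⟫ := inner_map g x x
      rw [hgx, inner_sub_left, inner_sub_right, inner_sub_right, ha, real_inner_comm a x] at h2
      linarith
    have h3 : x ∈ Fx (rf a * g) := by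
      rw [mem_Fx, mul_app, hgx, rf_apply ha, inner_sub_right, hxa, ha]
      module
    rw [← he, mem_Fx, hgx, sub_eq_self] at h3
    rw [h3] at ha; simp at ha
  have h2 := Submodule.finrank_lt_finrank_of_lt h1
  have h3 := (Fx g).finrank_add_finrank_orthogonal
  have h4 := (Fx (rf a * g)).finrank_add_finrank_orthogonal
  omega

/-- Carter's lemma: a product of reflections is a product of reflections in
linearly independent roots. -/
theorem IsRS.carter {Φ : Set V} (hΦ : IsRS Φ) {M : List V} (hM : ∀ a ∈ M, a ∈ Φ) :
    ∃ L : List V, (∀ a ∈ L, a ∈ Φ) ∧ Ind L ∧ pr L = pr M := by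
  have key : ∀ n : ℕ, ∀ M : List V, (∀ a ∈ M, a ∈ Φ) → Module.finrank ℝ (Fx (pr M))ᗮ < n →
      ∃ L : List V, (∀ a ∈ L, a ∈ Φ) ∧ Ind L ∧ pr L = pr M := by
    intro n
    induction n with
    | zero => intro M _ h; omega
    | succ n ih =>
      intro M hM hn
      by_cases h1 : pr M = 1
      · exact ⟨[], by simp, trivial, by rw [h1]; rfl⟩
      obtain ⟨a, ha, hao⟩ := hΦ.exists_root_orth hM h1
      have h2 := finrank_Fx_orth_lt (hΦ.norm a ha) hao
      rw [← pr_cons] at h2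
      obtain ⟨L, hL, hLi, e⟩ := ih (a :: M) (by simpa using ⟨ha, hM⟩) (by omega)
      have e' : pr (a :: L) = pr M := by
        rw [pr_cons, e, pr_cons, ← mul_assoc, rf_mul_self, one_mul]
      refine ⟨a :: L, by simpa using ⟨ha, hL⟩, ?_, e'⟩
      rw [ind_iff]
      have h3 := Submodule.finrank_mono (Fx_orth_le (a :: L))
      rw [e'] at h3
      have h4 := (ind_iff L).1 hLi
      rw [sp_eq_Fx_orth hLi, e] at h4
      have h5 := finrank_sp_le (a :: L)
      rw [List.length_cons] at *
      omega
  exact key _ M hM (Nat.lt_succ_self _)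

/-- Every root in the span of an independent list is the first entry of a factorization of the
same length and the same product. -/
theorem IsRS.carter_front {Φ : Set V} (hΦ : IsRS Φ) {L : List V} (hL : ∀ a ∈ L, a ∈ Φ)
    (hLi : Ind L) {a : V} (ha : a ∈ Φ) (has : a ∈ sp L) :
    ∃ τ : List V, (∀ b ∈ τ, b ∈ Φ) ∧ pr (a :: τ) = pr L ∧ (a :: τ).length = L.length := by
  obtain ⟨τ, hτ, hτi, e⟩ := hΦ.carter (M := a :: L) (by simpa using ⟨ha, hL⟩)
  have e' : pr (a :: τ) = pr L := by
    rw [pr_cons, e, pr_cons, ← mul_assoc, rf_mul_self, one_mul]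
  refine ⟨τ, hτ, e', ?_⟩
  have h1 : a ∈ (Fx (pr L))ᗮ := by rwa [← sp_eq_Fx_orth hLi]
  have h2 := finrank_Fx_orth_lt (hΦ.norm a ha) h1
  rw [← pr_cons, ← e, ← sp_eq_Fx_orth hτi, ← sp_eq_Fx_orth hLi, (ind_iff _).1 hτi,
    (ind_iff _).1 hLi] at h2
  have h3 := Submodule.finrank_mono (Fx_orth_le (a :: τ))
  rw [e', ← sp_eq_Fx_orth hLi, (ind_iff _).1 hLi] at h3
  have h4 := finrank_sp_le (a :: τ)
  rw [List.length_cons] at *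
  omega

end Simple

end HurwitzRS

namespace HurwitzRS

open scoped RealInnerProductSpace

section Fronts

variable {V : Type*} [NormedAddCommGroup V] [InnerProductSpace ℝ V]

theorem inner_preimage {g : V ≃ₗᵢ[ℝ] V} {a x : V} (h : x - g x = a) (ha : ⟪a, a⟫ = (2 : ℝ)) :
    ⟪a, x⟫ = (1 : ℝ) := by
  have hgx : g x = x - a := by rw [← h]; abel
  have h2 : ⟪g x, g x⟫ = ⟪x, x⟫ := inner_map g x x
  rw [hgx, inner_sub_left, inner_sub_right, inner_sub_right, ha, real_inner_comm a x] at h2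
  linarith

theorem rf_preimage {g : V ≃ₗᵢ[ℝ] V} {a x : V} (h : x - g x = a) (ha : ⟪a, a⟫ = (2 : ℝ)) :
    rf a x = g x := by
  rw [rf_apply ha, inner_preimage h ha, one_smul, ← h, sub_sub_cancel]

theorem inner_preimage_comm {g : V ≃ₗᵢ[ℝ] V} {a b x y : V} (hx : x - g x = a) (hy : y - g y = b) :
    ⟪x, b⟫ = -(⟪a, g y⟫ : ℝ) := by
  rw [← hx, ← hy, inner_sub_left, inner_sub_right, inner_map]; ring

theorem inner_preimage_add {g : V ≃ₗᵢ[ℝ] V} {a b x y : V} (hx : x - g x = a) (hy : y - g y = b) :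
    ⟪x, b⟫ + ⟪y, a⟫ = (⟪a, b⟫ : ℝ) := by
  rw [inner_preimage_comm hx hy, real_inner_comm a y]
  have : g y = y - b := by rw [← hy]; abel
  rw [this, inner_sub_right]; ring

theorem abs_inner_lt_two {a b : V} (ha : ⟪a, a⟫ = (2 : ℝ)) (hb : ⟪b, b⟫ = (2 : ℝ)) (h : b ≠ a)
    (h' : b ≠ -a) : |(⟪a, b⟫ : ℝ)| < 2 := by
  have key : ∀ c : V, ⟪c, c⟫ = (2 : ℝ) → c ≠ a → (⟪a, c⟫ : ℝ) < 2 := by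
    intro c hc hne
    have h1 : (0 : ℝ) < ⟪c - a, c - a⟫ := real_inner_self_pos.2 (sub_ne_zero.2 hne)
    rw [inner_sub_left, inner_sub_right, inner_sub_right, ha, hc, real_inner_comm a c] at h1
    linarith
  have h1 := key b hb h
  have h2 := key (-b) (by rw [inner_neg_neg, hb]) (fun e => h' (by rw [← e, neg_neg]))
  rw [inner_neg_right] at h2
  rw [abs_lt]; constructor <;> linarith

/-- A list is full if it generates all the roots in its span. -/
def Full (Φ : Set V) (L : List V) : Prop := ∀ b ∈ Φ, b ∈ sp L → Gen {x | x ∈ L} b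

/-- All the roots in the span of `L` occur as first entries in the Hurwitz orbit. -/
def Front (Φ : Set V) (L : List V) : Prop := ∀ b ∈ Φ, b ∈ sp L → ∃ τ, HV L (b :: τ)

/-- A set of vectors which is not the union of two nonempty orthogonal subsets. -/
def Irr (Y : Set V) : Prop := ∀ p : V → Prop, (∃ a ∈ Y, p a) → (∃ a ∈ Y, ¬ p a) →
  ∃ a ∈ Y, ∃ b ∈ Y, p a ∧ ¬ p b ∧ ⟪a, b⟫ ≠ (0 : ℝ)

theorem Irr.of_gen {X : Set V} (hX : ∀ a ∈ X, a ≠ 0) (h : Irr {v | Gen X v}) : Irr X := by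
  rintro p ⟨a, ha, hpa⟩ ⟨b, hb, hpb⟩
  by_contra! hcon
  have hs : X ⊆ {a ∈ X | p a} ∪ {a ∈ X | ¬ p a} := fun x hx => by
    by_cases hp : p x
    exacts [Or.inl ⟨hx, hp⟩, Or.inr ⟨hx, hp⟩]
  have horth : ∀ a ∈ {a ∈ X | p a}, ∀ b ∈ {a ∈ X | ¬ p a}, ⟪a, b⟫ = (0 : ℝ) :=
    fun a ha b hb => hcon a ha.1 b hb.1 ha.2 hb.2
  have hone : ∀ v, Gen {a ∈ X | p a} v → Gen {a ∈ X | ¬ p a} v → v = 0 := fun v h1 h2 =>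
    inner_self_eq_zero (𝕜 := ℝ).1 (span_orth horth h1.mem_span h2.mem_span)
  obtain ⟨x, hx, y, hy, hpx, hpy, hne⟩ := h (fun v => Gen {a ∈ X | p a} v)
    ⟨a, Gen.base ha, Gen.base ⟨ha, hpa⟩⟩
    ⟨b, Gen.base hb, fun h => hX b hb (hone b h (Gen.base ⟨hb, hpb⟩))⟩
  rcases gen_split horth (hy.mono hs) with h1 | h1
  · exact hpy h1
  · exact hne (span_orth horth hpx.mem_span h1.mem_span)

theorem Irr.gen {X : Set V} (hX : ∀ a ∈ X, a ≠ 0) (h : Irr X) : Irr {v | Gen X v} := by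
  rintro p ⟨a, ha, hpa⟩ ⟨b, hb, hpb⟩
  by_contra! hcon
  have hne : ∀ v, Gen X v → v ≠ 0 := fun v hv =>
    Gen.le (P := fun v => v ≠ 0) hX (fun a b _ hb h0 => hb (by rw [← rf_rf a b, h0, map_zero])) hv
  have hcon' : ∀ a b, Gen X a → Gen X b → p a → ¬ p b → ⟪a, b⟫ = (0 : ℝ) :=
    fun a b ha hb hpa hpb => hcon a ha b hb hpa hpb
  by_cases h1 : ∃ a ∈ X, p a
  · by_cases h2 : ∃ a ∈ X, ¬ p a
    · obtain ⟨x, hx, y, hy, hpx, hpy, h3⟩ := h p h1 h2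
      exact h3 (hcon' x y (Gen.base hx) (Gen.base hy) hpx hpy)
    · push Not at h2
      have : ∀ v, Gen X v → p v ∧ Gen X v := fun v hv => by
        refine Gen.le (P := fun v => p v ∧ Gen X v) (fun a ha => ⟨h2 a ha, Gen.base ha⟩) ?_ hv
        intro a b ha hb
        refine ⟨?_, Gen.step ha.2 hb.2⟩
        by_contra hp
        have h4 := hcon' _ _ ha.2 (Gen.step ha.2 hb.2) ha.1 hp
        have h5 := hcon' _ _ hb.2 (Gen.step ha.2 hb.2) hb.1 hp
        apply hne _ (Gen.step ha.2 hb.2)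
        have h6 : ⟪a, b⟫ = (0 : ℝ) := by
          rw [← inner_rf_rf a, rf_self, inner_neg_left, h4, neg_zero]
        rw [rf_fix h6] at h5 ⊢
        exact inner_self_eq_zero (𝕜 := ℝ).1 h5
      exact hpb (this b hb).1
  · push Not at h1
    have : ∀ v, Gen X v → ¬ p v ∧ Gen X v := fun v hv => by
      refine Gen.le (P := fun v => ¬ p v ∧ Gen X v) (fun a ha => ⟨h1 a ha, Gen.base ha⟩) ?_ hv
      intro a b ha hb
      refine ⟨?_, Gen.step ha.2 hb.2⟩
      intro hp
      have h4 := hcon' _ _ (Gen.step ha.2 hb.2) ha.2 hp ha.1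
      have h5 := hcon' _ _ (Gen.step ha.2 hb.2) hb.2 hp hb.1
      apply hne _ (Gen.step ha.2 hb.2)
      have h6 : ⟪a, b⟫ = (0 : ℝ) := by
        rw [real_inner_comm] at h4
        rw [← inner_rf_rf a, rf_self, inner_neg_left, h4, neg_zero]
      rw [rf_fix h6] at h5 ⊢
      exact inner_self_eq_zero (𝕜 := ℝ).1 h5
    exact (this a ha).1 hpa

theorem HV.sub {Φ : Set V} (hΦ : IsRS Φ) {L L' : List V} (h : HV L L') (hL : ∀ a ∈ L, a ∈ Φ) :
    ∀ a ∈ L', a ∈ Φ :=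
  (HV.forall_mem (P := (· ∈ Φ)) (fun a b ha hb => hΦ.refl a ha b hb) h).1 hL

theorem exists_preimage [FiniteDimensional ℝ V] {L : List V} (hL : Ind L) {a : V} (ha : a ∈ sp L) :
    ∃ x, x - pr L x = a :=
  exists_sub_eq (by rwa [← sp_eq_Fx_orth hL])

theorem preimage_orth {a x : V} {τ : List V} (hi : Ind (a :: τ)) (ha : ⟪a, a⟫ = (2 : ℝ))
    (hx : x - pr (a :: τ) x = a) : ∀ b ∈ τ, ⟪b, x⟫ = (0 : ℝ) := by
  apply orth_of_pr_fix hi.2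
  have h1 := rf_preimage hx ha
  rw [pr_cons, mul_app] at h1
  exact ((rf a).injective h1).symm

theorem mem_sp_tail_iff {a x : V} {τ : List V} (hi : Ind (a :: τ)) (ha : ⟪a, a⟫ = (2 : ℝ))
    (hx : x - pr (a :: τ) x = a) {b : V} (hb : b ∈ sp (a :: τ)) :
    b ∈ sp τ ↔ ⟪x, b⟫ = (0 : ℝ) := by
  have h1 : x ∈ (sp τ)ᗮ := mem_sp_orth.2 (preimage_orth hi ha hx)
  have h2 : ∀ t ∈ sp τ, ⟪x, t⟫ = (0 : ℝ) := fun t ht => by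
    rw [real_inner_comm]; exact (Submodule.mem_orthogonal _ _).1 h1 t ht
  refine ⟨h2 b, fun h => ?_⟩
  rw [sp_cons, Submodule.mem_sup] at hb
  obtain ⟨y, hy, z, hz, rfl⟩ := hb
  obtain ⟨c, rfl⟩ := Submodule.mem_span_singleton.1 hy
  rw [inner_add_right, h2 z hz, inner_smul_right, real_inner_comm, inner_preimage hx ha] at h
  simp only [mul_one, add_zero] at h
  rw [h, zero_smul, zero_add]; exact hz

/-- The standing hypotheses for the study of first entries in a Hurwitz orbit. -/
structure Ctx (Φ : Set V) (L : List V) : Prop where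
  rs : IsRS Φ
  sub : ∀ a ∈ L, a ∈ Φ
  ind : Ind L
  front : ∀ a τ, HV L (a :: τ) → Front Φ τ

theorem Ctx.closed {Φ : Set V} {L : List V} (h : Ctx Φ L) {a : V} {τ : List V}
    (ha : HV L (a :: τ)) {b : V} (hb : b ∈ Φ) (hbs : b ∈ sp τ) :
    (∃ τ', HV L (b :: τ')) ∧ ∃ τ', HV L (rf a b :: τ') := by
  obtain ⟨τ', hτ⟩ := h.front a τ ha b hb hbs
  have h1 := ha.trans (HV.cons a hτ)
  refine ⟨⟨rf b a :: τ', h1.trans ?_⟩, ⟨a :: τ', h1.trans (HV.swap a b τ')⟩⟩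
  have := HV.swap b (rf b a) τ'
  rw [rf_rf] at this
  exact this.symm

theorem Ctx.closed' {Φ : Set V} {L : List V} (h : Ctx Φ L) {a : V} {τ : List V}
    (ha : HV L (a :: τ)) {x : V} (hx : x - pr L x = a) {b : V} (hb : b ∈ Φ) (hbL : b ∈ sp L)
    (hxb : ⟪x, b⟫ = (0 : ℝ)) : (∃ τ', HV L (b :: τ')) ∧ ∃ τ', HV L (rf a b :: τ') := by
  apply h.closed ha hb
  have haΦ := ha.sub h.rs h.sub a (by simp)
  rw [← ha.sp] at hbL
  rw [← ha.pr] at hx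
  exact (mem_sp_tail_iff (ha.ind h.ind) (h.rs.norm a haΦ) hx hbL).2 hxb

/-- The roots which are not first entries are closed under the same operations. -/
theorem Ctx.compl_closed [FiniteDimensional ℝ V] {Φ : Set V} {L : List V} (h : Ctx Φ L) {c : V} (hc : c ∈ Φ)
    (hcL : c ∈ sp L) (hcn : ¬ ∃ τ, HV L (c :: τ)) {x : V} (hx : x - pr L x = c) {b : V} (hb : b ∈ Φ)
    (hbL : b ∈ sp L) (hxb : ⟪x, b⟫ = (0 : ℝ)) :
    (¬ ∃ τ, HV L (b :: τ)) ∧ ¬ ∃ τ, HV L (rf c b :: τ) := by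
  constructor
  · rintro ⟨τ, hτ⟩
    apply hcn
    obtain ⟨y, hy⟩ := exists_preimage h.ind hbL
    have h1 := inner_preimage_comm hx hy
    rw [hxb, zero_eq_neg, ← rf_preimage hy (h.rs.norm b hb), ← inner_rf_left,
      real_inner_comm y] at h1
    have := (h.closed' hτ hy (h.rs.refl b hb c hc) (rf_mem_sub hbL hcL) h1).2
    rwa [rf_rf] at this
  · rintro ⟨τ, hτ⟩
    apply hcn
    have hdL : rf c b ∈ sp L := rf_mem_sub hcL hbL
    obtain ⟨y, hy⟩ := exists_preimage h.ind hdL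
    have h1 := inner_preimage_comm hy hx
    rw [← rf_preimage hx (h.rs.norm c hc), inner_rf_rf, real_inner_comm x b, hxb, neg_zero] at h1
    exact (h.closed' hτ hy hc hcL h1).1

/-- The main linear algebra argument: a root having the sign property is a first entry. -/
theorem Ctx.mem_of_signs {Φ : Set V} {L : List V} (h : Ctx Φ L) (hlen : 2 ≤ L.length) {c x : V}
    (hx : x - pr L x = c)
    (hs : ∀ b τ, HV L (b :: τ) → 0 < (⟪x, b⟫ : ℝ) * ⟪pr L x, b⟫) : False := by
  have hfin : {b | b ∈ Φ ∧ ∃ τ, HV L (b :: τ)}.Finite := h.rs.fin.subset fun b hb => hb.1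
  have hne : {b | b ∈ Φ ∧ ∃ τ, HV L (b :: τ)}.Nonempty := by
    rcases L with _ | ⟨a, L⟩
    · simp at hlen
    · exact ⟨a, h.sub a (by simp), L, HV.refl _⟩
  obtain ⟨a, ⟨haΦ, τ, hτ⟩, hmin⟩ := Set.exists_min_image _ (fun b => |(⟪pr L x, b⟫ : ℝ)|) hfin hne
  have hi := hτ.ind h.ind
  have hτΦ : ∀ b ∈ τ, b ∈ Φ := fun b hb => hτ.sub h.rs h.sub b (by simp [hb])
  have hm : 0 < |(⟪pr L x, a⟫ : ℝ)| := by
    rw [abs_pos]; intro h0; have := hs a τ hτ; rw [h0, mul_zero] at this; exact lt_irrefl _ this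
  have hpr : pr L = rf a * pr τ := by rw [← hτ.pr, pr_cons]
  -- signs are preserved by `pr τ`
  have key : ∀ b ∈ Φ, b ∈ sp τ → 0 < (⟪x, pr τ b⟫ : ℝ) * ⟪x, b⟫ := by
    intro b₀ hb₀ hb₀τ
    set b := pr τ b₀ with hb_def
    have hb : b ∈ Φ := h.rs.pr_mem hτΦ hb₀
    have hbτ : b ∈ sp τ := pr_mem (fun a ha => mem_sp ha) hb₀τ
    have h1 : (⟪x, b₀⟫ : ℝ) = ⟪pr L x, rf a b⟫ := by
      rw [hpr, mul_app, inner_rf_rf, hb_def, inner_map]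
    obtain ⟨⟨τ₁, h2⟩, τ₂, h3⟩ := h.closed hτ hb hbτ
    have h4 := hs b τ₁ h2
    have h5 := hmin b ⟨hb, τ₁, h2⟩
    have h6 := hmin (rf a b) ⟨h.rs.refl a haΦ b hb, τ₂, h3⟩
    have h7 : |(⟪a, b⟫ : ℝ)| < 2 := by
      apply abs_inner_lt_two (h.rs.norm a haΦ) (h.rs.norm b hb)
      · rintro e; apply hi.1; rwa [← e]
      · rintro e; apply hi.1; rw [e] at hbτ; simpa using hbτ
    have h8 : (⟪pr L x, rf a b⟫ : ℝ) = ⟪pr L x, b⟫ - ⟪a, b⟫ * ⟪pr L x, a⟫ := by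
      rw [rf_apply (h.rs.norm a haΦ), inner_sub_right, inner_smul_right]
    rw [h1]
    set p : ℝ := ⟪pr L x, b⟫
    set q : ℝ := ⟪pr L x, rf a b⟫
    set m : ℝ := ⟪pr L x, a⟫
    set k : ℝ := ⟪a, b⟫
    set r : ℝ := ⟪x, b⟫
    have h9 : |p - q| < 2 * |m| := by
      rw [h8, sub_sub_cancel, abs_mul]
      exact mul_lt_mul_of_pos_right h7 hm
    have h10 : 0 < p * q := by
      by_contra! hpq
      rcases mul_nonpos_iff.1 hpq with ⟨h11, h12⟩ | ⟨h11, h12⟩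
      · rw [abs_of_nonneg (by linarith : 0 ≤ p - q)] at h9
        rw [abs_of_nonneg h11] at h5
        rw [abs_of_nonpos h12] at h6
        linarith
      · rw [abs_of_nonpos (by linarith : p - q ≤ 0)] at h9
        rw [abs_of_nonpos h11] at h5
        rw [abs_of_nonneg h12] at h6
        linarith
    rcases pos_and_pos_or_neg_and_neg_of_mul_pos h4 with ⟨h11, h12⟩ | ⟨h11, h12⟩ <;>
      rcases pos_and_pos_or_neg_and_neg_of_mul_pos h10 with ⟨h13, h14⟩ | ⟨h13, h14⟩ <;>
      first
        | exact mul_pos h11 h14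
        | exact mul_pos_of_neg_of_neg h11 h14
        | linarith
  have hlen2 : τ.length + 1 = L.length := by have := hτ.length; simpa using this
  obtain ⟨b₀, τ', rfl⟩ : ∃ b τ', τ = b :: τ' := by
    rcases τ with _ | ⟨b, τ'⟩
    · simp at hlen2; omega
    · exact ⟨b, τ', rfl⟩
  set τ := b₀ :: τ' with hτ_def
  have hb₀ : b₀ ∈ Φ := hτΦ b₀ (by simp [hτ_def])
  have hiter : ∀ i : ℕ, (⇑(pr τ))^[i] b₀ ∈ Φ ∧ (⇑(pr τ))^[i] b₀ ∈ sp τ ∧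
      0 < (⟪x, (⇑(pr τ))^[i] b₀⟫ : ℝ) * ⟪x, b₀⟫ := by
    intro i
    induction i with
    | zero =>
      refine ⟨hb₀, mem_sp (by simp [hτ_def]), ?_⟩
      obtain ⟨⟨τ₁, h2⟩, -⟩ := h.closed hτ hb₀ (mem_sp (by simp [hτ_def]))
      have := hs b₀ τ₁ h2
      have h0 : (⟪x, b₀⟫ : ℝ) ≠ 0 := by intro h0; rw [h0, zero_mul] at this; exact lt_irrefl _ this
      exact mul_self_pos.2 h0
    | succ i ih =>
      rw [Function.iterate_succ_apply']
      refine ⟨h.rs.pr_mem hτΦ ih.1, pr_mem (fun a ha => mem_sp ha) ih.2.1, ?_⟩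
      have h1 := key _ ih.1 ih.2.1
      have h2 := ih.2.2
      set p : ℝ := ⟪x, pr τ ((⇑(pr τ))^[i] b₀)⟫
      set q : ℝ := ⟪x, (⇑(pr τ))^[i] b₀⟫
      set r : ℝ := ⟪x, b₀⟫
      have h3 := mul_pos h1 h2
      have h4 : p * q * (q * r) = (p * r) * q ^ 2 := by ring
      rw [h4] at h3
      by_contra! h5
      have := mul_nonpos_of_nonpos_of_nonneg h5 (sq_nonneg q)
      linarith
  obtain ⟨i, j, hij, heq⟩ : ∃ i j : ℕ, i < j ∧ (⇑(pr τ))^[i] b₀ = (⇑(pr τ))^[j] b₀ := by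
    have hfr : Set.MapsTo (fun i : ℕ => (⇑(pr τ))^[i] b₀) Set.univ Φ := fun i _ => (hiter i).1
    obtain ⟨i, -, j, -, hne, he⟩ := Set.infinite_univ.exists_ne_map_eq_of_mapsTo hfr h.rs.fin
    rcases lt_or_gt_of_ne hne with h1 | h1
    exacts [⟨i, j, h1, he⟩, ⟨j, i, h1, he.symm⟩]
  set z := ∑ k ∈ Finset.Ico i j, (⇑(pr τ))^[k] b₀ with hz
  have hzfix : pr τ z = z := by
    rw [hz, map_sum]
    simp only [← Function.iterate_succ_apply' (⇑(pr τ))]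
    have h1 : ∑ k ∈ Finset.Ico i j, (⇑(pr τ))^[k + 1] b₀ - ∑ k ∈ Finset.Ico i j, (⇑(pr τ))^[k] b₀
        = (⇑(pr τ))^[j] b₀ - (⇑(pr τ))^[i] b₀ := by
      rw [← Finset.sum_sub_distrib]
      exact Finset.sum_Ico_sub (fun k => (⇑(pr τ))^[k] b₀) hij.le
    rw [heq, sub_self, sub_eq_zero] at h1
    exact h1
  have hzs : z ∈ sp τ := Submodule.sum_mem _ fun k _ => (hiter k).2.1
  have hz0 : z = 0 := by
    have h1 : z ∈ (sp τ)ᗮ := mem_sp_orth.2 (orth_of_pr_fix hi.2 hzfix)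
    exact inner_self_eq_zero (𝕜 := ℝ).1 ((Submodule.mem_orthogonal _ _).1 h1 z hzs)
  have : 0 < (⟪x, z⟫ : ℝ) * ⟪x, b₀⟫ := by
    rw [hz, inner_sum, Finset.sum_mul]
    exact Finset.sum_pos (fun k _ => (hiter k).2.2) ⟨i, by simp [hij]⟩
  rw [hz0] at this
  simp at this

end Fronts

end HurwitzRS

namespace HurwitzRS

open scoped RealInnerProductSpace

section Trans

variable {V : Type*} [NormedAddCommGroup V] [InnerProductSpace ℝ V]

theorem Gen.le_of_refl {X : Set V} {P : V → Prop} (h : ∀ a ∈ X, P a)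
    (hs : ∀ a ∈ X, ∀ b, P b → P (rf a b)) {v : V} (hv : Gen X v) : P v := by
  refine (Gen.le (P := fun v => P v ∧ ∀ u, P u → P (rf v u)) (fun a ha => ⟨h a ha, hs a ha⟩) ?_ hv).1
  rintro a b ⟨-, ha'⟩ ⟨hb, hb'⟩
  refine ⟨ha' b hb, fun u hu => ?_⟩
  rw [rf_rf_conj, mul_app, mul_app]
  exact ha' _ (hb' _ (ha' _ hu))

theorem rf_zpow {w r : V ≃ₗᵢ[ℝ] V} (h : r * w * r⁻¹ = w⁻¹) (j : ℤ) (v : V) :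
    r ((w ^ j) v) = (w ^ (-j)) (r v) := by
  have h1 : r * w ^ j * r⁻¹ = w ^ (-j) := by rw [← conj_zpow, h, inv_zpow, zpow_neg]
  have h2 : r * w ^ j = w ^ (-j) * r := by rw [← h1]; group
  have := congrArg (fun g : V ≃ₗᵢ[ℝ] V => g v) h2
  simpa [mul_app] using this

theorem front_pair {α β v : V} (hv : Gen {x | x ∈ [α, β]} v) : ∃ τ, HV [α, β] (v :: τ) := by
  set w := rf α * rf β with hw
  have hsucc : ∀ v, (∃ d, HV [α, β] [v, d]) → ∃ d, HV [α, β] [w v, d] := by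
    rintro v ⟨d, hd⟩
    have hwv : w = rf v * rf d := by have := hd.pr; simpa using this.symm
    refine ⟨rf v d, ((hd.trans (HV.swap v d [])).trans (HV.swap _ _ [])).trans ?_⟩
    · have h1 : rf (rf v d) v = -(w v) := by
        rw [rf_rf_conj, mul_app, mul_app, rf_self, map_neg, map_neg, hwv, mul_app]
      rw [h1]
      have := HV.neg (-(w v)) [rf v d]
      rwa [neg_neg] at this
  have hpred : ∀ v, (∃ d, HV [α, β] [v, d]) → ∃ d, HV [α, β] [w⁻¹ v, d] := by
    rintro v ⟨d, hd⟩
    have hwv : w = rf v * rf d := by have := hd.pr; simpa using this.symm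
    have h1 := HV.swap d (rf d v) []
    rw [rf_rf] at h1
    have h2 := HV.swap (rf d v) (rf (rf d v) d) []
    rw [rf_rf] at h2
    have h5 : HV [v, d] [rf d v, rf (rf d v) d] := h1.symm.trans h2.symm
    refine ⟨rf (rf d v) d, (hd.trans h5).trans ?_⟩
    have : w⁻¹ v = - rf d v := by
      rw [hwv, mul_inv_rev, rf_inv, rf_inv, mul_app, rf_self, map_neg]
    rw [this]
    exact HV.neg _ _
  have hz : ∀ v, (∃ d, HV [α, β] [v, d]) → ∀ j : ℤ, ∃ d, HV [α, β] [(w ^ j) v, d] := by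
    intro v hv j
    induction j with
    | zero => simpa using hv
    | succ i ih =>
      have := hsucc _ ih
      rw [← mul_app, ← zpow_one_add, add_comm] at this
      exact this
    | pred i ih =>
      have := hpred _ ih
      rw [← mul_app, ← zpow_neg_one, ← zpow_add, add_comm] at this
      exact this
  have hneg : ∀ v, (∃ d, HV [α, β] [v, d]) → ∃ d, HV [α, β] [-v, d] := by
    rintro v ⟨d, hd⟩; exact ⟨d, hd.trans (HV.neg _ _)⟩
  have hα : ∃ d, HV [α, β] [α, d] := ⟨β, HV.refl _⟩
  have hβ : ∃ d, HV [α, β] [β, d] := by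
    refine ⟨rf β α, ?_⟩
    have := HV.swap β (rf β α) []
    rw [rf_rf] at this
    exact this.symm
  have hP : ∃ j : ℤ, v = (w ^ j) α ∨ v = -(w ^ j) α ∨ v = (w ^ j) β ∨ v = -(w ^ j) β := by
    refine Gen.le_of_refl (P := fun v => ∃ j : ℤ, v = (w ^ j) α ∨ v = -(w ^ j) α ∨ v = (w ^ j) β ∨
      v = -(w ^ j) β) ?_ ?_ hv
    · intro a ha
      simp only [List.mem_cons, List.not_mem_nil, or_false, Set.mem_ofPred_eq] at ha
      rcases ha with rfl | rfl
      exacts [⟨0, by simp⟩, ⟨0, by simp⟩]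
    · intro a ha
      simp only [List.mem_cons, List.not_mem_nil, or_false, Set.mem_ofPred_eq] at ha
      have h1 : rf α * w * (rf α)⁻¹ = w⁻¹ := by
        rw [hw, mul_inv_rev, rf_inv, rf_inv, ← mul_assoc, rf_mul_self, one_mul]
      have h2 : rf β * w * (rf β)⁻¹ = w⁻¹ := by
        rw [hw, mul_inv_rev, rf_inv, rf_inv, mul_assoc, mul_assoc, rf_mul_self, mul_one]
      have h3 : rf α β = -(w β) := by rw [hw, mul_app, rf_self, map_neg, neg_neg]
      have h4 : rf β α = -(w⁻¹ α) := by
        rw [hw, mul_inv_rev, rf_inv, rf_inv, mul_app, rf_self, map_neg, neg_neg]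
      have h5 : ∀ j : ℤ, (w ^ (-j)) (w β) = (w ^ (-j + 1)) β := fun j => by
        rw [zpow_add_one, mul_app (w ^ (-j)) w]
      have h6 : ∀ j : ℤ, (w ^ (-j)) (w⁻¹ α) = (w ^ (-j - 1)) α := fun j => by
        rw [zpow_sub_one, mul_app]
      rcases ha with rfl | rfl
      · rintro b ⟨j, rfl | rfl | rfl | rfl⟩
        · exact ⟨-j, by simp [rf_zpow h1, rf_self]⟩
        · exact ⟨-j, by simp [rf_zpow h1, rf_self]⟩
        · exact ⟨-j + 1, by rw [rf_zpow h1, h3, map_neg, h5]; simp⟩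
        · exact ⟨-j + 1, by rw [map_neg, rf_zpow h1, h3, map_neg, h5]; simp⟩
      · rintro b ⟨j, rfl | rfl | rfl | rfl⟩
        · exact ⟨-j - 1, by rw [rf_zpow h2, h4, map_neg, h6]; simp⟩
        · exact ⟨-j - 1, by rw [map_neg, rf_zpow h2, h4, map_neg, h6]; simp⟩
        · exact ⟨-j, by simp [rf_zpow h2, rf_self]⟩
        · exact ⟨-j, by simp [rf_zpow h2, rf_self]⟩
  obtain ⟨j, rfl | rfl | rfl | rfl⟩ := hP
  · obtain ⟨d, hd⟩ := hz _ hα j; exact ⟨[d], hd⟩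
  · obtain ⟨d, hd⟩ := hneg _ (hz _ hα j); exact ⟨[d], hd⟩
  · obtain ⟨d, hd⟩ := hz _ hβ j; exact ⟨[d], hd⟩
  · obtain ⟨d, hd⟩ := hneg _ (hz _ hβ j); exact ⟨[d], hd⟩

theorem Ind.of_append {A B : List V} (h : Ind (A ++ B)) : Ind A ∧ Ind B := by
  induction A with
  | nil => exact ⟨trivial, h⟩
  | cons a A ih =>
    refine ⟨⟨fun h1 => h.1 ?_, (ih h.2).1⟩, (ih h.2).2⟩
    exact sp_mono (fun x hx => by simp [hx]) h1

theorem full_singleton {Φ : Set V} (hΦ : IsRS Φ) {a : V} (ha : a ∈ Φ) : Full Φ [a] := by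
  intro b hb hbs
  simp only [sp, List.mem_singleton, Set.ofPred_eq_eq_singleton] at hbs
  obtain ⟨c, rfl⟩ := Submodule.mem_span_singleton.1 hbs
  have h1 : Gen {x | x ∈ [a]} a := Gen.base (by simp)
  rcases eq_or_neg_of_smul (hΦ.norm a ha) (hΦ.norm _ hb) rfl with h | h <;> rw [h]
  exacts [h1, h1.neg]

theorem pr_eq_of_orth {A A' B B' : List V}
    (h : ∀ x ∈ sp A ⊔ sp A', ∀ y ∈ sp B ⊔ sp B', ⟪x, y⟫ = (0 : ℝ))
    (e : pr (A ++ B) = pr (A' ++ B')) : pr A = pr A' ∧ pr B = pr B' := by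
  have h1 : pr (A'.reverse ++ A) = pr (B' ++ B.reverse) := by
    rw [pr_append, pr_append] at e
    rw [pr_append, pr_append, pr_reverse, pr_reverse, inv_mul_eq_iff_eq_mul, ← mul_assoc, ← e]
    group
  have h2 : pr (A'.reverse ++ A) = 1 := by
    ext x
    have m1 := sub_pr_mem (A'.reverse ++ A) x
    have m2 := sub_pr_mem (B' ++ B.reverse) x
    rw [← h1] at m2
    have s1 : sp (A'.reverse ++ A) ≤ sp A ⊔ sp A' := by
      rw [sp_append, sup_comm]
      exact sup_le_sup le_rfl (sp_mono fun a ha => by simpa using ha)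
    have s2 : sp (B' ++ B.reverse) ≤ sp B ⊔ sp B' := by
      rw [sp_append, sup_comm]
      exact sup_le_sup (sp_mono fun a ha => by simpa using ha) le_rfl
    have := inner_self_eq_zero (𝕜 := ℝ).1 (h _ (s1 m1) _ (s2 m2))
    rw [sub_eq_zero] at this
    exact this.symm
  have h3 := h1
  rw [h2, pr_append, pr_reverse, eq_comm, mul_inv_eq_one] at h3
  rw [pr_append, pr_reverse, inv_mul_eq_one] at h2
  exact ⟨h2.symm, h3.symm⟩

variable [FiniteDimensional ℝ V]

/-- Transitivity of the Hurwitz action, assuming the two main properties of irreducible lists. -/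
theorem hv_of_pr_eq_aux {Φ : Set V} (hΦ : IsRS Φ)
    (hA : ∀ L, (∀ a ∈ L, a ∈ Φ) → Ind L → Full Φ L → Irr {x | x ∈ L} → 3 ≤ L.length →
      ∀ a τ, HV L (a :: τ) → Full Φ τ)
    (hB : ∀ L, Ctx Φ L → Full Φ L → Irr {x | x ∈ L} → 3 ≤ L.length → Front Φ L) :
    ∀ n : ℕ, ∀ L L' : List V, L.length = n → (∀ a ∈ L, a ∈ Φ) → Ind L → Full Φ L →
      (∀ a ∈ L', a ∈ Φ) → L'.length = L.length → pr L' = pr L → HV L L' := by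
  intro n
  induction n using Nat.strong_induction_on with
  | _ n ih =>
  intro L L' hn hL hLi hF hL' hlen hpr
  have hspec := ind_of_pr_eq hLi hpr.symm hlen.le
  have hfront : ∀ τ, τ.length < n → (∀ a ∈ τ, a ∈ Φ) → Ind τ → Full Φ τ → Front Φ τ := by
    intro τ hτn hτ hτi hτF b hb hbs
    obtain ⟨σ, hσ, e, hl⟩ := hΦ.carter_front hτ hτi hb hbs
    exact ⟨σ, ih _ hτn τ (b :: σ) rfl hτ hτi hτF (by simpa using ⟨hb, hσ⟩) hl e⟩
  have hfinish : Front Φ L → (∀ a τ, HV L (a :: τ) → Full Φ τ) → HV L L' := by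
    intro hfr hfu
    rcases L' with _ | ⟨a, τ'⟩
    · have : L = [] := List.length_eq_zero_iff.1 (by simpa using hlen.symm)
      rw [this]; exact HV.refl _
    · obtain ⟨τ, hτ⟩ := hfr a (hL' a (by simp)) (by rw [← hspec.1]; exact mem_sp (by simp))
      have hτl := hτ.length
      simp only [List.length_cons] at hlen hτl
      refine hτ.trans (HV.cons a (ih τ.length (by omega) τ τ' rfl
        (fun b hb => hτ.sub hΦ hL b (by simp [hb])) (hτ.ind hLi).2 (hfu a τ hτ)
        (fun b hb => hL' b (by simp [hb])) (by omega) ?_))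
      have := hpr.trans hτ.pr.symm
      simpa using this
  by_cases h3 : 3 ≤ n
  · by_cases hI : Irr {x | x ∈ L}
    · have hfu := hA L hL hLi hF hI (by omega)
      refine hfinish (hB L ⟨hΦ, hL, hLi, fun a τ hτ => ?_⟩ hF hI (by omega)) hfu
      have := hτ.length
      simp only [List.length_cons] at this
      exact hfront τ (by omega) (fun b hb => hτ.sub hΦ hL b (by simp [hb])) (hτ.ind hLi).2
        (hfu a τ hτ)
    · classical
      simp only [Irr] at hI
      push Not at hI
      obtain ⟨p, ⟨a₁, ha₁, hpa₁⟩, ⟨a₂, ha₂, hpa₂⟩, horth⟩ := hI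
      have hLHV := HV.filter (p := p) (L := L) horth
      set A := L.filter (fun a => p a) with hA_def
      set B := L.filter (fun a => ¬ p a) with hB_def
      have hAB : ∀ a ∈ {x | x ∈ A}, ∀ b ∈ {x | x ∈ B}, ⟪a, b⟫ = (0 : ℝ) := by
        intro a ha b hb
        simp only [hA_def, hB_def, List.mem_filter, decide_eq_true_eq, Set.mem_ofPred_eq] at ha hb
        exact horth a ha.1 b hb.1 ha.2 hb.2
      have hsplit : ∀ v ∈ Φ, v ∈ sp L → Gen {x | x ∈ A} v ∨ Gen {x | x ∈ B} v := by
        intro v hv hvs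
        apply gen_split hAB
        refine (hF v hv hvs).mono fun x hx => ?_
        by_cases hpx : p x
        · left; simp only [hA_def, List.mem_filter, Set.mem_ofPred_eq, decide_eq_true_eq]; exact ⟨hx, hpx⟩
        · right; simp only [hB_def, List.mem_filter, Set.mem_ofPred_eq, decide_eq_true_eq]; exact ⟨hx, hpx⟩
      have hL's : ∀ a ∈ L', Gen {x | x ∈ A} a ∨ Gen {x | x ∈ B} a := fun a ha =>
        hsplit a (hL' a ha) (by rw [← hspec.1]; exact mem_sp ha)
      have hL'HV := HV.filter (p := fun v => Gen {x | x ∈ A} v) (L := L') (by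
        intro a ha b hb h1 h2
        exact span_orth hAB h1.mem_span ((hL's b hb).resolve_left h2).mem_span)
      set A' := L'.filter (fun v => Gen {x | x ∈ A} v) with hA'_def
      set B' := L'.filter (fun v => ¬ Gen {x | x ∈ A} v) with hB'_def
      have hA's : ∀ a ∈ A', Gen {x | x ∈ A} a := by
        intro a ha
        simp only [hA'_def, List.mem_filter, decide_eq_true_eq] at ha
        exact ha.2
      have hB's : ∀ a ∈ B', Gen {x | x ∈ B} a := by
        intro a ha
        simp only [hB'_def, List.mem_filter, decide_eq_true_eq] at ha
        exact (hL's a ha.1).resolve_left ha.2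
      have hspA : sp A' ≤ sp A := sp_le.2 fun a ha => (hA's a ha).mem_span
      have hspB : sp B' ≤ sp B := sp_le.2 fun a ha => (hB's a ha).mem_span
      have horth' : ∀ x ∈ sp A, ∀ y ∈ sp B, ⟪x, y⟫ = (0 : ℝ) := fun x hx y hy => span_orth hAB hx hy
      have hprs : pr A' = pr A ∧ pr B' = pr B := by
        refine pr_eq_of_orth ?_ (by rw [hL'HV.pr, hpr, hLHV.pr])
        rw [sup_eq_right.2 hspA, sup_eq_right.2 hspB]
        exact horth'
      have hi := Ind.of_append (hLHV.ind hLi)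
      have hi' := Ind.of_append (hL'HV.ind hspec.2.1)
      have hAL : ∀ a ∈ A, a ∈ L := fun a ha => List.mem_of_mem_filter ha
      have hBL : ∀ a ∈ B, a ∈ L := fun a ha => List.mem_of_mem_filter ha
      have hFA : Full Φ A := by
        intro b hb hbs
        refine (hsplit b hb (sp_mono hAL hbs)).resolve_right fun h => hΦ.ne_zero hb ?_
        exact inner_self_eq_zero (𝕜 := ℝ).1 (horth' b hbs b h.mem_span)
      have hFB : Full Φ B := by
        intro b hb hbs
        refine (hsplit b hb (sp_mono hBL hbs)).resolve_left fun h => hΦ.ne_zero hb ?_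
        exact inner_self_eq_zero (𝕜 := ℝ).1 (horth' b h.mem_span b hbs)
      have hl := hLHV.length
      rw [List.length_append] at hl
      have hApos : 0 < A.length := List.length_pos_of_mem
        (by simp only [hA_def, List.mem_filter, decide_eq_true_eq]; exact ⟨ha₁, hpa₁⟩ : a₁ ∈ A)
      have hBpos : 0 < B.length := List.length_pos_of_mem
        (by simp only [hB_def, List.mem_filter, decide_eq_true_eq]; exact ⟨ha₂, hpa₂⟩ : a₂ ∈ B)
      have h4 := ih A.length (by omega) A A' rfl (fun a ha => hL a (hAL a ha)) hi.1 hFA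
        (fun a ha => hL' a (List.mem_of_mem_filter ha)) (length_eq_of_pr_eq hi.1 hi'.1 hprs.1.symm)
        hprs.1
      have h5 := ih B.length (by omega) B B' rfl (fun a ha => hL a (hBL a ha)) hi.2 hFB
        (fun a ha => hL' a (List.mem_of_mem_filter ha)) (length_eq_of_pr_eq hi.2 hi'.2 hprs.2.symm)
        hprs.2
      exact hLHV.trans (((h4.append_right B).trans (h5.append_left A')).trans hL'HV.symm)
  · rcases L with _ | ⟨a, _ | ⟨b, _ | ⟨c, L⟩⟩⟩
    · exact hfinish (fun b hb hbs => by
        have : b = 0 := by simpa [sp] using hbs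
        exact absurd this (hΦ.ne_zero hb)) fun a τ hτ => by simpa using hτ.length
    · refine hfinish (fun b hb hbs => ?_) fun b τ hτ => ?_
      · simp only [sp, List.mem_singleton, Set.ofPred_eq_eq_singleton] at hbs
        obtain ⟨c, rfl⟩ := Submodule.mem_span_singleton.1 hbs
        rcases eq_or_neg_of_smul (hΦ.norm a (hL a (by simp))) (hΦ.norm _ hb) rfl with h | h <;> rw [h]
        exacts [⟨[], HV.refl _⟩, ⟨[], HV.neg _ _⟩]
      · have : τ = [] := List.length_eq_zero_iff.1 (by simpa using hτ.length)
        rw [this]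
        intro c hc hcs
        have : c = 0 := by simpa [sp] using hcs
        exact absurd this (hΦ.ne_zero hc)
    · refine hfinish (fun c hc hcs => front_pair (hF c hc hcs)) fun c τ hτ => ?_
      obtain ⟨d, rfl⟩ := List.length_eq_one_iff.1 (by simpa using hτ.length)
      exact full_singleton hΦ (hτ.sub hΦ hL d (by simp))
    · simp at hn; omega

end Trans

end HurwitzRS

namespace HurwitzRS

section Dihedral

open Polynomial Polynomial.Chebyshev in
theorem reflection_mul_pow_eq_one {E : Type*} [AddCommGroup E] [Module ℝ E] {x y : E}
    {f g : Module.Dual ℝ E} (hf : f x = 2) (hg : g y = 2) {m : ℕ} (hm : 2 ≤ m)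
    (hfy : f y = -(2 * Real.cos (Real.pi / m))) (hgx : g x = -(2 * Real.cos (Real.pi / m))) :
    (Module.reflection hf * Module.reflection hg) ^ m = 1 := by
  ext z
  set θ : ℝ := Real.pi / m with hθ
  have hm0 : (m : ℝ) ≠ 0 := by positivity
  have ht : 2 * Real.cos (2 * θ) = f y * g x - 2 := by
    rw [hfy, hgx, Real.cos_two_mul]; ring
  rw [Module.reflection_mul_reflection_pow_apply hf hg m z _ ht]
  rcases Nat.lt_or_ge 2 m with h3 | h3
  · have hs : Real.sin (2 * θ) ≠ 0 := by
      apply ne_of_gt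
      apply Real.sin_pos_of_pos_of_lt_pi
      · have := Real.pi_pos; positivity
      · have h4 : (3 : ℝ) ≤ m := by exact_mod_cast h3
        have := Real.pi_pos
        rw [hθ, ← mul_div_assoc, div_lt_iff₀ (by positivity)]
        nlinarith
    have hS : ∀ n : ℤ, (S ℝ n).eval (2 * Real.cos (2 * θ)) =
        Real.sin ((n + 1) * (2 * θ)) / Real.sin (2 * θ) := fun n => by
      rw [eq_div_iff hs, S_two_mul_real_cos]
    rcases Nat.even_or_odd' m with ⟨k, hk | hk⟩
    · have e1 : ((m : ℤ) - 2) / 2 = k - 1 := by omega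
      have e2 : ((m : ℤ) - 1) / 2 = k - 1 := by omega
      have h0 : (S ℝ ((k : ℤ) - 1)).eval (2 * Real.cos (2 * θ)) = 0 := by
        rw [hS]
        have : (((k : ℤ) - 1 : ℤ) + 1 : ℝ) * (2 * θ) = Real.pi := by
          push_cast; rw [hθ]; field_simp; rw [hk]; push_cast; ring
        rw [this, Real.sin_pi, zero_div]
      rw [e1, e2, h0]; simp
    · have e1 : ((m : ℤ) - 2) / 2 = k - 1 := by omega
      have e2 : ((m : ℤ) - 1) / 2 = k := by omega
      have e3 : ((m : ℤ) - 3) / 2 = k - 1 := by omega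
      have e4 : (m : ℤ) / 2 = k := by omega
      have h0 : (S ℝ (k : ℤ)).eval (2 * Real.cos (2 * θ)) +
          (S ℝ ((k : ℤ) - 1)).eval (2 * Real.cos (2 * θ)) = 0 := by
        rw [hS, hS, ← add_div]
        have h5 : (m : ℝ) * θ = Real.pi := by rw [hθ]; field_simp
        have h6 : ((k : ℤ) + 1 : ℝ) * (2 * θ) = Real.pi + θ := by
          rw [← h5, hk]; push_cast; ring
        have h7 : (((k : ℤ) - 1 : ℤ) + 1 : ℝ) * (2 * θ) = Real.pi - θ := by
          rw [← h5, hk]; push_cast; ring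
        rw [h6, h7, Real.sin_pi_sub, add_comm Real.pi, Real.sin_add_pi]; simp
      rw [e1, e2, e3, e4, h0]; simp
  · obtain rfl : m = 2 := by omega
    have hc : Real.cos θ = 0 := by rw [hθ]; simp
    have : Real.cos (2 * θ) = -1 := by rw [Real.cos_two_mul, hc]; norm_num
    rw [this, hfy, hgx, hc]
    simp only [Nat.cast_ofNat, sub_self, Int.zero_ediv]
    norm_num [S_one, S_zero]
    module

end Dihedral

section Tits

/-- Linear combinations of the given vectors with all coefficients zero or at least one. -/
def BigCone {B E : Type*} [AddCommGroup E] [Module ℝ E] (σ : B → E) : Set E :=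
  {v | ∃ c : B →₀ ℝ, (∀ j, c j = 0 ∨ 1 ≤ c j) ∧ v = Finsupp.linearCombination ℝ σ c}

/-- The Chebyshev recursion. -/
noncomputable def cheb (c : ℝ) : ℕ → ℝ
  | 0 => 1
  | 1 => c
  | n + 2 => c * cheb c (n + 1) - cheb c n

theorem cheb_two (n : ℕ) : cheb 2 n = n + 1 ∧ cheb 2 (n + 1) = n + 2 := by
  induction n with
  | zero => simp [cheb]
  | succ n ih =>
    refine ⟨by rw [ih.2]; push_cast; ring, ?_⟩
    rw [cheb, ih.1, ih.2]; push_cast; ring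

theorem cheb_cos (θ : ℝ) (n : ℕ) :
    cheb (2 * Real.cos θ) n * Real.sin θ = Real.sin ((n + 1) * θ) ∧
    cheb (2 * Real.cos θ) (n + 1) * Real.sin θ = Real.sin ((n + 2) * θ) := by
  induction n with
  | zero => simp [cheb, Real.sin_two_mul]; ring
  | succ n ih =>
    refine ⟨by rw [ih.2]; push_cast; ring_nf, ?_⟩
    rw [cheb, sub_mul, mul_assoc, ih.1, ih.2]
    push_cast
    have h1 : ((n : ℝ) + 1) * θ = (n + 2) * θ - θ := by ring
    have h2 : ((n : ℝ) + 1 + 2) * θ = (n + 2) * θ + θ := by ring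
    rw [h1, h2, Real.sin_add, Real.sin_sub]; ring

theorem cheb_zero_or_one_le {m : ℕ} (hm : m ≠ 1) {n : ℕ} (hn : m = 0 ∨ n < m) :
    cheb (2 * Real.cos (Real.pi / m)) n = 0 ∨ 1 ≤ cheb (2 * Real.cos (Real.pi / m)) n := by
  rcases Nat.eq_zero_or_pos m with rfl | hpos
  · right; simp [(cheb_two n).1]
  have hn : n < m := hn.resolve_left hpos.ne'
  have hm2 : 2 ≤ m := by omega
  have hmr : (2 : ℝ) ≤ m := by exact_mod_cast hm2
  set θ := Real.pi / m with hθ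
  have hpi := Real.pi_pos
  have h5 : (m : ℝ) * θ = Real.pi := by rw [hθ]; field_simp
  have hθpos : 0 < θ := by positivity
  have hθle : 2 * θ ≤ Real.pi := by rw [← h5]; nlinarith
  have hs : 0 < Real.sin θ := Real.sin_pos_of_pos_of_lt_pi hθpos (by linarith)
  have h := (cheb_cos θ n).1
  rcases Nat.lt_or_ge (n + 1) m with h1 | h1
  · right
    have h6 : Real.sin θ ≤ Real.sin ((n + 1) * θ) := by
      have h7 : θ ≤ (n + 1) * θ := by nlinarith [(Nat.cast_nonneg n : (0 : ℝ) ≤ n)]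
      have h8 : ((n : ℝ) + 1) * θ ≤ Real.pi - θ := by
        rw [← h5]
        have : ((n : ℝ) + 1) + 1 ≤ m := by exact_mod_cast h1
        nlinarith
      rcases le_total ((n + 1) * θ) (Real.pi / 2) with h9 | h9
      · exact Real.sin_le_sin_of_le_of_le_pi_div_two (by linarith) h9 h7
      · rw [← Real.sin_pi_sub ((n + 1) * θ)]
        exact Real.sin_le_sin_of_le_of_le_pi_div_two (by linarith) (by linarith) (by linarith)
    rw [← h] at h6
    by_contra! h9
    nlinarith
  · left
    have : (n : ℝ) + 1 = m := by exact_mod_cast (by omega : n + 1 = m)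
    rw [this, h5, Real.sin_pi] at h
    exact (mul_eq_zero.1 h).resolve_right hs.ne'

variable {B W E : Type*} [Group W] [AddCommGroup E] [Module ℝ E] {M : CoxeterMatrix B}

theorem bigCone_add {σ : B → E} {x y : E} (hx : x ∈ BigCone σ) (hy : y ∈ BigCone σ) :
    x + y ∈ BigCone σ := by
  obtain ⟨c, hc, rfl⟩ := hx
  obtain ⟨d, hd, rfl⟩ := hy
  refine ⟨c + d, fun j => ?_, by rw [map_add]⟩
  rw [Finsupp.add_apply]
  rcases hc j with h | h <;> rcases hd j with h' | h'
  · left; rw [h, h', add_zero]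
  all_goals right; linarith

theorem bigCone_smul {σ : B → E} {x : E} (hx : x ∈ BigCone σ) {t : ℝ} (ht : t = 0 ∨ 1 ≤ t) :
    t • x ∈ BigCone σ := by
  obtain ⟨c, hc, rfl⟩ := hx
  refine ⟨t • c, fun j => ?_, by rw [map_smul]⟩
  rw [Finsupp.smul_apply, smul_eq_mul]
  rcases hc j with h | h <;> rcases ht with h' | h'
  · left; rw [h, mul_zero]
  · left; rw [h, mul_zero]
  · left; rw [h', zero_mul]
  · right; nlinarith

theorem bigCone_self (σ : B → E) (i : B) : σ i ∈ BigCone σ := by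
  classical
  refine ⟨Finsupp.single i 1, fun j => ?_, by simp⟩
  rw [Finsupp.single_apply]; split_ifs <;> simp

/-- The action of an alternating product on a simple root. -/
theorem alternating_apply (cs : CoxeterSystem M W) (ρ : W →* (E →ₗ[ℝ] E)) (σ : B → E)
    (hρ : ∀ i j, ρ (cs.simple i) (σ j) = σ j + (2 * Real.cos (Real.pi / M i j)) • σ i) (i j : B)
    (k : ℕ) : ρ (cs.wordProd (CoxeterSystem.alternatingWord i j (k + 1))) (σ i) =
      cheb (2 * Real.cos (Real.pi / M i j)) (k + 1) • σ (if Even k then j else i) +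
      cheb (2 * Real.cos (Real.pi / M i j)) k • σ (if Even k then i else j) := by
  have hneg : ∀ i, ρ (cs.simple i) (σ i) = - σ i := fun i => by
    rw [hρ, M.diagonal]; simp; module
  induction k with
  | zero =>
    rw [CoxeterSystem.alternatingWord_succ]
    simp [CoxeterSystem.alternatingWord, hρ, M.symmetric j i, cheb, add_comm]
  | succ k ih =>
    rw [CoxeterSystem.alternatingWord_succ', CoxeterSystem.wordProd_cons, map_mul,
      Module.End.mul_apply, ih]
    by_cases hk : Even k
    · have hk' : ¬ Even (k + 1) := by simpa [Nat.even_add_one] using hk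
      simp only [hk, hk', if_true, if_false, map_add, map_smul, hneg, hρ, cheb]
      module
    · have hk' : Even (k + 1) := by simpa [Nat.even_add_one] using hk
      simp only [hk, hk', if_true, if_false, map_add, map_smul, hneg, hρ, cheb, M.symmetric j i]
      module

/-- The image of a simple root under an element without the corresponding descent has
all coefficients zero or at least one. -/
theorem mem_bigCone_of_not_isRightDescent (cs : CoxeterSystem M W) (ρ : W →* (E →ₗ[ℝ] E))
    (σ : B → E) (hρ : ∀ i j, ρ (cs.simple i) (σ j) = σ j + (2 * Real.cos (Real.pi / M i j)) • σ i)
    (w : W) (i : B) (hw : ¬ cs.IsRightDescent w i) : ρ w (σ i) ∈ BigCone σ := by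
  have key : ∀ n : ℕ, ∀ w : W, cs.length w = n → ∀ i, ¬ cs.IsRightDescent w i →
      ρ w (σ i) ∈ BigCone σ := by
    intro n
    induction n using Nat.strong_induction_on with
    | _ n ih =>
    intro w hn i hw
    by_cases h1 : w = 1
    · rw [h1, map_one]; exact bigCone_self σ i
    obtain ⟨j, hj⟩ := cs.exists_rightDescent_of_ne_one h1
    have hij : i ≠ j := by rintro rfl; exact hw hj
    set P : ℕ → Prop := fun k => cs.length (w * (cs.wordProd (CoxeterSystem.alternatingWord i j k))⁻¹)
      + k = cs.length w with hP
    have hP1 : P 1 := by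
      simp only [hP, CoxeterSystem.alternatingWord]
      simpa using cs.isRightDescent_iff.1 hj
    have hbd : ∀ k, P k → k ≤ n := fun k hk => by simp only [hP] at hk; omega
    obtain ⟨k, hPk, hnot⟩ : ∃ k, P (k + 1) ∧ ¬ P (k + 2) := by
      by_contra! hcon
      have : ∀ k, P (k + 1) := fun k => by
        induction k with
        | zero => exact hP1
        | succ k ih => exact hcon k ih
      have := hbd _ (this n)
      omega
    have hdown : ∀ k, P (k + 1) → P k := by
      intro k h
      simp only [hP] at h ⊢
      set a := cs.wordProd (CoxeterSystem.alternatingWord i j k) with ha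
      have h2 := cs.length_le_length_mul_add_right w a⁻¹
      have h3 : cs.length a⁻¹ ≤ k := by
        rw [cs.length_inv, ha]
        exact (cs.length_wordProd_le _).trans (by rw [CoxeterSystem.length_alternatingWord])
      have h4 := cs.length_mul_le (w * (cs.wordProd (CoxeterSystem.alternatingWord i j (k + 1)))⁻¹)
        (cs.simple (if Even k then j else i))
      rw [cs.length_simple] at h4
      have h5 : w * (cs.wordProd (CoxeterSystem.alternatingWord i j (k + 1)))⁻¹ *
          cs.simple (if Even k then j else i) = w * a⁻¹ := by
        rw [CoxeterSystem.alternatingWord_succ', CoxeterSystem.wordProd_cons]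
        simp [mul_assoc, ha]
      rw [h5] at h4
      omega
    have hdown' : ∀ k l, P (k + l) → P k := by
      intro k l
      induction l with
      | zero => exact id
      | succ l ih => exact fun h => ih (hdown _ h)
    have hkm : M i j = 0 ∨ k + 1 < M i j := by
      by_contra! hcon
      have h2 : P (M i j) := by
        apply hdown' _ (k + 1 - M i j)
        rwa [Nat.add_sub_cancel' hcon.2]
      obtain ⟨m, hm⟩ : ∃ m, M i j = m + 1 := ⟨M i j - 1, by omega⟩
      apply hw
      simp only [hP] at h2
      have h3 := cs.prod_alternatingWord_eq_prod_alternatingWord_sub i j (M i j) (by omega)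
      have h4 : M i j * 2 - M i j = m + 1 := by omega
      rw [h4, CoxeterSystem.alternatingWord_succ, CoxeterSystem.wordProd_concat] at h3
      set v := w * (cs.wordProd (CoxeterSystem.alternatingWord i j (M i j)))⁻¹ with hv
      have h5 : w * cs.simple i = v * cs.wordProd (CoxeterSystem.alternatingWord i j m) := by
        rw [hv, h3]; simp [mul_assoc]
      rw [CoxeterSystem.IsRightDescent, h5]
      have h6 := cs.length_mul_le v (cs.wordProd (CoxeterSystem.alternatingWord i j m))
      have h7 := cs.length_wordProd_le (CoxeterSystem.alternatingWord i j m)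
      rw [CoxeterSystem.length_alternatingWord] at h7
      omega
    have hm1 : M i j ≠ 1 := M.off_diagonal i j hij
    set v := w * (cs.wordProd (CoxeterSystem.alternatingWord i j (k + 1)))⁻¹ with hv
    have hvl : cs.length v + (k + 1) = cs.length w := hPk
    have hd1 : ¬ cs.IsRightDescent v (if Even k then j else i) := by
      have h5 : v * cs.simple (if Even k then j else i) =
          w * (cs.wordProd (CoxeterSystem.alternatingWord i j k))⁻¹ := by
        rw [hv, CoxeterSystem.alternatingWord_succ', CoxeterSystem.wordProd_cons]
        simp [mul_assoc]
      have h6 : P k := hdown k hPk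
      simp only [hP] at h6
      rw [CoxeterSystem.IsRightDescent, h5]
      omega
    have hd2 : ¬ cs.IsRightDescent v (if Even k then i else j) := by
      intro h
      apply hnot
      have h5 : v * cs.simple (if Even k then i else j) =
          w * (cs.wordProd (CoxeterSystem.alternatingWord i j (k + 2)))⁻¹ := by
        rw [hv, CoxeterSystem.alternatingWord_succ' i j (k + 1), CoxeterSystem.wordProd_cons,
          mul_inv_rev, ← mul_assoc]
        by_cases hk : Even k
        · have hk' : ¬ Even (k + 1) := by simpa [Nat.even_add_one] using hk
          simp [hk, hk']
        · have hk' : Even (k + 1) := by simpa [Nat.even_add_one] using hk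
          simp [hk, hk']
      have h6 := cs.isRightDescent_iff.1 h
      rw [h5] at h6
      simp only [hP]
      omega
    have hwv : w = v * cs.wordProd (CoxeterSystem.alternatingWord i j (k + 1)) := by simp [hv]
    rw [hwv, map_mul, Module.End.mul_apply, alternating_apply cs ρ σ hρ, map_add, map_smul, map_smul]
    refine bigCone_add (bigCone_smul (ih _ (by omega) v rfl _ hd1) ?_)
      (bigCone_smul (ih _ (by omega) v rfl _ hd2) ?_)
    · exact cheb_zero_or_one_le hm1 (by omega)
    · exact cheb_zero_or_one_le hm1 (by omega)
  exact key _ w rfl i hw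

theorem bigCone_or_neg (cs : CoxeterSystem M W) (ρ : W →* (E →ₗ[ℝ] E))
    (σ : B → E) (hρ : ∀ i j, ρ (cs.simple i) (σ j) = σ j + (2 * Real.cos (Real.pi / M i j)) • σ i)
    (w : W) (i : B) : ρ w (σ i) ∈ BigCone σ ∨ -ρ w (σ i) ∈ BigCone σ := by
  by_cases hw : cs.IsRightDescent w i
  · right
    have h := mem_bigCone_of_not_isRightDescent cs ρ σ hρ (w * cs.simple i) i
      (cs.isRightDescent_iff_not_isRightDescent_mul.1 hw)
    have hneg : ρ (cs.simple i) (σ i) = - σ i := by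
      rw [hρ, M.diagonal]; simp; module
    rwa [map_mul, Module.End.mul_apply, hneg, map_neg] at h
  · exact Or.inl (mem_bigCone_of_not_isRightDescent cs ρ σ hρ w i hw)

end Tits

end HurwitzRS

namespace HurwitzRS
open scoped RealInnerProductSpace goldenRatio

section Dichotomy
variable {V : Type*} [NormedAddCommGroup V] [InnerProductSpace ℝ V]

theorem IsSimple.linearIndependent {Ψ : Set V} {Δ : Finset V} (h : IsSimple Ψ Δ) {n : ℕ}
    {f : Fin n → V} (hf : Function.Injective f) (hfΔ : ∀ i, f i ∈ Δ) : LinearIndependent ℝ f := by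
  have h1 : LinearIndependent ℝ (fun d : Δ => (d : V)) := by
    rw [Fintype.linearIndependent_iff]
    intro g hg d
    classical
    have := h.li (fun v => if hv : v ∈ Δ then g ⟨v, hv⟩ else 0) (by
      rw [← hg, ← Finset.sum_attach Δ]
      exact Finset.sum_congr rfl fun x _ => by simp) d d.2
    simpa using this
  exact h1.comp (fun i => ⟨f i, hfΔ i⟩) fun i j hij => hf (Subtype.ext_iff.1 hij)

/-- A test vector with nonnegative coordinates has positive norm, also after increasing the
inner products. -/
theorem test_vector {n : ℕ} {f : Fin n → V} (hf : LinearIndependent ℝ f) (g : Fin n → ℝ)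
    (hg : ∀ i, 0 ≤ g i) (hg0 : ∃ i, g i ≠ 0) (C : Fin n → Fin n → ℝ)
    (hC : ∀ i j, ⟪f i, f j⟫ ≤ C i j) : 0 < ∑ i, ∑ j, g i * g j * C i j := by
  have h1 : ∑ i, g i • f i ≠ 0 := fun h => by
    obtain ⟨i, hi⟩ := hg0
    exact hi (Fintype.linearIndependent_iff.1 hf g h i)
  have h2 : 0 < ⟪∑ i, g i • f i, ∑ i, g i • f i⟫ := real_inner_self_pos.2 h1
  refine h2.trans_le ?_
  simp_rw [sum_inner, inner_sum, real_inner_smul_left, real_inner_smul_right]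
  refine Finset.sum_le_sum fun i _ => Finset.sum_le_sum fun j _ => ?_
  rw [← mul_assoc]
  exact mul_le_mul_of_nonneg_left (hC i j) (mul_nonneg (hg i) (hg j))

/-- Membership of a combination of two simple roots forces equal signs. -/
theorem IsSimple.pair_signs {Ψ : Set V} {Δ : Finset V} (h : IsSimple Ψ Δ) {a b : V}
    (ha : a ∈ Δ) (hb : b ∈ Δ) (hab : a ≠ b) {x y : ℝ} (hv : x • a + y • b ∈ Ψ) :
    0 ≤ x ∧ 0 ≤ y ∨ x ≤ 0 ∧ y ≤ 0 := by
  classical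
  have e : x • a + y • b = ∑ d ∈ Δ, (if d = a then x else if d = b then y else 0) • d := by
    rw [← Finset.sum_subset (s₁ := {a, b})]
    · rw [Finset.sum_pair hab]; simp [hab.symm]
    · intro d hd; simp at hd; rcases hd with rfl | rfl <;> assumption
    · intro d _ hd; simp at hd; simp [hd]
  rcases h.nonneg_or hv e with h1 | h1
  · left
    have h2 := h1 a ha; have h3 := h1 b hb
    simp [hab.symm] at h2 h3; exact ⟨h2, h3⟩
  · right
    have h2 := h1 a ha; have h3 := h1 b hb
    simp [hab.symm] at h2 h3; exact ⟨h2, h3⟩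

theorem IsSimple.edge_values {Ψ : Set V} {Δ : Finset V} (hΨ : IsRS Ψ) (h : IsSimple Ψ Δ) {a b : V}
    (ha : a ∈ Δ) (hb : b ∈ Δ) (hab : a ≠ b) :
    (⟪a, b⟫ : ℝ) = 0 ∨ (⟪a, b⟫ : ℝ) = -1 ∨ (⟪a, b⟫ : ℝ) = -√2 ∨ (⟪a, b⟫ : ℝ) = -φ ∨
      (⟪a, b⟫ : ℝ) ≤ -√3 := by
  obtain ⟨c, hc⟩ : ∃ c : ℝ, ⟪a, b⟫ = -c := ⟨-⟪a, b⟫, by ring⟩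
  have hc0 : 0 ≤ c := by have := h.obtuse hΨ ha hb hab; linarith
  have haa := hΨ.norm a (h.sub a ha)
  have hbb := hΨ.norm b (h.sub b hb)
  have hba : ⟪b, a⟫ = -c := by rw [real_inner_comm]; exact hc
  have hra : ∀ x y : ℝ, rf a (x • a + y • b) = (c * y - x) • a + y • b := fun x y => by
    rw [rf_apply haa, inner_add_right, inner_smul_right, inner_smul_right, haa, hc]; module
  have hrb : ∀ x y : ℝ, rf b (x • a + y • b) = x • a + (c * x - y) • b := fun x y => by
    rw [rf_apply hbb, inner_add_right, inner_smul_right, inner_smul_right, hbb, hba]; module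
  have hstep : ∀ x y : ℝ, x • a + y • b ∈ Ψ → (c * (c * x - y) - x) • a + (c * x - y) • b ∈ Ψ :=
    fun x y hx => by
      have := hΨ.refl a (h.sub a ha) _ (hΨ.refl b (h.sub b hb) _ hx)
      rwa [hrb, hra] at this
  have h0 : (1 : ℝ) • a + (0 : ℝ) • b ∈ Ψ := by simpa using h.sub a ha
  have h2 := hstep _ _ h0
  have h4 := hstep _ _ h2
  have h1' : (c : ℝ) • a + (1 : ℝ) • b ∈ Ψ := by
    have := hΨ.refl a (h.sub a ha) b (h.sub b hb)
    rw [show b = (0 : ℝ) • a + (1 : ℝ) • b by module, hra] at this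
    simpa using this
  have h3 := hstep _ _ h1'
  have h5 := hstep _ _ h3
  have s2 := h.pair_signs ha hb hab h2
  have s3 := h.pair_signs ha hb hab h3
  have s4 := h.pair_signs ha hb hab h4
  have s5 := h.pair_signs ha hb hab h5
  rw [hc]
  have r2 : √2 ^ 2 = (2 : ℝ) := Real.sq_sqrt (by norm_num)
  have r3 : √3 ^ 2 = (3 : ℝ) := Real.sq_sqrt (by norm_num)
  have p2 : 0 < √2 := by positivity
  have p3 : 0 < √3 := by positivity
  have pφ := Real.goldenRatio_pos
  have rφ := Real.goldenRatio_sq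
  rcases hc0.eq_or_lt with h0 | h0
  · left; rw [← h0]; simp
  right
  have k1 : 1 ≤ c := by
    rcases s2 with s | s
    · nlinarith
    · nlinarith
  rcases k1.eq_or_lt with h1 | h1
  · left; rw [← h1]
  right
  have k2 : 2 ≤ c ^ 2 := by
    rcases s3 with s | s
    · by_contra! hlt
      have : c * (c ^ 2 - 2) < 0 := mul_neg_of_pos_of_neg h0 (by linarith)
      nlinarith
    · nlinarith
  rcases k2.eq_or_lt with h2 | h2
  · left
    have : (c - √2) * (c + √2) = 0 := by nlinarith
    rcases mul_eq_zero.1 this with h | h <;> linarith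
  right
  have h23 : 0 < c * (c ^ 2 - 2) := by apply mul_pos h0; linarith
  have k3 : c ^ 4 - 3 * c ^ 2 + 1 ≥ 0 := by
    rcases s4 with s | s <;> nlinarith
  have k3' : φ ^ 2 ≤ c ^ 2 := by
    by_contra! hlt
    have hp1 : 1 < φ := Real.one_lt_goldenRatio
    have hp2 : φ < 2 := Real.goldenRatio_lt_two
    have : (c ^ 2 - φ ^ 2) * (c ^ 2 + φ ^ 2 - 3) < 0 :=
      mul_neg_of_neg_of_pos (by linarith) (by nlinarith)
    nlinarith
  rcases k3'.eq_or_lt with h3 | h3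
  · left
    have : (c - φ) * (c + φ) = 0 := by nlinarith
    rcases mul_eq_zero.1 this with h | h <;> linarith
  right
  have h24 : 0 < c ^ 4 - 3 * c ^ 2 + 1 := by
    have hp1 : 1 < φ := Real.one_lt_goldenRatio
    have : 0 < (c ^ 2 - φ ^ 2) * (c ^ 2 + φ ^ 2 - 3) := mul_pos (by linarith) (by nlinarith)
    nlinarith
  have k5 : 3 ≤ c ^ 2 := by
    by_contra! hlt
    have : c * (c ^ 2 - 1) * (c ^ 2 - 3) < 0 :=
      mul_neg_of_pos_of_neg (mul_pos h0 (by linarith)) (by linarith)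
    rcases s5 with s | s <;> nlinarith
  have : √3 ≤ c := by
    rw [← Real.sqrt_sq hc0]; exact Real.sqrt_le_sqrt k5
  linarith

/-- Irreducibility passes to simple systems. -/
theorem IsSimple.irr {Ψ : Set V} {Δ : Finset V} (hΨ : IsRS Ψ) (h : IsSimple Ψ Δ) (hI : Irr Ψ) :
    Irr (Δ : Set V) := by
  have e : {v | Gen (Δ : Set V) v} = Ψ := by
    ext v; exact ⟨fun hv => hΨ.gen_sub h.sub hv, fun hv => h.gen hΨ hv⟩
  exact Irr.of_gen (fun a ha => hΨ.ne_zero (h.sub a ha)) (by rwa [e])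

theorem IsSimple.exists_neighbor {Ψ : Set V} {Δ : Finset V} (hΨ : IsRS Ψ) (h : IsSimple Ψ Δ)
    (hI : Irr Ψ) (S : Finset V) (hne : ∃ a ∈ S, a ∈ Δ) (hcard : S.card < Δ.card) :
    ∃ a ∈ S, a ∈ Δ ∧ ∃ b ∈ Δ, b ∉ S ∧ (⟪a, b⟫ : ℝ) ≠ 0 := by
  obtain ⟨a, haS, ha⟩ := hne
  obtain ⟨b, hb, hbS⟩ : ∃ b ∈ Δ, b ∉ S := by
    by_contra! hcon
    exact absurd (Finset.card_le_card hcon) (by omega)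
  obtain ⟨x, hx, y, hy, hxS, hyS, hxy⟩ := h.irr hΨ hI (fun v => v ∈ S)
    ⟨a, ha, haS⟩ ⟨b, hb, hbS⟩
  exact ⟨x, hxS, hx, y, hy, hyS, hxy⟩

theorem IsSimple.edge_cases {Ψ : Set V} {Δ : Finset V} (hΨ : IsRS Ψ) (h : IsSimple Ψ Δ)
    (hI : Irr Ψ) (hcard : 3 ≤ Δ.card) {a b : V} (ha : a ∈ Δ) (hb : b ∈ Δ) (hab : a ≠ b) :
    (⟪a, b⟫ : ℝ) = 0 ∨ (⟪a, b⟫ : ℝ) = -1 ∨ (⟪a, b⟫ : ℝ) = -√2 ∨ (⟪a, b⟫ : ℝ) = -φ := by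
  rcases h.edge_values hΨ ha hb hab with h1 | h1 | h1 | h1 | h1
  · exact .inl h1
  · exact .inr (.inl h1)
  · exact .inr (.inr (.inl h1))
  · exact .inr (.inr (.inr h1))
  exfalso
  classical
  obtain ⟨b', hb'S, hb', e, he, heS, hbe⟩ := h.exists_neighbor hΨ hI {a, b} ⟨a, by simp, ha⟩
    ((Finset.card_le_two).trans_lt hcard)
  wlog hbb' : b' = b generalizing a b
  · refine this hb ha hab.symm (by rwa [real_inner_comm]) (by simpa [or_comm] using hb'S)
      (by simpa [or_comm, and_comm] using heS) ?_
    simp at hb'S; tauto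
  subst hbb'
  simp at heS
  have hbe1 : ⟪b', e⟫ ≤ (-1 : ℝ) := by
    have g2 : (1 : ℝ) ≤ √2 := Real.one_le_sqrt.2 (by norm_num)
    have g3 : (1 : ℝ) ≤ √3 := Real.one_le_sqrt.2 (by norm_num)
    have := Real.one_lt_goldenRatio
    rcases h.edge_values hΨ hb' he (Ne.symm heS.2) with h2 | h2 | h2 | h2 | h2
    · exact absurd h2 hbe
    all_goals linarith
  have hae : ⟪a, e⟫ ≤ (0 : ℝ) := h.obtuse hΨ ha he (Ne.symm heS.1)
  have hli := h.linearIndependent (f := ![a, b', e]) (by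
      intro i j hij
      fin_cases i <;> fin_cases j <;> simp_all [eq_comm]) (by
      intro i; fin_cases i <;> simp [*])
  have r3 : √3 * √3 = (3 : ℝ) := Real.mul_self_sqrt (by norm_num)
  have := test_vector hli ![√3, 2, 1] (by intro i; fin_cases i <;> simp) ⟨1, by simp⟩
    ![![2, -√3, 0], ![-√3, 2, -1], ![0, -1, 2]] (by
      have n1 := hΨ.norm a (h.sub a ha)
      have n2 := hΨ.norm b' (h.sub b' hb')
      have n3 := hΨ.norm e (h.sub e he)
      intro i j
      fin_cases i <;> fin_cases j <;> simp only [Fin.isValue, Fin.mk_one, Fin.reduceFinMk, Fin.zero_eta, Matrix.cons_val] <;> first | assumption | exact le_of_eq ‹_› | (rw [real_inner_comm]; assumption))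
  simp [Fin.sum_univ_succ] at this
  nlinarith

end Dichotomy

end HurwitzRS

namespace HurwitzRS
open scoped RealInnerProductSpace goldenRatio

section Golden
variable {V : Type*} [NormedAddCommGroup V] [InnerProductSpace ℝ V]

theorem IsSimple.test_vector {Ψ : Set V} {Δ : Finset V} (hΨ : IsRS Ψ) (h : IsSimple Ψ Δ) {n : ℕ}
    (f : Fin n → V) (hf : ∀ i, f i ∈ Δ) (g : Fin n → ℝ) (hg : ∀ i, 0 ≤ g i) (hg0 : ∃ i, g i ≠ 0)
    (C : Fin n → Fin n → ℝ) (hC : ∀ i j, i < j → f i ≠ f j ∧ ⟪f i, f j⟫ ≤ C i j) :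
    0 < ∑ i, ∑ j, g i * g j * (if i = j then 2 else if i < j then C i j else C j i) := by
  refine HurwitzRS.test_vector (h.linearIndependent (f := f) ?_ hf) g hg hg0 _ ?_
  · intro i j hij
    by_contra hne
    rcases lt_or_gt_of_ne hne with h1 | h1
    · exact (hC i j h1).1 hij
    · exact (hC j i h1).1 hij.symm
  · intro i j
    split_ifs with h1 h2
    · rw [h1, hΨ.norm _ (h.sub _ (hf j))]
    · exact (hC i j h2).2
    · rw [real_inner_comm]; exact (hC j i (lt_of_le_of_ne (not_lt.1 h2) (Ne.symm h1))).2

theorem IsSimple.golden {Ψ : Set V} {Δ : Finset V} (hΨ : IsRS Ψ) (h : IsSimple Ψ Δ) (hI : Irr Ψ)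
    (hcard : 3 ≤ Δ.card) {a b : V} (ha : a ∈ Δ) (hb : b ∈ Δ) (hab : (⟪a, b⟫ : ℝ) = -φ) :
    Δ.card ≤ 4 ∧ ∀ d ∈ Δ, ∀ e ∈ Δ,
      (⟪d, e⟫ : ℝ) = 2 ∨ (⟪d, e⟫ : ℝ) = 0 ∨ (⟪d, e⟫ : ℝ) = -1 ∨ (⟪d, e⟫ : ℝ) = -φ := by
  classical
  have pφ : (8 / 5 : ℝ) ≤ φ := by
    nlinarith [Real.goldenRatio_sq, Real.goldenRatio_pos]
  have p2 : (7 / 5 : ℝ) ≤ √2 := by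
    rw [Real.le_sqrt' (by norm_num)]; norm_num
  have hnab : a ≠ b := by
    rintro rfl
    rw [hΨ.norm a (h.sub a ha)] at hab; linarith
  have hle : ∀ d ∈ Δ, ∀ e ∈ Δ, d ≠ e → (⟪d, e⟫ : ℝ) ≠ 0 → (⟪d, e⟫ : ℝ) = -1 ∨
      (⟪d, e⟫ : ℝ) ≤ -(7 / 5) := fun d hd e he hne h0 => by
    rcases h.edge_cases hΨ hI hcard hd he hne with h1 | h1 | h1 | h1
    · exact absurd h1 h0
    · exact .inl h1
    · right; linarith
    · right; linarith
  have hle1 : ∀ d ∈ Δ, ∀ e ∈ Δ, d ≠ e → (⟪d, e⟫ : ℝ) ≠ 0 → (⟪d, e⟫ : ℝ) ≤ -1 :=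
    fun d hd e he hne h0 => by 
    rcases hle d hd e he hne h0 with h1 | h1 <;> linarith
  have hob : ∀ d ∈ Δ, ∀ e ∈ Δ, d ≠ e → (⟪d, e⟫ : ℝ) ≤ 0 := fun d hd e he hne =>
    h.obtuse hΨ hd he hne
  obtain ⟨b', hb'S, hb', c, hc, hcS, hbc⟩ := h.exists_neighbor hΨ hI {a, b} ⟨a, by simp, ha⟩
    ((Finset.card_le_two).trans_lt hcard)
  wlog hbb' : b' = b generalizing a b
  · refine this hb ha (by rwa [real_inner_comm]) hnab.symm (by simpa [or_comm] using hb'S)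
      (by simpa [or_comm, and_comm] using hcS) ?_
    simp at hb'S; tauto
  subst hbb'
  simp only [Finset.mem_insert, Finset.mem_singleton, not_or] at hcS
  obtain ⟨hca, hcb⟩ : c ≠ a ∧ c ≠ b' := hcS
  have hab' : (⟪a, b'⟫ : ℝ) ≤ -(8 / 5) := by linarith
  have hbc1 : (⟪b', c⟫ : ℝ) = -1 := by
    refine (hle b' hb' c hc hcb.symm hbc).resolve_right fun h1 => ?_
    have h2 := hob a ha c hc hca.symm
    have := h.test_vector hΨ (n := 3) ![a, b', c] (by intro i; fin_cases i <;> simp [*])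
      ![4 / 5, 1, 7 / 10] (by intro i; fin_cases i <;> norm_num) ⟨1, by simp⟩
      ![![0, -(8 / 5), 0], ![0, 0, -(7 / 5)], ![0, 0, 0]] (by
        intro i j hij
        fin_cases i <;> fin_cases j <;> first
          | exact absurd hij (by decide)
          | exact ⟨by simp [*, Ne.symm _], by simpa using by assumption⟩)
    simp +decide [Fin.sum_univ_three] at this
    norm_num at this
  have hbc1l := hbc1.le
  have hac : (⟪a, c⟫ : ℝ) = 0 := by
    by_contra h0
    have h2 := hle1 a ha c hc hca.symm h0
    have := h.test_vector hΨ (n := 3) ![a, b', c] (by intro i; fin_cases i <;> simp [*])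
      ![1, 1, 1] (by intro i; fin_cases i <;> norm_num) ⟨1, by simp⟩
      ![![0, -(8 / 5), -1], ![0, 0, -1], ![0, 0, 0]] (by
        intro i j hij
        fin_cases i <;> fin_cases j <;> first
          | exact absurd hij (by decide)
          | exact ⟨by simp [*, Ne.symm _], by simpa using by assumption⟩)
    simp +decide [Fin.sum_univ_three] at this
    norm_num at this
  have hacl := hac.le
  have hd1 : ∀ d ∈ Δ, d ≠ a → d ≠ b' → d ≠ c → (⟪a, d⟫ : ℝ) = 0 ∧ (⟪b', d⟫ : ℝ) = 0 := by
    intro d hd hda hdb hdc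
    have o1 := hob a ha d hd hda.symm
    have o2 := hob b' hb' d hd hdb.symm
    have o3 := hob c hc d hd hdc.symm
    constructor
    · by_contra h0
      have h2 := hle1 a ha d hd hda.symm h0
      have := h.test_vector hΨ (n := 4) ![a, b', c, d] (by intro i; fin_cases i <;> simp [*])
        ![1, 1, 1 / 2, 1 / 2] (by intro i; fin_cases i <;> norm_num) ⟨1, by simp⟩
        ![![0, -(8 / 5), 0, -1], ![0, 0, -1, 0], ![0, 0, 0, 0], ![0, 0, 0, 0]] (by
          intro i j hij
          fin_cases i <;> fin_cases j <;> first
            | exact absurd hij (by decide)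
            | exact ⟨by simp [*, Ne.symm _], by simpa using by assumption⟩)
      simp +decide [Fin.sum_univ_four] at this
      norm_num at this
    · by_contra h0
      have h2 := hle1 b' hb' d hd hdb.symm h0
      have := h.test_vector hΨ (n := 4) ![a, b', c, d] (by intro i; fin_cases i <;> simp [*])
        ![4 / 5, 1, 1 / 2, 1 / 2] (by intro i; fin_cases i <;> norm_num) ⟨1, by simp⟩
        ![![0, -(8 / 5), 0, 0], ![0, 0, -1, -1], ![0, 0, 0, 0], ![0, 0, 0, 0]] (by
          intro i j hij
          fin_cases i <;> fin_cases j <;> first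
            | exact absurd hij (by decide)
            | exact ⟨by simp [*, Ne.symm _], by simpa using by assumption⟩)
      simp +decide [Fin.sum_univ_four] at this
      norm_num at this
  have hself : ∀ d ∈ Δ, (⟪d, d⟫ : ℝ) = 2 := fun d hd => hΨ.norm d (h.sub d hd)
  have hba : (⟪b', a⟫ : ℝ) = -φ := by rw [real_inner_comm]; exact hab
  have hcb' : (⟪c, b'⟫ : ℝ) = -1 := by rw [real_inner_comm]; exact hbc1
  have hca' : (⟪c, a⟫ : ℝ) = 0 := by rw [real_inner_comm]; exact hac
  by_cases hΔ : Δ ⊆ {a, b', c}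
  · refine ⟨(Finset.card_le_card hΔ).trans (Finset.card_le_three.trans (by norm_num)), ?_⟩
    intro d hd e he
    have h1 := hΔ hd; have h2 := hΔ he
    simp only [Finset.mem_insert, Finset.mem_singleton] at h1 h2
    rcases h1 with rfl | rfl | rfl <;> rcases h2 with rfl | rfl | rfl <;>
      first | exact .inl (hself _ hd) | exact .inl (hself _ hc) | simp [*]
  have hΔ4 : 3 < Δ.card := by
    refine lt_of_le_of_lt (b := ({a, b', c} : Finset V).card) ?_ (Finset.card_lt_card ⟨?_, hΔ⟩)
    · rw [Finset.card_eq_three.2 ⟨a, b', c, hnab, hca.symm, hcb.symm, rfl⟩]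
    · intro x hx; simp at hx; rcases hx with rfl | rfl | rfl <;> assumption
  obtain ⟨c', hc'S, hc', d, hd, hdS, hcd⟩ := h.exists_neighbor hΨ hI {a, b', c} ⟨a, by simp, ha⟩
    (Finset.card_le_three.trans_lt hΔ4)
  simp only [Finset.mem_insert, Finset.mem_singleton, not_or] at hdS hc'S
  obtain ⟨hda, hdb, hdc⟩ : d ≠ a ∧ d ≠ b' ∧ d ≠ c := hdS
  obtain ⟨had, hbd⟩ := hd1 d hd hda hdb hdc
  obtain rfl : c' = c := by
    rcases hc'S with rfl | rfl | rfl
    · exact absurd had hcd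
    · exact absurd hbd hcd
    · rfl
  have hadl := had.le
  have hbdl := hbd.le
  have hcd1 : (⟪c', d⟫ : ℝ) = -1 := by
    refine (hle c' hc d hd hdc.symm hcd).resolve_right fun h1 => ?_
    have := h.test_vector hΨ (n := 4) ![a, b', c', d] (by intro i; fin_cases i <;> simp [*])
      ![8 / 10, 1, 72 / 100, 1 / 2] (by intro i; fin_cases i <;> norm_num) ⟨1, by simp⟩
      ![![0, -(8 / 5), 0, 0], ![0, 0, -1, 0], ![0, 0, 0, -(7 / 5)], ![0, 0, 0, 0]] (by
        intro i j hij
        fin_cases i <;> fin_cases j <;> first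
          | exact absurd hij (by decide)
          | exact ⟨by simp [*, Ne.symm _], by simpa using by assumption⟩)
    simp +decide [Fin.sum_univ_four] at this
    norm_num at this
  have hcd1l := hcd1.le
  have hΔe : Δ ⊆ {a, b', c', d} := by
    by_contra hΔ'
    have h5 : ({a, b', c', d} : Finset V).card < Δ.card := by
      refine Finset.card_lt_card ⟨?_, hΔ'⟩
      intro x hx; simp at hx; rcases hx with rfl | rfl | rfl | rfl <;> assumption
    obtain ⟨d', hd'S, hd', e, he, heS, hde⟩ := h.exists_neighbor hΨ hI {a, b', c', d}
      ⟨a, by simp, ha⟩ h5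
    simp only [Finset.mem_insert, Finset.mem_singleton, not_or] at heS hd'S
    obtain ⟨hea, heb, hec, hed⟩ : e ≠ a ∧ e ≠ b' ∧ e ≠ c' ∧ e ≠ d := heS
    obtain ⟨hae, hbe⟩ := hd1 e he hea heb hec
    have hael := hae.le
    have hbel := hbe.le
    have h2 := hle1 d' hd' e he (by rintro rfl; tauto) hde
    have o3 := hob c' hc e he hec.symm
    have o4 := hob d hd e he hed.symm
    rcases hd'S with rfl | rfl | rfl | rfl
    · exact hde hae
    · exact hde hbe
    · have := h.test_vector hΨ (n := 5) ![a, b', d', d, e] (by intro i; fin_cases i <;> simp [*])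
        ![8 / 10, 1, 72 / 100, 36 / 100, 36 / 100]
        (by intro i; fin_cases i <;> norm_num) ⟨1, by simp⟩
        ![![0, -(8 / 5), 0, 0, 0], ![0, 0, -1, 0, 0], ![0, 0, 0, -1, -1], ![0, 0, 0, 0, 0],
          ![0, 0, 0, 0, 0]] (by
          intro i j hij
          fin_cases i <;> fin_cases j <;> first
            | exact absurd hij (by decide)
            | exact ⟨by simp [*, Ne.symm _], by simpa using by assumption⟩)
      simp +decide [Fin.sum_univ_five] at this
      norm_num at this
    · have := h.test_vector hΨ (n := 5) ![a, b', c', d', e] (by intro i; fin_cases i <;> simp [*])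
        ![8 / 10, 1, 72 / 100, 44 / 100, 22 / 100]
        (by intro i; fin_cases i <;> norm_num) ⟨1, by simp⟩
        ![![0, -(8 / 5), 0, 0, 0], ![0, 0, -1, 0, 0], ![0, 0, 0, -1, 0], ![0, 0, 0, 0, -1],
          ![0, 0, 0, 0, 0]] (by
          intro i j hij
          fin_cases i <;> fin_cases j <;> first
            | exact absurd hij (by decide)
            | exact ⟨by simp [*, Ne.symm _], by simpa using by assumption⟩)
      simp +decide [Fin.sum_univ_five] at this
      norm_num at this
  refine ⟨(Finset.card_le_card hΔe).trans Finset.card_le_four, ?_⟩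
  intro x hx y hy
  have h1 := hΔe hx; have h2 := hΔe hy
  have hda' : (⟪d, a⟫ : ℝ) = 0 := by rw [real_inner_comm]; exact had
  have hdb' : (⟪d, b'⟫ : ℝ) = 0 := by rw [real_inner_comm]; exact hbd
  have hdc' : (⟪d, c'⟫ : ℝ) = -1 := by rw [real_inner_comm]; exact hcd1
  simp only [Finset.mem_insert, Finset.mem_singleton] at h1 h2
  rcases h1 with rfl | rfl | rfl | rfl <;> rcases h2 with rfl | rfl | rfl | rfl <;>
    first | exact .inl (hself _ hx) | simp [*]

end Golden

end HurwitzRS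

namespace HurwitzRS
open scoped RealInnerProductSpace goldenRatio

section GoldenInts

/-- The ring of integers of the golden field. -/
noncomputable def goldenInts : Subring ℝ where
  carrier := {x | ∃ m n : ℤ, x = m + n * φ}
  mul_mem' := by
    rintro _ _ ⟨m, n, rfl⟩ ⟨k, l, rfl⟩
    refine ⟨m * k + n * l, m * l + n * k + n * l, ?_⟩
    push_cast
    linear_combination (n * l : ℝ) * Real.goldenRatio_sq
  one_mem' := ⟨1, 0, by simp⟩
  add_mem' := by
    rintro _ _ ⟨m, n, rfl⟩ ⟨k, l, rfl⟩
    exact ⟨m + k, n + l, by push_cast; ring⟩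
  zero_mem' := ⟨0, 0, by simp⟩
  neg_mem' := by
    rintro _ ⟨m, n, rfl⟩
    exact ⟨-m, -n, by push_cast; ring⟩

theorem golden_inj {m n k l : ℤ} (h : (m + n * φ : ℝ) = k + l * φ) : m = k ∧ n = l := by
  by_cases hnl : n = l
  · subst hnl; exact ⟨by exact_mod_cast (add_right_cancel h : (m : ℝ) = k), rfl⟩
  · exfalso
    have hir := Real.goldenRatio_irrational
    apply hir
    have h1 : ((n - l : ℤ) : ℝ) ≠ 0 := by exact_mod_cast sub_ne_zero.2 hnl
    refine ⟨(k - m : ℚ) / (n - l : ℚ), ?_⟩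
    push_cast at h1 ⊢
    rw [div_eq_iff h1]; linarith

theorem sqrt_two_notMem_goldenInts : √2 ∉ goldenInts := by
  rintro ⟨m, n, h⟩
  have h1 : ((m * m + n * n : ℤ) + (2 * m * n + n * n : ℤ) * φ : ℝ) = (2 : ℤ) + (0 : ℤ) * φ := by
    have h2 : √2 * √2 = (2 : ℝ) := Real.mul_self_sqrt (by norm_num)
    rw [h] at h2
    push_cast
    linear_combination h2 - (n * n : ℝ) * Real.goldenRatio_sq
  obtain ⟨h2, h3⟩ := golden_inj h1
  rcases mul_eq_zero.1 (by linear_combination h3 : n * (2 * m + n) = 0) with h4 | h4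
  · subst h4
    have : m ≤ 1 := by nlinarith
    have : -1 ≤ m := by nlinarith
    interval_cases m <;> omega
  · obtain rfl : n = -2 * m := by linarith
    have : 5 * (m * m) = 2 := by linarith
    omega

variable {V : Type*} [NormedAddCommGroup V] [InnerProductSpace ℝ V]

theorem inner_mem_of_mem_span {R : Subring ℝ} {X Y : Set V} (h : ∀ a ∈ X, ∀ b ∈ Y, (⟪a, b⟫ : ℝ) ∈ R)
    {x y : V} (hx : x ∈ Submodule.span R X) (hy : y ∈ Submodule.span R Y) : (⟪x, y⟫ : ℝ) ∈ R := by
  induction hx using Submodule.span_induction with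
  | mem x hx =>
    induction hy using Submodule.span_induction with
    | mem y hy => exact h x hx y hy
    | zero => rw [inner_zero_right]; exact R.zero_mem
    | add a b _ _ h1 h2 => rw [inner_add_right]; exact R.add_mem h1 h2
    | smul r a _ h1 =>
      have : r • a = (r : ℝ) • a := rfl
      rw [this, real_inner_smul_right]; exact R.mul_mem r.2 h1
  | zero => rw [inner_zero_left]; exact R.zero_mem
  | add a b _ _ h1 h2 => rw [inner_add_left]; exact R.add_mem h1 h2
  | smul r a _ h1 =>
    have : r • a = (r : ℝ) • a := rfl
    rw [this, real_inner_smul_left]; exact R.mul_mem r.2 h1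

theorem Gen.mem_span_subring {R : Subring ℝ} {X : Set V} (hn : ∀ a ∈ X, (⟪a, a⟫ : ℝ) = 2)
    (h : ∀ a ∈ X, ∀ b ∈ X, (⟪a, b⟫ : ℝ) ∈ R) {v : V} (hv : Gen X v) : v ∈ Submodule.span R X := by
  refine hv.le_of_refl (P := fun v => v ∈ Submodule.span R X)
    (fun a ha => Submodule.subset_span ha) fun a ha b hb => ?_
  have h1 := inner_mem_of_mem_span h (Submodule.subset_span ha) hb
  have : ⟪a, b⟫ • a = (⟨_, h1⟩ : R) • a := rfl
  rw [rf_apply (hn a ha), this]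
  exact Submodule.sub_mem _ hb (Submodule.smul_mem _ _ (Submodule.subset_span ha))

theorem Gen.inner_mem_subring {R : Subring ℝ} {X : Set V} (hn : ∀ a ∈ X, (⟪a, a⟫ : ℝ) = 2)
    (h : ∀ a ∈ X, ∀ b ∈ X, (⟪a, b⟫ : ℝ) ∈ R) {v w : V} (hv : Gen X v) (hw : Gen X w) :
    (⟪v, w⟫ : ℝ) ∈ R :=
  inner_mem_of_mem_span h (hv.mem_span_subring hn h) (hw.mem_span_subring hn h)

end GoldenInts

section Flats
variable {V : Type*} [NormedAddCommGroup V] [InnerProductSpace ℝ V]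

theorem IsSimple.span_eq {Ψ : Set V} {Δ : Finset V} (h : IsSimple Ψ Δ) :
    Submodule.span ℝ (Δ : Set V) = Submodule.span ℝ Ψ := by
  apply le_antisymm
  · exact Submodule.span_mono h.sub
  · rw [Submodule.span_le]
    have hc : ∀ x ∈ cone Δ, x ∈ Submodule.span ℝ (Δ : Set V) := by
      rintro _ ⟨c, -, rfl⟩
      exact Submodule.sum_mem _ fun d hd => Submodule.smul_mem _ _ (Submodule.subset_span hd)
    intro b hb
    rcases h.pos b hb with h1 | h1
    · exact hc _ h1
    · simpa using Submodule.neg_mem _ (hc _ h1)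

theorem IsSimple.finrank_eq {Ψ : Set V} {Δ : Finset V} (h : IsSimple Ψ Δ) :
    Module.finrank ℝ (Submodule.span ℝ Ψ) = Δ.card := by
  rw [← h.span_eq]
  have h1 : LinearIndependent ℝ (fun d : Δ => (d : V)) := by
    rw [Fintype.linearIndependent_iff]
    intro g hg d
    classical
    have := h.li (fun v => if hv : v ∈ Δ then g ⟨v, hv⟩ else 0) (by
      rw [← hg, ← Finset.sum_attach Δ]
      exact Finset.sum_congr rfl fun x _ => by simp) d d.2
    simpa using this
  exact finrank_span_finset_eq_card h1

theorem IsRS.exists_flat [FiniteDimensional ℝ V] {Ψ : Set V} (hΨ : IsRS Ψ) (U : Submodule ℝ V) :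
    ∃ Δ Δ' : Finset V, IsSimple Ψ Δ ∧ Δ' ⊆ Δ ∧ IsSimple (Ψ ∩ U) Δ' := by
  classical
  obtain ⟨f₀, hf₀, hgen⟩ := exists_generic Uᗮ (S := Ψ \ U) (hΨ.fin.subset Set.sdiff_subset)
    (fun a ha => by
      by_contra! hcon
      apply ha.2
      rw [SetLike.mem_coe, ← Submodule.orthogonal_orthogonal U, Submodule.mem_orthogonal]
      intro y hy
      rw [real_inner_comm]; exact hcon y hy)
  obtain ⟨f, hf, hff⟩ := hΨ.exists_regular f₀
  obtain ⟨Δ, hΔ, hpos⟩ := hΨ.exists_simple hf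
  have hU : ∀ u ∈ U, (⟪u, f₀⟫ : ℝ) = 0 := fun u hu => (Submodule.mem_orthogonal _ _).1 hf₀ u hu
  have hnn : ∀ d ∈ Δ, (0 : ℝ) ≤ ⟪d, f₀⟫ := fun d hd => by
    by_contra! hlt
    have := hff (-d) (hΨ.neg (hΔ.sub d hd)) (by rw [inner_neg_left]; linarith)
    rw [inner_neg_left] at this
    linarith [hpos d hd]
  refine ⟨Δ, Δ.filter (fun d => d ∈ U), hΔ, Finset.filter_subset _ _, ?_⟩
  have hcone : ∀ b ∈ U, b ∈ cone Δ → b ∈ cone (Δ.filter (fun d => d ∈ U)) := by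
    rintro b hb ⟨c, hc, rfl⟩
    have h0 := hU _ hb
    simp_rw [sum_inner, real_inner_smul_left] at h0
    have h1 := (Finset.sum_eq_zero_iff_of_nonneg
      (fun d hd => mul_nonneg (hc d hd) (hnn d hd))).1 h0
    refine ⟨c, fun d hd => hc d (Finset.mem_filter.1 hd).1, ?_⟩
    rw [Finset.sum_filter]
    refine Finset.sum_congr rfl fun d hd => ?_
    split_ifs with hdU
    · rfl
    · rcases mul_eq_zero.1 (h1 d hd) with h2 | h2
      · rw [h2, zero_smul]
      · exact absurd h2 (hgen d ⟨hΔ.sub d hd, hdU⟩)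
  refine ⟨fun d hd => ?_, fun g hg d hd => ?_, fun b hb => ?_, ?_⟩
  · rw [Finset.mem_filter] at hd; exact ⟨hΔ.sub d hd.1, hd.2⟩
  · rw [sum_extend (Finset.filter_subset _ _)] at hg
    have := hΔ.li _ hg d (Finset.mem_filter.1 hd).1
    simpa [hd] using this
  · rcases hΔ.pos b hb.1 with h1 | h1
    · exact .inl (hcone b hb.2 h1)
    · exact .inr (hcone _ (U.neg_mem hb.2) h1)
  · exact ⟨f, fun d hd => hpos d (Finset.mem_filter.1 hd).1⟩

theorem Gen.pair_coords {a b : V} (ha : (⟪a, a⟫ : ℝ) = 2) (hb : (⟪b, b⟫ : ℝ) = 2) {c : ℝ}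
    (hc : (⟪a, b⟫ : ℝ) = -c) {P : ℝ → ℝ → Prop} (h1 : P 1 0) (h2 : P 0 1)
    (h3 : ∀ x y, P x y → P (c * y - x) y) (h4 : ∀ x y, P x y → P x (c * x - y)) {v : V}
    (hv : Gen {a, b} v) : ∃ x y, P x y ∧ v = x • a + y • b := by
  have hba : ⟪b, a⟫ = -c := by rw [real_inner_comm]; exact hc
  refine hv.le_of_refl (P := fun v => ∃ x y, P x y ∧ v = x • a + y • b) ?_ ?_
  · rintro d (rfl | rfl)
    · exact ⟨1, 0, h1, by simp⟩
    · exact ⟨0, 1, h2, by simp⟩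
  · rintro d (rfl | rfl) _ ⟨x, y, hxy, rfl⟩
    · refine ⟨_, _, h3 x y hxy, ?_⟩
      rw [rf_apply ha, inner_add_right, inner_smul_right, inner_smul_right, ha, hc]; module
    · refine ⟨_, _, h4 x y hxy, ?_⟩
      rw [rf_apply hb, inner_add_right, inner_smul_right, inner_smul_right, hb, hba]; module

theorem inner_pair_coords {a b : V} (ha : (⟪a, a⟫ : ℝ) = 2) (hb : (⟪b, b⟫ : ℝ) = 2) {c : ℝ}
    (hc : (⟪a, b⟫ : ℝ) = -c) (x y z w : ℝ) :
    (⟪x • a + y • b, z • a + w • b⟫ : ℝ) = 2 * x * z + 2 * y * w - c * (x * w + y * z) := by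
  have hba : ⟪b, a⟫ = -c := by rw [real_inner_comm]; exact hc
  simp only [inner_add_left, inner_add_right, real_inner_smul_left, real_inner_smul_right, ha, hb,
    hc, hba]
  ring

/-- The squares of the admissible inner products in the case without golden edges. -/
def CrysVal (x : ℝ) : Prop := x ^ 2 = 0 ∨ x ^ 2 = 1 ∨ x ^ 2 = 2 ∨ x ^ 2 = 4

/-- The admissible inner products in the golden case. -/
def GoldVal (x : ℝ) : Prop :=
  x = 0 ∨ x = 1 ∨ x = -1 ∨ x = φ ∨ x = -φ ∨ x = φ - 1 ∨ x = 1 - φ ∨ x = 2 ∨ x = -2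

theorem GoldVal.neg {x : ℝ} (h : GoldVal x) : GoldVal (-x) := by
  rcases h with rfl | rfl | rfl | rfl | rfl | rfl | rfl | rfl | rfl <;> simp [GoldVal]

theorem sq_one_cases {x : ℝ} (h : x ^ 2 = 1) : x = 1 ∨ x = -1 := by
  rwa [← sq_eq_sq_iff_eq_or_eq_neg, one_pow]

theorem pair_values {a b : V} (ha : (⟪a, a⟫ : ℝ) = 2) (hb : (⟪b, b⟫ : ℝ) = 2)
    (hc : (⟪a, b⟫ : ℝ) = 0 ∨ (⟪a, b⟫ : ℝ) = -1 ∨ (⟪a, b⟫ : ℝ) = -√2) {v w : V}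
    (hv : Gen {a, b} v) (hw : Gen {a, b} w) : CrysVal ⟪v, w⟫ := by
  have r2 : √2 * √2 = (2 : ℝ) := Real.mul_self_sqrt (by norm_num)
  rcases hc with hc | hc | hc
  · have hc' : (⟪a, b⟫ : ℝ) = -0 := by simpa using hc
    obtain ⟨x, y, hxy, rfl⟩ := hv.pair_coords ha hb hc'
      (P := fun x y => x ^ 2 = 1 ∧ y = 0 ∨ x = 0 ∧ y ^ 2 = 1) (by simp) (by simp)
      (by rintro x y (⟨h1, h2⟩ | ⟨h1, h2⟩) <;> simp [*]) (by rintro x y (⟨h1, h2⟩ | ⟨h1, h2⟩) <;> simp [*])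
    obtain ⟨z, w, hzw, rfl⟩ := hw.pair_coords ha hb hc'
      (P := fun x y => x ^ 2 = 1 ∧ y = 0 ∨ x = 0 ∧ y ^ 2 = 1) (by simp) (by simp)
      (by rintro x y (⟨h1, h2⟩ | ⟨h1, h2⟩) <;> simp [*]) (by rintro x y (⟨h1, h2⟩ | ⟨h1, h2⟩) <;> simp [*])
    rw [inner_pair_coords ha hb hc', CrysVal]
    rcases hxy with ⟨h1, rfl⟩ | ⟨rfl, h1⟩ <;> rcases hzw with ⟨h2, rfl⟩ | ⟨rfl, h2⟩ <;>
      simp [mul_pow, h1, h2] <;> norm_num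
  · have h1 : ∀ v, Gen {a, b} v → ∃ x y : ℝ, (x = 0 ∧ y ^ 2 = 1 ∨ x ^ 2 = 1 ∧ y = 0 ∨
        x ^ 2 = 1 ∧ y = x) ∧ v = x • a + y • b := fun v hv => by
      refine hv.pair_coords ha hb hc (by simp) (by simp) ?_ ?_
      · rintro x y (⟨h1, h2⟩ | ⟨h1, h2⟩ | ⟨h1, h2⟩) <;> simp [*]
      · rintro x y (⟨h1, h2⟩ | ⟨h1, h2⟩ | ⟨h1, h2⟩) <;> simp [*]
    obtain ⟨x, y, hxy, rfl⟩ := h1 v hv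
    obtain ⟨z, w, hzw, rfl⟩ := h1 w hw
    rw [inner_pair_coords ha hb hc, CrysVal]
    rcases hxy with ⟨rfl, h1⟩ | ⟨h1, rfl⟩ | ⟨h1, rfl⟩ <;>
      rcases hzw with ⟨rfl, h2⟩ | ⟨h2, rfl⟩ | ⟨h2, rfl⟩ <;>
      simp only [sub_sq, add_sq, mul_pow, h1, h2, mul_zero, zero_mul, add_zero, zero_add, sub_zero,
        zero_sub, neg_sq, one_mul, mul_one] <;>
      rcases sq_one_cases h1 with rfl | rfl <;> rcases sq_one_cases h2 with rfl | rfl <;> norm_num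
  · have h1 : ∀ v, Gen {a, b} v → ∃ x y : ℝ, (x = 0 ∧ y ^ 2 = 1 ∨ x ^ 2 = 1 ∧ y = 0 ∨
        x ^ 2 = 1 ∧ y = √2 * x ∨ x = √2 * y ∧ y ^ 2 = 1) ∧ v = x • a + y • b := fun v hv => by
      refine hv.pair_coords ha hb hc (by simp) (by simp) ?_ ?_
      · rintro x y (⟨h1, h2⟩ | ⟨h1, h2⟩ | ⟨h1, h2⟩ | ⟨h1, h2⟩) <;> simp [*]
        right; right; left
        have : √2 * (√2 * x) - x = x := by rw [← mul_assoc, r2]; ring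
        rw [this]; exact ⟨sq_one_cases h1, rfl⟩
      · rintro x y (⟨h1, h2⟩ | ⟨h1, h2⟩ | ⟨h1, h2⟩ | ⟨h1, h2⟩) <;> simp [*]
        right; right; right
        have : √2 * (√2 * y) - y = y := by rw [← mul_assoc, r2]; ring
        rw [this]; exact ⟨rfl, sq_one_cases h2⟩
    obtain ⟨x, y, hxy, rfl⟩ := h1 v hv
    obtain ⟨z, w, hzw, rfl⟩ := h1 w hw
    rw [inner_pair_coords ha hb hc, CrysVal]
    generalize √2 = s at *
    rcases hxy with ⟨rfl, h1⟩ | ⟨h1, rfl⟩ | ⟨h1, rfl⟩ | ⟨rfl, h1⟩ <;>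
      rcases hzw with ⟨rfl, h2⟩ | ⟨h2, rfl⟩ | ⟨h2, rfl⟩ | ⟨rfl, h2⟩ <;>
      rcases sq_one_cases h1 with rfl | rfl <;> rcases sq_one_cases h2 with rfl | rfl <;>
      clear h1 h2 hv hw ha hb hc <;> grind

/-- The `a, b`-coordinates of the roots of the rank two golden system. -/
def GoldPair (x y : ℝ) : Prop :=
  ∃ ε : ℝ, (ε = 1 ∨ ε = -1) ∧ (x = ε ∧ y = 0 ∨ x = 0 ∧ y = ε ∨ x = ε ∧ y = φ * ε ∨
    x = φ * ε ∧ y = ε ∨ x = φ * ε ∧ y = φ * ε)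

theorem GoldPair.symm {x y : ℝ} (h : GoldPair x y) : GoldPair y x := by
  obtain ⟨ε, hε, h⟩ := h
  exact ⟨ε, hε, by tauto⟩

theorem GoldPair.step {x y : ℝ} (h : GoldPair x y) : GoldPair (φ * y - x) y := by
  have rφ := Real.goldenRatio_sq
  obtain ⟨ε, hε, ⟨rfl, rfl⟩ | ⟨rfl, rfl⟩ | ⟨rfl, rfl⟩ | ⟨rfl, rfl⟩ | ⟨rfl, rfl⟩⟩ := h
  · exact ⟨-x, by rcases hε with rfl | rfl <;> simp, .inl ⟨by ring, rfl⟩⟩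
  · exact ⟨y, hε, .inr (.inr (.inr (.inl ⟨by ring, rfl⟩)))⟩
  · exact ⟨x, hε, .inr (.inr (.inr (.inr ⟨by linear_combination x * rφ, rfl⟩)))⟩
  · exact ⟨y, hε, .inr (.inl ⟨by ring, rfl⟩)⟩
  · exact ⟨ε, hε, .inr (.inr (.inl ⟨by linear_combination ε * rφ, rfl⟩))⟩

theorem GoldPair.goldVal {x y z w : ℝ} (h : GoldPair x y) (h' : GoldPair z w) :
    GoldVal (2 * x * z + 2 * y * w - φ * (x * w + y * z)) := by
  have rφ := Real.goldenRatio_sq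
  obtain ⟨ε, hε, h⟩ := h
  obtain ⟨δ, hδ, h'⟩ := h'
  suffices ∃ t, 2 * x * z + 2 * y * w - φ * (x * w + y * z) = ε * δ * t ∧ GoldVal t by
    obtain ⟨t, ht, hv⟩ := this
    rw [ht]
    rcases hε with rfl | rfl <;> rcases hδ with rfl | rfl <;> simp [hv, hv.neg]
  have g1 : GoldVal 2 := by simp [GoldVal]
  have g2 : GoldVal (-φ) := by simp [GoldVal]
  have g3 : GoldVal (1 - φ) := by simp [GoldVal]
  have g4 : GoldVal φ := by simp [GoldVal]
  have g5 : GoldVal (φ - 1) := by simp [GoldVal]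
  clear hε hδ
  rcases h with ⟨rfl, rfl⟩ | ⟨rfl, rfl⟩ | ⟨rfl, rfl⟩ | ⟨rfl, rfl⟩ | ⟨rfl, rfl⟩
  all_goals rcases h' with ⟨rfl, rfl⟩ | ⟨rfl, rfl⟩ | ⟨rfl, rfl⟩ | ⟨rfl, rfl⟩ | ⟨rfl, rfl⟩
  all_goals generalize φ = s at *
  all_goals first
    | exact ⟨2, by grind, g1⟩
    | exact ⟨-s, by grind, g2⟩
    | exact ⟨1 - s, by grind, g3⟩
    | exact ⟨s, by grind, g4⟩
    | exact ⟨s - 1, by grind, g5⟩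

theorem pair_values_golden {a b : V} (ha : (⟪a, a⟫ : ℝ) = 2) (hb : (⟪b, b⟫ : ℝ) = 2)
    (hc : (⟪a, b⟫ : ℝ) = -φ) {v w : V}
    (hv : Gen {a, b} v) (hw : Gen {a, b} w) : GoldVal ⟪v, w⟫ := by
  have h1 : ∀ v, Gen {a, b} v → ∃ x y : ℝ, GoldPair x y ∧ v = x • a + y • b := fun v hv =>
    hv.pair_coords ha hb hc ⟨1, by simp⟩ ⟨1, by simp⟩ (fun _ _ h => h.step)
      (fun _ _ h => h.symm.step.symm)
  obtain ⟨x, y, hxy, rfl⟩ := h1 v hv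
  obtain ⟨z, w, hzw, rfl⟩ := h1 w hw
  rw [inner_pair_coords ha hb hc]
  exact hxy.goldVal hzw

end Flats

end HurwitzRS

namespace HurwitzRS
open scoped RealInnerProductSpace goldenRatio

section Types
variable {V : Type*} [NormedAddCommGroup V] [InnerProductSpace ℝ V]

/-- An irreducible root system of rank at least three is either "crystallographic" (it lacks golden
edges) or golden, in which case its rank is at most four. -/
theorem IsRS.crys_or_gold [FiniteDimensional ℝ V] {Ψ : Set V} (hΨ : IsRS Ψ) (hI : Irr Ψ)
    (hr : 3 ≤ Module.finrank ℝ (Submodule.span ℝ Ψ)) :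
    (∀ a ∈ Ψ, ∀ b ∈ Ψ, CrysVal ⟪a, b⟫) ∨
    (Module.finrank ℝ (Submodule.span ℝ Ψ) ≤ 4 ∧ ∀ a ∈ Ψ, ∀ b ∈ Ψ, GoldVal ⟪a, b⟫) := by
  classical
  have flat : ∀ v ∈ Ψ, ∀ w ∈ Ψ, v ≠ w → v ≠ -w → ∃ Δ : Finset V, IsSimple Ψ Δ ∧
      ∃ a ∈ Δ, ∃ b ∈ Δ, a ≠ b ∧ Gen {a, b} v ∧ Gen {a, b} w := by
    intro v hv w hw h1 h2
    obtain ⟨Δ, Δ', hΔ, hsub, hΔ'⟩ := hΨ.exists_flat (Submodule.span ℝ {v, w})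
    have hvU : v ∈ Ψ ∩ (Submodule.span ℝ {v, w} : Submodule ℝ V) :=
      ⟨hv, Submodule.subset_span (by simp)⟩
    have hwU : w ∈ Ψ ∩ (Submodule.span ℝ {v, w} : Submodule ℝ V) :=
      ⟨hw, Submodule.subset_span (by simp)⟩
    have hsp : Submodule.span ℝ (Ψ ∩ (Submodule.span ℝ {v, w} : Submodule ℝ V)) =
        Submodule.span ℝ {v, w} := by
      apply le_antisymm
      · exact Submodule.span_le.2 Set.inter_subset_right
      · apply Submodule.span_mono
        rintro x (rfl | rfl)
        exacts [hvU, hwU]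
    have hli : LinearIndependent ℝ ![v, w] := by
      rw [LinearIndependent.pair_iff' (hΨ.ne_zero hv)]
      intro c hc
      rcases eq_or_neg_of_smul (hΨ.norm v hv) (hΨ.norm w hw) hc.symm with h | h
      · exact h1 h.symm
      · exact h2 (by rw [h, neg_neg])
    have h2 := finrank_span_eq_card hli
    rw [Matrix.range_cons, Matrix.range_cons, Matrix.range_empty, Set.union_empty,
      Set.singleton_union, ← hsp, hΔ'.finrank_eq, Fintype.card_fin] at h2
    obtain ⟨a, b, hab, e⟩ := Finset.card_eq_two.1 h2
    have hin := hΨ.inter (Submodule.span ℝ {v, w})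
    refine ⟨Δ, hΔ, a, hsub (by simp [e]), b, hsub (by simp [e]), hab, ?_, ?_⟩
    · simpa [e] using hΔ'.gen hin hvU
    · simpa [e] using hΔ'.gen hin hwU
  by_cases hg : ∃ Δ, IsSimple Ψ Δ ∧ ∃ a ∈ Δ, ∃ b ∈ Δ, (⟪a, b⟫ : ℝ) = -φ
  · right
    obtain ⟨Δ₀, hΔ₀, a₀, ha₀, b₀, hb₀, hab₀⟩ := hg
    have hg := hΔ₀.golden hΨ hI (hΔ₀.finrank_eq ▸ hr) ha₀ hb₀ hab₀
    have hφ : φ ∈ goldenInts := ⟨0, 1, by simp⟩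
    have hinn : ∀ v ∈ Ψ, ∀ w ∈ Ψ, (⟪v, w⟫ : ℝ) ∈ goldenInts := by
      intro v hv w hw
      refine Gen.inner_mem_subring (fun a ha => hΨ.norm a (hΔ₀.sub a ha)) ?_
        (hΔ₀.gen hΨ hv) (hΔ₀.gen hΨ hw)
      intro d hd e he
      rcases hg.2 d hd e he with h | h | h | h <;> rw [h]
      · exact ⟨2, 0, by simp⟩
      · exact goldenInts.zero_mem
      · exact goldenInts.neg_mem goldenInts.one_mem
      · exact goldenInts.neg_mem hφ
    refine ⟨by rw [hΔ₀.finrank_eq]; exact hg.1, fun v hv w hw => ?_⟩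
    by_cases h1 : v = w
    · subst h1; rw [hΨ.norm v hv]; simp [GoldVal]
    by_cases h2 : v = -w
    · subst h2; rw [inner_neg_left, hΨ.norm w hw]; simp [GoldVal]
    obtain ⟨Δ, hΔ, a, ha, b, hb, hab, hGv, hGw⟩ := flat v hv w hw h1 h2
    have hna := hΨ.norm a (hΔ.sub a ha)
    have hnb := hΨ.norm b (hΔ.sub b hb)
    have hcrys : CrysVal ⟪v, w⟫ → GoldVal ⟪v, w⟫ := by
      have hm := hinn v hv w hw
      generalize (⟪v, w⟫ : ℝ) = x at hm ⊢
      rintro (h | h | h | h)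
      · simp [GoldVal, pow_eq_zero_iff two_ne_zero |>.1 h]
      · rcases sq_one_cases h with rfl | rfl <;> simp [GoldVal]
      · exfalso
        apply sqrt_two_notMem_goldenInts
        rw [← h, Real.sqrt_sq_eq_abs]
        rcases abs_choice x with e | e <;> rw [e]
        exacts [hm, goldenInts.neg_mem hm]
      · have h' : x ^ 2 = 2 ^ 2 := by rw [h]; norm_num
        rcases sq_eq_sq_iff_eq_or_eq_neg.1 h' with rfl | rfl <;> simp [GoldVal]
    rcases hΔ.edge_cases hΨ hI (hΔ.finrank_eq ▸ hr) ha hb hab with h | h | h | h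
    · exact hcrys (pair_values hna hnb (.inl h) hGv hGw)
    · exact hcrys (pair_values hna hnb (.inr (.inl h)) hGv hGw)
    · exact hcrys (pair_values hna hnb (.inr (.inr h)) hGv hGw)
    · exact pair_values_golden hna hnb h hGv hGw
  · left
    push Not at hg
    intro v hv w hw
    by_cases h1 : v = w
    · subst h1; rw [hΨ.norm v hv]; norm_num [CrysVal]
    by_cases h2 : v = -w
    · subst h2; rw [inner_neg_left, hΨ.norm w hw]; norm_num [CrysVal]
    obtain ⟨Δ, hΔ, a, ha, b, hb, hab, hGv, hGw⟩ := flat v hv w hw h1 h2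
    have := hΔ.edge_cases hΨ hI (hΔ.finrank_eq ▸ hr) ha hb hab
    exact pair_values (hΨ.norm a (hΔ.sub a ha)) (hΨ.norm b (hΔ.sub b hb))
      (by have := hg Δ hΔ a ha b hb; tauto) hGv hGw

end Types

end HurwitzRS

namespace HurwitzRS
open scoped RealInnerProductSpace goldenRatio

section Crys
variable {V : Type*} [NormedAddCommGroup V] [InnerProductSpace ℝ V]

theorem rf_mul_rf_pow {a b : V} (ha : (⟪a, a⟫ : ℝ) = 2) (hb : (⟪b, b⟫ : ℝ) = 2) {m : ℕ}
    (hm : 2 ≤ m) (hab : (⟪a, b⟫ : ℝ) = -(2 * Real.cos (Real.pi / m))) :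
    (rf a * rf b) ^ m = 1 := by
  have hfa : (innerₗ V a) a = 2 := ha
  have hfb : (innerₗ V b) b = 2 := hb
  let F : (V ≃ₗᵢ[ℝ] V) →* (V ≃ₗ[ℝ] V) :=
    { toFun := fun g => g.toLinearEquiv, map_one' := rfl, map_mul' := fun _ _ => rfl }
  have hF : Function.Injective F := LinearIsometryEquiv.toLinearEquiv_injective
  have h1 : ∀ (c : V) (hc : (innerₗ V c) c = 2), F (rf c) = Module.reflection hc := by
    intro c hc
    ext v
    rw [Module.reflection_apply]
    exact rf_apply hc v
  apply hF
  rw [map_pow, map_mul, h1 a hfa, h1 b hfb, map_one]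
  exact reflection_mul_pow_eq_one hfa hfb hm hab (by
    rw [← hab]; exact real_inner_comm _ _)

/-- The group generated by roots with the indicated angles is a Coxeter group, hence its roots have
coefficients of a common sign which vanish or are at least one. -/
theorem Gen.coef_of_edges {S : Finset V} (hn : ∀ d ∈ S, (⟪d, d⟫ : ℝ) = 2)
    (hS : ∀ d ∈ S, ∀ e ∈ S, d ≠ e →
      (⟪d, e⟫ : ℝ) = 0 ∨ (⟪d, e⟫ : ℝ) = -1 ∨ (⟪d, e⟫ : ℝ) = -√2 ∨ (⟪d, e⟫ : ℝ) = -φ)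
    {v : V} (hv : Gen ↑S v) : ∃ c : V → ℝ, (∀ d ∈ S, c d = 0 ∨ 1 ≤ c d) ∧
      (v = ∑ d ∈ S, c d • d ∨ -v = ∑ d ∈ S, c d • d) := by
  classical
  let m : S → S → ℕ := fun i j => if i = j then 1 else if (⟪(i : V), j⟫ : ℝ) = 0 then 2 else
    if (⟪(i : V), j⟫ : ℝ) = -1 then 3 else if (⟪(i : V), j⟫ : ℝ) = -√2 then 4 else 5
  let M : CoxeterMatrix S :=
    { M := Matrix.of m
      isSymm := by
        ext i j
        simp only [Matrix.transpose_apply, Matrix.of_apply, m, real_inner_comm, eq_comm]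
      diagonal := fun i => by simp [m]
      off_diagonal := fun i j hij => by
        simp only [Matrix.of_apply, m, if_neg hij]
        split_ifs <;> norm_num }
  have hM : ∀ i j : S, (⟪(i : V), j⟫ : ℝ) = -(2 * Real.cos (Real.pi / M i j)) := by
    intro i j
    change _ = -(2 * Real.cos (Real.pi / m i j))
    simp only [m]
    split_ifs with h1 h2 h3 h4
    · subst h1; rw [hn _ i.2]; simp
    · rw [h2]; simp
    · rw [h3]; simp
    · rw [h4]; simp; ring
    · have := hS i i.2 j j.2 (fun h => h1 (Subtype.ext h))
      simp only [h2, h3, h4, false_or] at this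
      rw [this, Nat.cast_ofNat, Real.cos_pi_div_five, Real.goldenRatio]; ring
  have hlift : M.IsLiftable (fun i : S => rf (i : V)) := by
    intro i j
    by_cases hij : i = j
    · subst hij
      rw [rf_mul_self, one_pow]
    · apply rf_mul_rf_pow (hn _ i.2) (hn _ j.2) _ (hM i j)
      change 2 ≤ m i j
      simp only [m, if_neg hij]
      split_ifs <;> norm_num
  let cs := M.toCoxeterSystem
  let ρ₀ : M.Group →* (V ≃ₗᵢ[ℝ] V) := cs.lift ⟨_, hlift⟩
  have hρ₀ : ∀ i, ρ₀ (cs.simple i) = rf (i : V) := fun i => cs.lift_apply_simple hlift i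
  let ρ : M.Group →* (V →ₗ[ℝ] V) :=
    { toFun := fun g => (ρ₀ g).toLinearEquiv.toLinearMap
      map_one' := by ext v; simp
      map_mul' := fun g h => by ext v; simp [mul_app] }
  have hρv : ∀ g v, ρ g v = ρ₀ g v := fun _ _ => rfl
  have hsimple : ∀ i j : S, ρ (cs.simple i) (j : V) =
      (j : V) + (2 * Real.cos (Real.pi / M i j)) • (i : V) := by
    intro i j
    rw [hρv, hρ₀, rf_apply (hn _ i.2), hM]
    module
  obtain ⟨w, i, rfl⟩ : ∃ (w : M.Group) (i : S), v = ρ w (i : V) := by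
    refine hv.le_of_refl (P := fun v => ∃ (w : M.Group) (i : S), v = ρ w (i : V)) ?_ ?_
    · intro a ha
      exact ⟨1, ⟨a, ha⟩, by simp⟩
    · rintro a ha _ ⟨w, i, rfl⟩
      exact ⟨cs.simple ⟨a, ha⟩ * w, i, by rw [hρv, hρv, map_mul, mul_app, hρ₀]⟩
  have conv : ∀ u ∈ BigCone (fun i : S => (i : V)), ∃ c : V → ℝ, (∀ d ∈ S, c d = 0 ∨ 1 ≤ c d) ∧
      u = ∑ d ∈ S, c d • d := by
    rintro _ ⟨c, hc, rfl⟩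
    refine ⟨fun d => if h : d ∈ S then c ⟨d, h⟩ else 0, fun d hd => ?_, ?_⟩
    · simp only [hd, dite_true]; exact hc _
    · rw [Finsupp.linearCombination_apply, Finsupp.sum_fintype _ _ (by simp),
        ← Finset.sum_attach S]
      exact Finset.sum_congr rfl fun x _ => by simp
  rcases bigCone_or_neg cs ρ (fun i : S => (i : V)) hsimple w i with h | h
  · obtain ⟨c, hc, e⟩ := conv _ h
    exact ⟨c, hc, .inl e⟩
  · obtain ⟨c, hc, e⟩ := conv _ h
    exact ⟨c, hc, .inr e⟩

theorem Gen.coef_of_crys {S : Finset V} (hn : ∀ d ∈ S, (⟪d, d⟫ : ℝ) = 2)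
    (hS : ∀ d ∈ S, ∀ e ∈ S, d ≠ e → (⟪d, e⟫ : ℝ) = 0 ∨ (⟪d, e⟫ : ℝ) = -1 ∨ (⟪d, e⟫ : ℝ) = -√2)
    {v : V} (hv : Gen ↑S v) : ∃ c : V → ℝ, (∀ d ∈ S, c d = 0 ∨ 1 ≤ c d) ∧
      (v = ∑ d ∈ S, c d • d ∨ -v = ∑ d ∈ S, c d • d) :=
  hv.coef_of_edges hn fun d hd e he hde => (hS d hd e he hde).imp_right (Or.imp_right .inl)

theorem crys_tail [FiniteDimensional ℝ V] {Φ : Set V} (hΦ : IsRS Φ) {a : V} {τ : List V}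
    (hL : ∀ b ∈ a :: τ, b ∈ Φ) (hi : Ind (a :: τ)) (hF : Full Φ (a :: τ))
    (hc : ∀ u ∈ Φ, u ∈ sp (a :: τ) → ∀ v ∈ Φ, v ∈ sp (a :: τ) → CrysVal ⟪u, v⟫) :
    Full Φ τ ∧ ∀ x, x - pr (a :: τ) x = a → ∀ b ∈ Φ, b ∈ sp (a :: τ) →
      (⟪x, b⟫ : ℝ) = 0 ∨ 1 ≤ |(⟪x, b⟫ : ℝ)| := by
  classical
  have haΦ := hL a (by simp)
  have hτ : ∀ b ∈ τ, b ∈ Φ := fun b hb => hL b (by simp [hb])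
  have hτs : ({x | x ∈ τ} : Set V) ⊆ Φ := hτ
  have hG := hΦ.gen hτs
  obtain ⟨f, hf, hff⟩ := hG.exists_regular (-a)
  obtain ⟨Δ, hΔ, hpos⟩ := hG.exists_simple hf
  have hΔΦ : ∀ d ∈ Δ, d ∈ Φ := fun d hd => hΦ.gen_sub hτs (hΔ.sub d hd)
  have hΔsp : ∀ d ∈ Δ, d ∈ sp τ := fun d hd => (hΔ.sub d hd).mem_span
  have hle : sp τ ≤ sp (a :: τ) := sp_mono fun b hb => by simp [hb]
  have hna : a ∉ Δ := fun h => hi.1 (hΔsp a h)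
  have hao : ∀ d ∈ Δ, (⟪a, d⟫ : ℝ) ≤ 0 := fun d hd => by
    by_contra! hlt
    have := hff (-d) (hG.neg (hΔ.sub d hd)) (by rw [inner_neg_neg, real_inner_comm]; exact hlt)
    rw [inner_neg_left] at this
    linarith [hpos d hd]
  have hval : ∀ u ∈ Φ, u ∈ sp (a :: τ) → ∀ v ∈ Φ, v ∈ sp (a :: τ) → v ≠ u → v ≠ -u →
      (⟪u, v⟫ : ℝ) ≤ 0 → (⟪u, v⟫ : ℝ) = 0 ∨ (⟪u, v⟫ : ℝ) = -1 ∨ (⟪u, v⟫ : ℝ) = -√2 := by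
    intro u hu hu' v hv hv' h1 h2 h3
    have h4 := hc u hu hu' v hv hv'
    have h5 := abs_inner_lt_two (hΦ.norm u hu) (hΦ.norm v hv) h1 h2
    generalize (⟪u, v⟫ : ℝ) = t at *
    rw [abs_of_nonpos h3] at h5
    rcases h4 with h | h | h | h
    · exact .inl (by simpa using h)
    · right; left; nlinarith
    · right; right
      rw [← h, Real.sqrt_sq_eq_abs, abs_of_nonpos h3, neg_neg]
    · nlinarith
  have hasp : a ∈ sp (a :: τ) := mem_sp (by simp)
  obtain ⟨z, hz⟩ := exists_preimage hi hasp
  have hz1 := inner_preimage hz (hΦ.norm a haΦ)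
  have hzτ : ∀ t ∈ sp τ, (⟪t, z⟫ : ℝ) = 0 := fun t ht => by
    exact (Submodule.mem_orthogonal _ _).1 (mem_sp_orth.2 (preimage_orth hi (hΦ.norm a haΦ) hz)) t ht
  have hsumz : ∀ g : V → ℝ, (⟪∑ d ∈ insert a Δ, g d • d, z⟫ : ℝ) = g a := fun g => by
    rw [Finset.sum_insert hna, inner_add_left, real_inner_smul_left, hz1, sum_inner,
      Finset.sum_eq_zero, mul_one, add_zero]
    intro d hd
    rw [real_inner_smul_left, hzτ d (hΔsp d hd), mul_zero]
  have hne : ∀ d ∈ Δ, d ≠ a ∧ d ≠ -a := fun d hd => by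
    refine ⟨fun h => hna (h ▸ hd), fun h => hi.1 ?_⟩
    have := (sp τ).neg_mem (hΔsp d hd)
    rwa [h, neg_neg] at this
  have hangle : ∀ d ∈ insert a Δ, ∀ e ∈ insert a Δ, d ≠ e →
      (⟪d, e⟫ : ℝ) = 0 ∨ (⟪d, e⟫ : ℝ) = -1 ∨ (⟪d, e⟫ : ℝ) = -√2 := by
    intro d hd e he hde
    rcases Finset.mem_insert.1 hd with rfl | hd1 <;> rcases Finset.mem_insert.1 he with rfl | he
    · exact absurd rfl hde
    · exact hval d haΦ hasp e (hΔΦ e he) (hle (hΔsp e he)) (hne e he).1 (hne e he).2 (hao e he)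
    · rw [real_inner_comm]
      exact hval e haΦ hasp d (hΔΦ d hd1) (hle (hΔsp d hd1)) (hne d hd1).1 (hne d hd1).2 (hao d hd1)
    · refine hval d (hΔΦ d hd1) (hle (hΔsp d hd1)) e (hΔΦ e he) (hle (hΔsp e he)) (Ne.symm hde) ?_
        (hΔ.obtuse hG hd1 he hde)
      rintro rfl
      have h1 := hpos _ he
      rw [inner_neg_left] at h1
      linarith [hpos d hd1]
  have hcoef : ∀ b ∈ Φ, b ∈ sp (a :: τ) → ∃ c : V → ℝ, (∀ d ∈ insert a Δ, c d = 0 ∨ 1 ≤ c d) ∧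
      (b = ∑ d ∈ insert a Δ, c d • d ∨ -b = ∑ d ∈ insert a Δ, c d • d) := by
    intro b hb hbs
    refine Gen.coef_of_crys (fun d hd => ?_) hangle ?_
    · rcases Finset.mem_insert.1 hd with rfl | hd
      exacts [hΦ.norm d haΦ, hΦ.norm d (hΔΦ d hd)]
    · refine Gen.trans (fun e he => ?_) (hF b hb hbs)
      rcases List.mem_cons.1 he with rfl | he
      · exact Gen.base (by simp)
      · exact (hΔ.gen hG (Gen.base he)).mono (by simp)
  have hsimple : IsSimple (Φ ∩ sp (a :: τ)) (insert a Δ) := by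
    refine ⟨fun d hd => ?_, fun g hg => ?_, fun b hb => ?_, ?_⟩
    · rcases Finset.mem_insert.1 hd with rfl | hd
      exacts [⟨haΦ, hasp⟩, ⟨hΔΦ d hd, hle (hΔsp d hd)⟩]
    · have hga : g a = 0 := by rw [← hsumz g, hg, inner_zero_left]
      rw [Finset.sum_insert hna, hga, zero_smul, zero_add] at hg
      intro d hd
      rcases Finset.mem_insert.1 hd with rfl | hd
      exacts [hga, hΔ.li g hg d hd]
    · obtain ⟨c, hc, h⟩ := hcoef b hb.1 hb.2
      have hc' : ∀ d ∈ insert a Δ, 0 ≤ c d := fun d hd => by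
        rcases hc d hd with h | h <;> linarith
      exact h.imp (fun h => ⟨c, hc', h⟩) fun h => ⟨c, hc', h⟩
    · refine ⟨f + (|(⟪a, f⟫ : ℝ)| + 1) • z, fun d hd => ?_⟩
      rw [inner_add_right, real_inner_smul_right]
      rcases Finset.mem_insert.1 hd with rfl | hd
      · rw [hz1]; linarith [neg_abs_le (⟪d, f⟫ : ℝ)]
      · rw [hzτ d (hΔsp d hd)]; linarith [hpos d hd]
  refine ⟨fun b hb hbs => ?_, fun x hx b hb hbs => ?_⟩
  · refine Gen.trans (fun d hd => hΔ.sub d hd) (hsimple.gen_of_span (hΦ.inter _)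
      (Finset.subset_insert a Δ) ⟨hb, hle hbs⟩ ?_)
    rw [hΔ.span_eq]
    exact Submodule.span_mono (fun t ht => Gen.base ht) hbs
  · have hxz : ∀ b ∈ sp (a :: τ), (⟪x, b⟫ : ℝ) = ⟪b, z⟫ := by
      intro b hb
      have h1 := inner_preimage hx (hΦ.norm a haΦ)
      have h2 := mem_sp_orth.2 (preimage_orth hi (hΦ.norm a haΦ) hx)
      rw [sp_cons, Submodule.mem_sup] at hb
      obtain ⟨y, hy, t, ht, rfl⟩ := hb
      obtain ⟨k, rfl⟩ := Submodule.mem_span_singleton.1 hy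
      rw [real_inner_comm, inner_add_left, inner_add_left, real_inner_smul_left,
        real_inner_smul_left, h1, hz1, hzτ t ht, (Submodule.mem_orthogonal _ _).1 h2 t ht]
    rw [hxz b hbs]
    obtain ⟨c, hc, h⟩ := hcoef b hb hbs
    have h3 := hc a (by simp)
    rcases h with h | h
    · rw [h, hsumz]
      exact h3.imp_right fun h => h.trans (le_abs_self _)
    · have h4 : (⟪b, z⟫ : ℝ) = - c a := by rw [← hsumz c, ← h, inner_neg_left, neg_neg]
      rw [h4, neg_eq_zero, abs_neg]
      exact h3.imp_right fun h => h.trans (le_abs_self _)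

theorem Full.of_hv {Φ : Set V} {L L' : List V} (hF : Full Φ L) (h : HV L L') : Full Φ L' :=
  fun b hb hbs => (h.gen b).1 (hF b hb (h.sp ▸ hbs))

theorem Ctx.front_of_crys [FiniteDimensional ℝ V] {Φ : Set V} {L : List V} (h : Ctx Φ L)
    (hF : Full Φ L) (hlen : 2 ≤ L.length)
    (hc : ∀ u ∈ Φ, u ∈ sp L → ∀ v ∈ Φ, v ∈ sp L → CrysVal ⟪u, v⟫) : Front Φ L := by
  intro g hg hgs
  by_contra hgn
  obtain ⟨x, hx⟩ := exists_preimage h.ind hgs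
  refine h.mem_of_signs hlen hx fun b τ hb => ?_
  have hsp := hb.sp
  have hbΦ := hb.sub h.rs h.sub
  have hbs : b ∈ sp L := hsp ▸ mem_sp (by simp)
  have hbn := h.rs.norm b (hbΦ b (by simp))
  have hgn2 := h.rs.norm g hg
  obtain ⟨y, hy⟩ := exists_preimage h.ind hbs
  have hb0 : (⟪x, b⟫ : ℝ) ≠ 0 := fun h0 =>
    (h.compl_closed hg hgs hgn hx (hbΦ b (by simp)) hbs h0).1 ⟨τ, hb⟩
  have hg0 : (⟪y, g⟫ : ℝ) ≠ 0 := fun h0 => hgn (h.closed' hb hy hg hgs h0).1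
  have htail := (crys_tail h.rs hbΦ (hb.ind h.ind) (hF.of_hv hb) (by rwa [hsp])).2 y
    (by rw [hb.pr]; exact hy)
  rw [hsp] at htail
  have h1 := (htail g hg hgs).resolve_left hg0
  have hxy := inner_preimage_comm hx hy
  have hyx := inner_preimage_comm hy hx
  have hadd := inner_preimage_add hx hy
  have hw : (⟪x, b⟫ : ℝ) = -⟪y, (pr L)⁻¹ g⟫ := by
    rw [hxy, ← inner_inv, real_inner_comm]
  have h2 := htail ((pr L)⁻¹ g) (by
    rw [← pr_reverse]; exact h.rs.pr_mem (by simpa using h.sub) hg) (by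
    rw [← pr_reverse]; exact pr_mem (by simpa using fun a ha => mem_sp ha) hgs)
  rw [← neg_eq_zero, ← hw, ← abs_neg, ← hw] at h2
  replace h2 := h2.resolve_left hb0
  have hlt := abs_inner_lt_two hgn2 hbn (fun e => hgn ⟨τ, e ▸ hb⟩)
    (fun e => hgn ⟨τ, by have := hb.trans (HV.neg b τ); rwa [e, neg_neg] at this⟩)
  rw [← hadd, abs_lt] at hlt
  have hy' : (⟪pr L x, b⟫ : ℝ) = -⟪y, g⟫ := by rw [hyx, neg_neg, real_inner_comm]
  rw [hy']
  rcases le_abs'.1 h1 with h1 | h1 <;> rcases le_abs'.1 h2 with h2 | h2 <;> nlinarith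

end Crys

end HurwitzRS

namespace HurwitzRS
open scoped RealInnerProductSpace

section Geometric
variable {B W : Type*} [Group W] {M : CoxeterMatrix B}

theorem two_le_of_ne_zero (M : CoxeterMatrix B) {i j : B} (hij : i ≠ j) (h0 : M i j ≠ 0) :
    2 ≤ M i j := by
  have := M.off_diagonal i j hij
  have h1 : M i j ≠ 1 := this
  omega

theorem exists_linear_rep (cs : CoxeterSystem M W) : ∃ ρ : W →* ((B →₀ ℝ) ≃ₗ[ℝ] (B →₀ ℝ)),
    ∀ i v, ρ (cs.simple i) v = v - (Finsupp.linearCombination ℝ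
      (fun j => -(2 * Real.cos (Real.pi / M i j))) v) • Finsupp.single i 1 := by
  let f : B → Module.Dual ℝ (B →₀ ℝ) := fun i =>
    Finsupp.linearCombination ℝ (fun j => -(2 * Real.cos (Real.pi / M i j)))
  have hf : ∀ i, f i (Finsupp.single i 1) = 2 := fun i => by simp [f]
  have hfij : ∀ i j, f i (Finsupp.single j 1) = -(2 * Real.cos (Real.pi / M i j)) := fun i j => by
    simp [f]
  have hlift : M.IsLiftable (fun i => Module.reflection (hf i)) := by
    intro i j
    by_cases hij : i = j
    · subst hij
      have : Module.reflection (hf i) * Module.reflection (hf i) = 1 := by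
        ext1 v
        exact Module.involutive_reflection (hf i) v
      rw [this, one_pow]
    by_cases h0 : M i j = 0
    · rw [h0, pow_zero]
    · exact reflection_mul_pow_eq_one _ _ (two_le_of_ne_zero M hij h0) (hfij i j)
        (by rw [hfij, M.symmetric])
  refine ⟨cs.lift ⟨_, hlift⟩, fun i v => ?_⟩
  rw [cs.lift_apply_simple hlift, Module.reflection_apply]

theorem finite_of_finite [Finite W] (cs : CoxeterSystem M W) : Finite B := by
  obtain ⟨ρ, hρ⟩ := exists_linear_rep cs
  refine Finite.of_injective cs.simple fun i j hij => ?_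
  by_contra hne
  have h1 := hρ i (Finsupp.single i 1)
  rw [hij, hρ j] at h1
  have h2 := DFunLike.congr_fun h1 i
  simp [Ne.symm hne] at h2
  norm_num at h2

theorem exists_geometric.{u, v} {B : Type u} {W : Type v} [Group W] {M : CoxeterMatrix B}
    [Finite W] (cs : CoxeterSystem M W) :
    ∃ (ι : Type (max v u)) (_ : Fintype ι) (a : B → EuclideanSpace ℝ ι), LinearIndependent ℝ a ∧
      ∀ i j, (⟪a i, a j⟫ : ℝ) = -(2 * Real.cos (Real.pi / M i j)) := by
  classical
  obtain ⟨ρ, hρ⟩ := exists_linear_rep cs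
  have := finite_of_finite cs
  have := Fintype.ofFinite B
  have := Fintype.ofFinite W
  let F : (B →₀ ℝ) →ₗ[ℝ] EuclideanSpace ℝ (W × B) :=
    { toFun := fun v => WithLp.toLp 2 fun p => ρ p.1 v p.2
      map_add' := fun v w => by ext p; simp
      map_smul' := fun c v => by ext p; simp }
  have hF : ∀ v p, F v p = ρ p.1 v p.2 := fun _ _ => rfl
  have hFinj : LinearMap.ker F = ⊥ := by
    rw [LinearMap.ker_eq_bot']
    intro v hv
    ext j
    have := congrArg (fun u => u.ofLp (1, j)) hv
    simpa [hF] using this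
  have hinv : ∀ g v w, (⟪F (ρ g v), F (ρ g w)⟫ : ℝ) = ⟪F v, F w⟫ := by
    intro g v w
    simp only [PiLp.inner_apply, hF, Fintype.sum_prod_type]
    refine Fintype.sum_equiv (Equiv.mulRight g) _ _ fun h => ?_
    simp
  let e : B → EuclideanSpace ℝ (W × B) := fun i => F (Finsupp.single i 1)
  have heli : LinearIndependent ℝ e :=
    (Finsupp.linearIndependent_single_one ℝ B).map' F hFinj
  have hn : ∀ i, 0 < ‖e i‖ := fun i => norm_pos_iff.2 (heli.ne_zero i)
  have key : ∀ i j, 2 * (⟪e i, e j⟫ : ℝ) = -(2 * Real.cos (Real.pi / M i j)) * (‖e i‖ * ‖e i‖) := by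
    intro i j
    have h1 := hinv (cs.simple i) (Finsupp.single i 1) (Finsupp.single j 1)
    rw [hρ, hρ, map_sub, map_sub, map_smul, map_smul] at h1
    change (⟪e i - _ • e i, e j - _ • e i⟫ : ℝ) = ⟪e i, e j⟫ at h1
    simp only [Finsupp.linearCombination_single, one_smul, M.diagonal, Nat.cast_one, div_one,
      Real.cos_pi, inner_sub_left, inner_sub_right, real_inner_smul_left, real_inner_smul_right,
      real_inner_self_eq_norm_mul_norm] at h1
    linarith
  refine ⟨W × B, inferInstance, fun i => (√2 / ‖e i‖) • e i, ?_, fun i j => ?_⟩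
  · exact heli.units_smul (fun i => Units.mk0 (√2 / ‖e i‖) (by have := hn i; positivity))
  · have r2 : √2 * √2 = (2 : ℝ) := Real.mul_self_sqrt (by norm_num)
    have h1 := key i j
    have h2 := key j i
    rw [real_inner_comm, M.symmetric] at h2
    have hi := hn i
    have hj := hn j
    rw [real_inner_smul_left, real_inner_smul_right]
    have h3 : √2 / ‖e i‖ * (√2 / ‖e j‖ * ⟪e i, e j⟫) =
        √2 * √2 * ⟪e i, e j⟫ / (‖e i‖ * ‖e j‖) := by ring
    rw [h3, r2, div_eq_iff (by positivity), h1]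
    rcases eq_or_ne (-(2 * Real.cos (Real.pi / M i j))) 0 with h0 | h0
    · rw [h0]; ring
    · have h4 : ‖e i‖ * ‖e i‖ = ‖e j‖ * ‖e j‖ := mul_left_cancel₀ h0 (h1.symm.trans h2)
      have h5 : ‖e i‖ = ‖e j‖ := by
        rwa [← sq, ← sq, sq_eq_sq₀ hi.le hj.le] at h4
      rw [h5]

variable {V : Type*} [NormedAddCommGroup V] [InnerProductSpace ℝ V]

theorem exists_isometric_rep (cs : CoxeterSystem M W) {a : B → V} (hli : LinearIndependent ℝ a)
    (ha : ∀ i j, (⟪a i, a j⟫ : ℝ) = -(2 * Real.cos (Real.pi / M i j))) :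
    ∃ ρ : W →* (V ≃ₗᵢ[ℝ] V), Function.Injective ρ ∧ (∀ i, ρ (cs.simple i) = rf (a i)) ∧
      ∀ w i, ρ w (a i) ∈ BigCone a ∨ -ρ w (a i) ∈ BigCone a := by
  have hn : ∀ i, (⟪a i, a i⟫ : ℝ) = 2 := fun i => by rw [ha]; simp
  have hlift : M.IsLiftable (fun i => rf (a i)) := by
    intro i j
    by_cases hij : i = j
    · subst hij
      rw [rf_mul_self, one_pow]
    by_cases h0 : M i j = 0
    · rw [h0, pow_zero]
    · exact rf_mul_rf_pow (hn i) (hn j) (two_le_of_ne_zero M hij h0) (ha i j)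
  let ρ : W →* (V ≃ₗᵢ[ℝ] V) := cs.lift ⟨_, hlift⟩
  have hρ : ∀ i, ρ (cs.simple i) = rf (a i) := fun i => cs.lift_apply_simple hlift i
  let ρ' : W →* (V →ₗ[ℝ] V) :=
    { toFun := fun g => (ρ g).toLinearEquiv.toLinearMap
      map_one' := by ext v; simp
      map_mul' := fun g h => by ext v; simp [mul_app] }
  have hρ' : ∀ g v, ρ' g v = ρ g v := fun _ _ => rfl
  have hs : ∀ i j, ρ' (cs.simple i) (a j) = a j + (2 * Real.cos (Real.pi / M i j)) • a i := by
    intro i j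
    rw [hρ', hρ, rf_apply (hn i), ha]; module
  refine ⟨ρ, (injective_iff_map_eq_one ρ).2 fun w hw => ?_, hρ,
    fun w i => bigCone_or_neg cs ρ' a hs w i⟩
  by_contra hne
  obtain ⟨i, hi⟩ := cs.exists_rightDescent_of_ne_one hne
  have h1 := mem_bigCone_of_not_isRightDescent cs ρ' a hs (w * cs.simple i) i
    (cs.isRightDescent_iff_not_isRightDescent_mul.1 hi)
  rw [hρ', map_mul, hw, one_mul, hρ, rf_self] at h1
  obtain ⟨c, hc, e⟩ := h1
  have h2 : Finsupp.linearCombination ℝ a (Finsupp.single i (-1)) =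
      Finsupp.linearCombination ℝ a c := by
    rw [← e]; simp
  have h3 := DFunLike.congr_fun (hli h2) i
  have h4 := hc i
  rw [← h3] at h4
  norm_num at h4

end Geometric

end HurwitzRS

namespace HurwitzRS
open scoped RealInnerProductSpace

section HurwitzEquiv
variable {G : Type*} [Group G]

theorem HurwitzEquiv.symm {l m : List G} (h : HurwitzEquiv l m) : HurwitzEquiv m l := by
  induction h with
  | refl => exact Relation.ReflTransGen.refl
  | tail _ h ih => exact Relation.ReflTransGen.head (Or.symm h) ih

theorem HurwitzMove.cons (t : G) {l m : List G} (h : HurwitzMove l m) :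
    HurwitzMove (t :: l) (t :: m) := by
  obtain ⟨l₁, l₂, a, b, rfl, rfl⟩ := h
  exact ⟨t :: l₁, l₂, a, b, rfl, rfl⟩

theorem HurwitzEquiv.cons (t : G) {l m : List G} (h : HurwitzEquiv l m) :
    HurwitzEquiv (t :: l) (t :: m) := by
  induction h with
  | refl => exact Relation.ReflTransGen.refl
  | tail _ h ih => exact ih.tail (h.imp (HurwitzMove.cons t) (HurwitzMove.cons t))

theorem HurwitzEquiv.closure_eq {l m : List G} (h : HurwitzEquiv l m) :
    Subgroup.closure {t | t ∈ l} = Subgroup.closure {t | t ∈ m} := by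
  have move : ∀ l m : List G, HurwitzMove l m →
      Subgroup.closure {t | t ∈ l} = Subgroup.closure {t | t ∈ m} := by
    rintro _ _ ⟨l₁, l₂, a, b, rfl, rfl⟩
    have hl : ∀ x ∈ l₁ ++ a :: b :: l₂, x ∈ Subgroup.closure {t | t ∈ l₁ ++ a :: b :: l₂} :=
      fun x hx => Subgroup.subset_closure hx
    have hr : ∀ x ∈ l₁ ++ (a * b * a⁻¹) :: a :: l₂,
        x ∈ Subgroup.closure {t | t ∈ l₁ ++ (a * b * a⁻¹) :: a :: l₂} :=
      fun x hx => Subgroup.subset_closure hx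
    apply le_antisymm <;> rw [Subgroup.closure_le] <;> intro x hx <;>
      simp only [Set.mem_ofPred_eq, List.mem_append, List.mem_cons] at hx <;>
      rcases hx with hx | rfl | rfl | hx
    · exact hr x (by simp [hx])
    · exact hr x (by simp)
    · have := mul_mem (mul_mem (inv_mem (hr a (by simp))) (hr (a * x * a⁻¹) (by simp)))
        (hr a (by simp))
      simpa [mul_assoc] using this
    · exact hr x (by simp [hx])
    · exact hl x (by simp [hx])
    · exact mul_mem (mul_mem (hl a (by simp)) (hl b (by simp))) (inv_mem (hl a (by simp)))
    · exact hl x (by simp)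
    · exact hl x (by simp [hx])
  induction h with
  | refl => rfl
  | tail _ h ih => exact ih.trans (h.elim (move _ _) fun h => (move _ _ h).symm)

theorem HurwitzEquiv.of_map {H : Type*} [Group H] (f : G →* H) {l : List G} {m : List H} (h : HurwitzEquiv (l.map f) m) :
    ∃ l', m = l'.map f ∧ HurwitzEquiv l l' := by
  induction h with
  | refl => exact ⟨l, rfl, Relation.ReflTransGen.refl⟩
  | tail _ h ih =>
    obtain ⟨l', rfl, h'⟩ := ih
    rcases h with ⟨l₁, l₂, a, b, e, rfl⟩ | ⟨l₁, l₂, a, b, rfl, e⟩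
    · obtain ⟨k₁, k₂, rfl, rfl, e₁⟩ := List.map_eq_append_iff.1 e
      obtain ⟨x, k₂, rfl, rfl, e₂⟩ := List.map_eq_cons_iff.1 e₁
      obtain ⟨y, k₂, rfl, rfl, rfl⟩ := List.map_eq_cons_iff.1 e₂
      exact ⟨k₁ ++ (x * y * x⁻¹) :: x :: k₂, by simp, h'.tail (.inl ⟨k₁, k₂, x, y, rfl, rfl⟩)⟩
    · obtain ⟨k₁, k₂, rfl, rfl, e₁⟩ := List.map_eq_append_iff.1 e
      obtain ⟨z, k₂, rfl, hz, e₂⟩ := List.map_eq_cons_iff.1 e₁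
      obtain ⟨x, k₂, rfl, rfl, rfl⟩ := List.map_eq_cons_iff.1 e₂
      have hb : b = f (x⁻¹ * z * x) := by
        rw [map_mul, map_mul, hz, map_inv]; group
      refine ⟨k₁ ++ x :: (x⁻¹ * z * x) :: k₂, by simp [hb], h'.tail (.inr ⟨k₁, k₂, x, _, rfl, ?_⟩)⟩
      simp [mul_assoc]

end HurwitzEquiv

section Transfer
variable {V : Type*} [NormedAddCommGroup V] [InnerProductSpace ℝ V]

theorem HV.hurwitzEquiv {L L' : List V} (h : HV L L') : HurwitzEquiv (L.map rf) (L'.map rf) := by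
  induction h with
  | refl => exact Relation.ReflTransGen.refl
  | symm _ ih => exact HurwitzEquiv.symm ih
  | trans _ _ ih ih' => exact ih.trans ih'
  | cons a _ ih => exact HurwitzEquiv.cons _ ih
  | swap a b L =>
    refine Relation.ReflTransGen.single (.inl ⟨[], L.map rf, rf a, rf b, rfl, ?_⟩)
    simp [rf_rf_conj, rf_inv]
  | neg a L =>
    rw [List.map_cons, List.map_cons, rf_neg]
    exact Relation.ReflTransGen.refl

end Transfer

end HurwitzRS

namespace HurwitzRS
open scoped RealInnerProductSpace

section Reduction
variable {B W : Type*} [Group W] {M : CoxeterMatrix B} {V : Type*} [NormedAddCommGroup V]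
  [InnerProductSpace ℝ V]

/-- A faithful orthogonal representation of a Coxeter group with linearly independent simple
roots. -/
structure IsGeo (cs : CoxeterSystem M W) (a : B → V) (ρ : W →* (V ≃ₗᵢ[ℝ] V)) : Prop where
  li : LinearIndependent ℝ a
  norm : ∀ i, (⟪a i, a i⟫ : ℝ) = 2
  inj : Function.Injective ρ
  simple : ∀ i, ρ (cs.simple i) = rf (a i)
  big : ∀ w i, ρ w (a i) ∈ BigCone a ∨ -ρ w (a i) ∈ BigCone a

/-- The orbit of the simple roots. -/
def orbitRoots (a : B → V) (ρ : W →* (V ≃ₗᵢ[ℝ] V)) : Set V := {v | ∃ w i, v = ρ w (a i)}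

variable {cs : CoxeterSystem M W} {a : B → V} {ρ : W →* (V ≃ₗᵢ[ℝ] V)}

theorem IsGeo.map_reflection (h : IsGeo cs a ρ) (w : W) (i : B) :
    ρ (w * cs.simple i * w⁻¹) = rf (ρ w (a i)) := by
  rw [map_mul, map_mul, map_inv, h.simple, rf_conj]

theorem IsGeo.simple_mem (_h : IsGeo cs a ρ) (i : B) : a i ∈ orbitRoots a ρ := ⟨1, i, by simp⟩

theorem IsGeo.isRS [Finite W] [Finite B] (h : IsGeo cs a ρ) : IsRS (orbitRoots a ρ) where
  fin := by
    refine (Set.finite_range fun p : W × B => ρ p.1 (a p.2)).subset ?_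
    rintro _ ⟨w, i, rfl⟩
    exact ⟨(w, i), rfl⟩
  norm := by
    rintro _ ⟨w, i, rfl⟩
    rw [inner_map, h.norm]
  refl := by
    rintro _ ⟨w, i, rfl⟩ _ ⟨w', j, rfl⟩
    exact ⟨w * cs.simple i * w⁻¹ * w', j, by rw [map_mul, h.map_reflection, mul_app]⟩

theorem IsGeo.map_mem (_h : IsGeo cs a ρ) (w : W) {v : V} (hv : v ∈ orbitRoots a ρ) :
    ρ w v ∈ orbitRoots a ρ := by
  obtain ⟨u, i, rfl⟩ := hv
  exact ⟨w * u, i, by rw [map_mul, mul_app]⟩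

theorem IsGeo.exists_height [FiniteDimensional ℝ V] (h : IsGeo cs a ρ) :
    ∃ f : V, ∀ i, (⟪a i, f⟫ : ℝ) = 1 := by
  obtain ⟨g, hg⟩ := LinearMap.exists_extend
    (p := Submodule.span ℝ (Set.range a)) ((Module.Basis.span h.li).constr ℝ fun _ => (1 : ℝ))
  refine ⟨(InnerProductSpace.toDual ℝ V).symm g.toContinuousLinearMap, fun i => ?_⟩
  rw [real_inner_comm, InnerProductSpace.toDual_symm_apply]
  have h1 := LinearMap.congr_fun hg (Module.Basis.span h.li i)
  rw [Module.Basis.constr_basis] at h1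
  simpa [Module.Basis.span_apply] using h1

section
variable [Fintype B] [DecidableEq V]

theorem IsGeo.cone_of_bigCone (h : IsGeo cs a ρ) {v : V} (hv : v ∈ BigCone a) :
    v ∈ cone (Finset.univ.image a) := by
  obtain ⟨c, hc, rfl⟩ := hv
  have hinj := h.li.injective
  refine ⟨fun d => if hd : ∃ i, a i = d then c hd.choose else 0, fun d _ => ?_, ?_⟩
  · dsimp only
    split_ifs
    · rcases hc (Exists.choose ‹_›) with h0 | h0
      · exact h0.ge
      · exact zero_le_one.trans h0
    · exact le_rfl
  · rw [Finset.sum_image fun _ _ _ _ e => hinj e,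
      Finsupp.linearCombination_apply, Finsupp.sum_fintype _ _ (by simp)]
    refine Finset.sum_congr rfl fun i _ => ?_
    have hd : ∃ j, a j = a i := ⟨i, rfl⟩
    have h1 : hd.choose = i := hinj hd.choose_spec
    simp only [hd, dif_pos, h1]

theorem IsGeo.isSimple [FiniteDimensional ℝ V] (h : IsGeo cs a ρ) :
    IsSimple (orbitRoots a ρ) (Finset.univ.image a) where
  sub := by
    intro d hd
    obtain ⟨i, -, rfl⟩ := Finset.mem_image.1 hd
    exact h.simple_mem i
  li := by
    intro g hg d hd
    obtain ⟨i, -, rfl⟩ := Finset.mem_image.1 hd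
    rw [Finset.sum_image fun _ _ _ _ e => h.li.injective e] at hg
    exact Fintype.linearIndependent_iff.1 h.li (fun i => g (a i)) hg i
  pos := by
    rintro _ ⟨w, i, rfl⟩
    exact (h.big w i).imp h.cone_of_bigCone h.cone_of_bigCone
  ex := by
    obtain ⟨f, hf⟩ := h.exists_height
    refine ⟨f, fun d hd => ?_⟩
    obtain ⟨i, -, rfl⟩ := Finset.mem_image.1 hd
    rw [hf]; exact one_pos

end

theorem IsGeo.exists_roots (h : IsGeo cs a ρ) {l : List W} (hl : ∀ t ∈ l, cs.IsReflection t) :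
    ∃ L : List V, (∀ b ∈ L, b ∈ orbitRoots a ρ) ∧ l.map ρ = L.map rf := by
  induction l with
  | nil => exact ⟨[], by simp, rfl⟩
  | cons t l ih =>
    obtain ⟨L, hL, e⟩ := ih fun s hs => hl s (List.mem_cons_of_mem _ hs)
    obtain ⟨w, i, rfl⟩ := hl t List.mem_cons_self
    refine ⟨ρ w (a i) :: L, ?_, by rw [List.map_cons, List.map_cons, h.map_reflection, e]⟩
    intro b hb
    rcases List.mem_cons.1 hb with rfl | hb
    exacts [⟨w, i, rfl⟩, hL b hb]

theorem IsGeo.exists_reflections (h : IsGeo cs a ρ) {L : List V}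
    (hL : ∀ b ∈ L, b ∈ orbitRoots a ρ) :
    ∃ l : List W, (∀ t ∈ l, cs.IsReflection t) ∧ l.map ρ = L.map rf := by
  induction L with
  | nil => exact ⟨[], by simp, rfl⟩
  | cons b L ih =>
    obtain ⟨l, hl, e⟩ := ih fun s hs => hL s (List.mem_cons_of_mem _ hs)
    obtain ⟨w, i, rfl⟩ := hL b List.mem_cons_self
    refine ⟨w * cs.simple i * w⁻¹ :: l, ?_, by rw [List.map_cons, List.map_cons, h.map_reflection, e]⟩
    intro t ht
    rcases List.mem_cons.1 ht with rfl | ht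
    exacts [⟨w, i, rfl⟩, hl t ht]

theorem map_prod_eq_pr {l : List W} {L : List V} (e : l.map ρ = L.map rf) : ρ l.prod = pr L := by
  rw [map_list_prod, e, pr]

theorem redT_nonempty (cs : CoxeterSystem M W) (w : W) : ∃ l, l ∈ RedT cs w := by
  have hne : {k | ∃ l : List W, l.length = k ∧ (∀ t ∈ l, cs.IsReflection t) ∧ l.prod = w}.Nonempty := by
    obtain ⟨ω, rfl⟩ := cs.wordProd_surjective w
    refine ⟨_, ω.map cs.simple, rfl, fun t ht => ?_, rfl⟩
    obtain ⟨i, -, rfl⟩ := List.mem_map.1 ht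
    exact cs.isReflection_simple i
  obtain ⟨l, h⟩ := Nat.sInf_mem hne
  exact ⟨l, h⟩

theorem exists_word_of_mem_map_closure {l : List W} {L : List V}
    (e : l.map ρ = L.map rf) {g : V ≃ₗᵢ[ℝ] V} :
    g ∈ (Subgroup.closure {t | t ∈ l}).map ρ → ∃ K : List V, (∀ b ∈ K, b ∈ L) ∧ pr K = g := by
  rintro ⟨w, hw, rfl⟩
  have hmem : ∀ t ∈ l, ∃ b ∈ L, ρ t = rf b := by
    intro t ht
    have h1 : ρ t ∈ l.map ρ := List.mem_map_of_mem ht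
    rw [e] at h1
    obtain ⟨b, hb, e'⟩ := List.mem_map.1 h1
    exact ⟨b, hb, e'.symm⟩
  induction hw using Subgroup.closure_induction with
  | mem t ht =>
    obtain ⟨b, hb, e'⟩ := hmem t ht
    exact ⟨[b], by simpa using hb, by simp [e']⟩
  | one => exact ⟨[], by simp, by simp⟩
  | mul x y _ _ ihx ihy =>
    obtain ⟨K, hK, e1⟩ := ihx
    obtain ⟨K', hK', e2⟩ := ihy
    refine ⟨K ++ K', fun b hb => ?_, by rw [pr_append, e1, e2]; simp⟩
    rcases List.mem_append.1 hb with hb | hb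
    exacts [hK b hb, hK' b hb]
  | inv x _ ih =>
    obtain ⟨K, hK, e1⟩ := ih
    exact ⟨K.reverse, fun b hb => hK b (List.mem_reverse.1 hb), by rw [pr_reverse, e1]; simp⟩

theorem rf_mem_map_closure (h : IsGeo cs a ρ) {S : Set B} {v : V} (hv : Gen (a '' S) v) :
    rf v ∈ (Subgroup.closure (cs.simple '' S)).map ρ := by
  obtain ⟨K, hK, e⟩ := hv.exists_word
  rw [← e, pr]
  refine Subgroup.list_prod_mem _ fun x hx => ?_
  obtain ⟨b, hb, rfl⟩ := List.mem_map.1 hx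
  obtain ⟨i, hi, rfl⟩ := hK b hb
  exact ⟨cs.simple i, Subgroup.subset_closure ⟨i, hi, rfl⟩, h.simple i⟩

theorem IsGeo.sub_mem_span (h : IsGeo cs a ρ) {S : Set B} {g : W}
    (hg : g ∈ Subgroup.closure (cs.simple '' S)) :
    ∀ v, v - ρ g v ∈ Submodule.span ℝ (a '' S) := by
  induction hg using Subgroup.closure_induction with
  | mem t ht =>
    obtain ⟨i, hi, rfl⟩ := ht
    intro v
    rw [h.simple]
    exact Submodule.span_mono (by simpa using ⟨i, hi, rfl⟩) (sub_rf_mem (a i) v)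
  | one => intro v; simp
  | mul x y _ _ ihx ihy =>
    intro v
    rw [map_mul, mul_app]
    have := add_mem (ihx (ρ y v)) (ihy v)
    convert this using 1; abel
  | inv x _ ih =>
    intro v
    have := neg_mem (ih (ρ x⁻¹ v))
    rw [map_inv, app_inv_app] at this
    rw [map_inv]
    convert this using 1; abel

variable [Finite W] [Finite B] [FiniteDimensional ℝ V]

theorem IsGeo.ind_of_redT (h : IsGeo cs a ρ) {w : W} {l : List W} (hl : l ∈ RedT cs w)
    {L : List V} (hL : ∀ b ∈ L, b ∈ orbitRoots a ρ) (e : l.map ρ = L.map rf) : Ind L := by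
  obtain ⟨L₀, h0, hi, hp⟩ := h.isRS.carter hL
  obtain ⟨l₀, hl0, e0⟩ := h.exists_reflections h0
  have hprod : l₀.prod = w := by
    apply h.inj
    rw [map_prod_eq_pr e0, hp, ← map_prod_eq_pr e, hl.2.2]
  have h1 : reflLen cs w ≤ l₀.length := Nat.sInf_le ⟨l₀, rfl, hl0, hprod⟩
  have h2 : l.length = L.length := by simpa using congrArg List.length e
  have h3 : l₀.length = L₀.length := by simpa using congrArg List.length e0
  have h4 := hl.1
  exact (ind_of_pr_eq hi hp (by omega)).2.1

theorem IsGeo.full_of_isParabolic (h : IsGeo cs a ρ) {l : List W} {L : List V}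
    (hL : ∀ b ∈ L, b ∈ orbitRoots a ρ) (e : l.map ρ = L.map rf)
    (hP : IsParabolic cs (Subgroup.closure {t | t ∈ l})) : Full (orbitRoots a ρ) L := by
  classical
  have := Fintype.ofFinite B
  obtain ⟨u, S, hS⟩ := hP
  have h1 : sp L ≤ (Submodule.span ℝ (a '' S)).comap (ρ u⁻¹).toLinearEquiv.toLinearMap := by
    rw [sp_le]
    intro c hc
    have h2 : rf c ∈ l.map ρ := e ▸ List.mem_map_of_mem hc
    obtain ⟨t, ht, e'⟩ := List.mem_map.1 h2
    have h3 : t ∈ Subgroup.closure {t | t ∈ l} := Subgroup.subset_closure ht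
    rw [hS] at h3
    obtain ⟨g, hg, rfl⟩ := h3
    have h4 := h.sub_mem_span hg (ρ u⁻¹ c)
    have h5 : ρ g (ρ u⁻¹ c) = - ρ u⁻¹ c := by
      have h6 : g = u⁻¹ * (MulAut.conj u).toMonoidHom g * u := by simp [mul_assoc]
      rw [h6, map_mul, map_mul, e', mul_app, mul_app, map_inv, app_inv_app, rf_self, map_neg]
    rw [h5] at h4
    have h7 := Submodule.smul_mem _ (1 / 2 : ℝ) h4
    rwa [sub_neg_eq_add, ← two_smul ℝ, smul_smul, one_div, inv_mul_cancel₀ two_ne_zero,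
      one_smul] at h7
  intro b hb hbL
  have h2 : Gen (a '' S) (ρ u⁻¹ b) := by
    have := h.isSimple.gen_of_span h.isRS (S := (Finset.univ.filter (· ∈ S)).image a)
      (Finset.image_subset_image (Finset.filter_subset _ _)) (h.map_mem u⁻¹ hb)
      (by simpa using h1 hbL)
    simpa using this
  obtain ⟨g, hg, e'⟩ := rf_mem_map_closure h h2
  have h3 : rf b ∈ (Subgroup.closure {t | t ∈ l}).map ρ := by
    rw [hS]
    refine ⟨_, ⟨g, hg, rfl⟩, ?_⟩
    have h4 : rf b = rf (ρ u (ρ u⁻¹ b)) := by rw [map_inv, app_inv_app]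
    rw [h4, rf_conj, ← e']
    simp
  obtain ⟨K, hK, eK⟩ := exists_word_of_mem_map_closure e h3
  exact h.isRS.gen_of_rf_eq (X := {x | x ∈ L}) hL (h.isRS.norm b hb) (fun c hc => Gen.base (hK c hc)) eK

theorem IsGeo.isParabolic_of_forall (h : IsGeo cs a ρ) {l : List W} {L : List V}
    (hL : ∀ b ∈ L, b ∈ orbitRoots a ρ) (e : l.map ρ = L.map rf)
    (hF : ∀ b ∈ orbitRoots a ρ, b ∈ sp L → rf b ∈ (Subgroup.closure {t | t ∈ l}).map ρ) :
    IsParabolic cs (Subgroup.closure {t | t ∈ l}) := by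
  classical
  have := Fintype.ofFinite B
  have hsimple := h.isSimple
  obtain ⟨f, hf⟩ := h.exists_height
  obtain ⟨y, hy, hy'⟩ := exists_generic (sp L)ᗮ (S := orbitRoots a ρ \ sp L)
    (h.isRS.fin.subset Set.sdiff_subset) (by
      intro b hb
      by_contra hcon
      push Not at hcon
      refine hb.2 ?_
      rw [← Submodule.orthogonal_orthogonal (sp L)]
      intro y hy
      rw [real_inner_comm]
      exact hcon y hy)
  obtain ⟨g, hg⟩ := Finite.exists_max fun g : W => (⟪ρ g y, f⟫ : ℝ)
  have hdom : ∀ i, (0 : ℝ) ≤ ⟪a i, ρ g y⟫ := by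
    intro i
    have h1 := hg (cs.simple i * g)
    rw [map_mul, mul_app, h.simple, rf_apply (h.norm i), inner_sub_left, real_inner_smul_left,
      hf] at h1
    linarith
  set S : Set B := {i | (⟪a i, ρ g y⟫ : ℝ) = 0} with hSdef
  refine ⟨g⁻¹, S, le_antisymm ?_ ?_⟩
  · rw [Subgroup.closure_le]
    intro t ht
    have h2 : ρ t ∈ L.map rf := e ▸ List.mem_map_of_mem ht
    obtain ⟨c, hc, e'⟩ := List.mem_map.1 h2
    have key : ∀ v ∈ orbitRoots a ρ, (⟪v, ρ g y⟫ : ℝ) = 0 → v ∈ cone (Finset.univ.image a) →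
        Gen (a '' S) v := by
      intro v hv hv0 hvc
      have h3 : v ∈ cone ((Finset.univ.filter (· ∈ S)).image a) := by
        obtain ⟨k, hk, rfl⟩ := hvc
        rw [sum_inner] at hv0
        have h4 := (Finset.sum_eq_zero_iff_of_nonneg (fun d hd => by
          rw [real_inner_smul_left]
          obtain ⟨i, -, rfl⟩ := Finset.mem_image.1 hd
          exact mul_nonneg (hk _ hd) (hdom i))).1 hv0
        refine ⟨k, fun d hd => hk d (Finset.image_subset_image (Finset.filter_subset _ _) hd), ?_⟩
        refine (Finset.sum_subset (Finset.image_subset_image (Finset.filter_subset _ _)) ?_).symm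
        intro d hd hd'
        have h5 := h4 d hd
        rw [real_inner_smul_left] at h5
        obtain ⟨i, -, rfl⟩ := Finset.mem_image.1 hd
        rcases mul_eq_zero.1 h5 with h6 | h6
        · rw [h6, zero_smul]
        · exact absurd (Finset.mem_image_of_mem a (by simpa [hSdef] using h6)) hd'
      simpa using hsimple.gen_of_cone h.isRS (Finset.image_subset_image (Finset.filter_subset _ _)) hv h3
    have hcΦ := h.map_mem g (hL c hc)
    have hc0 : (⟪ρ g c, ρ g y⟫ : ℝ) = 0 := by
      rw [inner_map]; exact mem_sp_orth.1 hy c hc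
    have h5 : Gen (a '' S) (ρ g c) := by
      rcases hsimple.pos _ hcΦ with h6 | h6
      · exact key _ hcΦ hc0 h6
      · simpa using (key _ (h.isRS.neg hcΦ) (by rw [inner_neg_left, hc0, neg_zero]) h6).neg
    obtain ⟨x, hx, ex⟩ := rf_mem_map_closure h h5
    refine ⟨x, hx, h.inj ?_⟩
    rw [rf_conj, e'] at ex
    simp [ex, mul_assoc]
  · rw [Subgroup.map_le_iff_le_comap, Subgroup.closure_le]
    rintro _ ⟨i, hi, rfl⟩
    have hb : ρ g⁻¹ (a i) ∈ orbitRoots a ρ := ⟨g⁻¹, i, rfl⟩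
    have hb0 : (⟪ρ g⁻¹ (a i), y⟫ : ℝ) = 0 := by rw [map_inv, inner_inv]; exact hi
    have hbL : ρ g⁻¹ (a i) ∈ sp L := by
      by_contra hn
      exact hy' _ ⟨hb, hn⟩ hb0
    obtain ⟨x, hx, ex⟩ := hF _ hb hbL
    rw [← h.map_reflection] at ex
    have := h.inj ex
    rw [this] at hx
    simpa using hx

/-- The equivalence, given that reflection factorizations whose roots generate all the roots in
their span are Hurwitz equivalent to all others of the same element. -/
theorem IsGeo.transitive_iff (h : IsGeo cs a ρ)
    (hT : ∀ L L' : List V, (∀ b ∈ L, b ∈ orbitRoots a ρ) → Ind L → Full (orbitRoots a ρ) L →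
      (∀ b ∈ L', b ∈ orbitRoots a ρ) → L'.length = L.length → pr L' = pr L → HV L L') (w : W) :
    (∀ l₁ ∈ RedT cs w, ∀ l₂ ∈ RedT cs w, HurwitzEquiv l₁ l₂) ↔
    ∃ l ∈ RedT cs w, IsParabolic cs (Subgroup.closure {t | t ∈ l}) := by
  constructor
  · intro htr
    obtain ⟨l, hl⟩ := redT_nonempty cs w
    obtain ⟨L, hL, e⟩ := h.exists_roots hl.2.1
    refine ⟨l, hl, h.isParabolic_of_forall hL e fun b hb hbL => ?_⟩
    obtain ⟨τ, hτ, e1, e2⟩ := h.isRS.carter_front hL (h.ind_of_redT hl hL e) hb hbL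
    obtain ⟨l', hl', e'⟩ := h.exists_reflections (L := b :: τ) (by simpa using ⟨hb, hτ⟩)
    have h1 : l' ∈ RedT cs w := by
      refine ⟨?_, hl', h.inj ?_⟩
      · have h2 : l.length = L.length := by simpa using congrArg List.length e
        have h3 : l'.length = (b :: τ).length := by simpa using congrArg List.length e'
        rw [h3, e2, ← h2, hl.1]
      · rw [map_prod_eq_pr e', e1, ← map_prod_eq_pr e, hl.2.2]
    rw [HurwitzEquiv.closure_eq (htr l hl l' h1)]
    have h2 : rf b ∈ l'.map ρ := e' ▸ by simp
    obtain ⟨t, ht, et⟩ := List.mem_map.1 h2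
    exact ⟨t, Subgroup.subset_closure ht, et⟩
  · rintro ⟨l, hl, hP⟩
    obtain ⟨L, hL, e⟩ := h.exists_roots hl.2.1
    have key : ∀ l' ∈ RedT cs w, HurwitzEquiv l l' := by
      intro l' hl'
      obtain ⟨L', hL', e'⟩ := h.exists_roots hl'.2.1
      have h2 : l.length = L.length := by simpa using congrArg List.length e
      have h3 : l'.length = L'.length := by simpa using congrArg List.length e'
      have h4 := (hT L L' hL (h.ind_of_redT hl hL e) (h.full_of_isParabolic hL e hP) hL'
        (by rw [← h2, ← h3, hl.1, hl'.1])
        (by rw [← map_prod_eq_pr e', ← map_prod_eq_pr e, hl.2.2, hl'.2.2])).hurwitzEquiv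
      rw [← e, ← e'] at h4
      obtain ⟨m, hm, hlm⟩ := HurwitzEquiv.of_map ρ h4
      rwa [List.map_injective_iff.2 h.inj hm]
    intro l₁ h₁ l₂ h₂
    exact (HurwitzEquiv.symm (key l₁ h₁)).trans (key l₂ h₂)

end Reduction

end HurwitzRS

namespace HurwitzRS
open scoped RealInnerProductSpace goldenRatio

section Lattice
variable {V : Type*} [NormedAddCommGroup V] [InnerProductSpace ℝ V]

theorem GoldVal.coords {x : ℝ} (h : GoldVal x) : ∃ m n : ℤ, x = m + n * φ := by
  rcases h with h | h | h | h | h | h | h | h | h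
  · exact ⟨0, 0, by simp [h]⟩
  · exact ⟨1, 0, by simp [h]⟩
  · exact ⟨-1, 0, by simp [h]⟩
  · exact ⟨0, 1, by simp [h]⟩
  · exact ⟨0, -1, by simp [h]⟩
  · exact ⟨-1, 1, by rw [h]; push_cast; ring⟩
  · exact ⟨1, -1, by rw [h]; push_cast; ring⟩
  · exact ⟨2, 0, by simp [h]⟩
  · exact ⟨-2, 0, by simp [h]⟩

theorem GoldVal.mem_goldenInts {x : ℝ} (h : GoldVal x) : x ∈ goldenInts := h.coords

theorem GoldVal.cases_of_pos {x : ℝ} (h : GoldVal x) {m n : ℤ} (hx : x = m + n * φ) (hm : 1 ≤ m) :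
    x = 1 ∨ x = 2 ∨ x = 1 - φ := by
  have key : ∀ k l : ℤ, x = k + l * φ → k < 1 → False := fun k l hk hk' => by
    have := (golden_inj (hx.symm.trans hk)).1
    omega
  rcases h with h | h | h | h | h | h | h | h | h
  · exact (key 0 0 (by simp [h]) (by norm_num)).elim
  · exact .inl h
  · exact (key (-1) 0 (by simp [h]) (by norm_num)).elim
  · exact (key 0 1 (by simp [h]) (by norm_num)).elim
  · exact (key 0 (-1) (by simp [h]) (by norm_num)).elim
  · exact (key (-1) 1 (by rw [h]; push_cast; ring) (by norm_num)).elim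
  · exact .inr (.inr h)
  · exact .inr (.inl h)
  · exact (key (-2) 0 (by simp [h]) (by norm_num)).elim

theorem GoldVal.cases_of_pos_mul {x : ℝ} (h : GoldVal x) {m n : ℤ} (hx : φ * x = m + n * φ)
    (hm : 1 ≤ m) : x = φ ∨ x = φ - 1 := by
  have key : ∀ k l : ℤ, φ * x = k + l * φ → k < 1 → False := fun k l hk hk' => by
    have := (golden_inj (hx.symm.trans hk)).1
    omega
  have hp := Real.goldenRatio_sq
  rcases h with h | h | h | h | h | h | h | h | h
  · exact (key 0 0 (by simp [h]) (by norm_num)).elim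
  · exact (key 0 1 (by simp [h]) (by norm_num)).elim
  · exact (key 0 (-1) (by simp [h]) (by norm_num)).elim
  · exact .inl h
  · exact (key (-1) (-1) (by rw [h]; push_cast; linear_combination -hp) (by norm_num)).elim
  · exact .inr h
  · exact (key (-1) 0 (by rw [h]; push_cast; linear_combination -hp) (by norm_num)).elim
  · exact (key 0 2 (by rw [h]; push_cast; ring) (by norm_num)).elim
  · exact (key 0 (-2) (by rw [h]; push_cast; ring) (by norm_num)).elim

theorem GoldVal.cases_of_pos_mul_mul {x : ℝ} (h : GoldVal x) {m n : ℤ}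
    (hx : φ * (φ * x) = m + n * φ) (hm : 1 ≤ m) : x = 1 ∨ x = φ ∨ x = 2 := by
  have key : ∀ k l : ℤ, φ * (φ * x) = k + l * φ → k < 1 → False := fun k l hk hk' => by
    have := (golden_inj (hx.symm.trans hk)).1
    omega
  have hp := Real.goldenRatio_sq
  rcases h with h | h | h | h | h | h | h | h | h
  · exact (key 0 0 (by simp [h]) (by norm_num)).elim
  · exact .inl h
  · exact (key (-1) (-1) (by rw [h]; push_cast; linear_combination -hp) (by norm_num)).elim
  · exact .inr (.inl h)
  · exact (key (-1) (-2) (by rw [h]; push_cast; linear_combination -(φ + 1) * hp)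
      (by norm_num)).elim
  · exact (key 0 1 (by rw [h]; push_cast; linear_combination φ * hp) (by norm_num)).elim
  · exact (key 0 (-1) (by rw [h]; push_cast; linear_combination -φ * hp) (by norm_num)).elim
  · exact .inr (.inr h)
  · exact (key (-2) (-2) (by rw [h]; push_cast; linear_combination -2 * hp) (by norm_num)).elim

theorem eq_of_inner_eq_two {a b : V} (ha : (⟪a, a⟫ : ℝ) = 2) (hb : (⟪b, b⟫ : ℝ) = 2)
    (h : (⟪a, b⟫ : ℝ) = 2) : a = b := by
  have : (⟪a - b, a - b⟫ : ℝ) = 0 := by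
    rw [inner_sub_left, inner_sub_right, inner_sub_right, real_inner_comm a b, ha, hb, h]
    norm_num
  exact sub_eq_zero.1 (inner_self_eq_zero.1 this)

theorem exists_pos_of_inner_sum {v : V} {M : List V}
    (h : ∀ m ∈ M, (⟪v, m⟫ : ℝ) ∈ goldenInts) {p q : ℤ} (hp : 1 ≤ p)
    (hs : (⟪v, M.sum⟫ : ℝ) = p + q * φ) :
    ∃ m ∈ M, ∃ k l : ℤ, 1 ≤ k ∧ (⟪v, m⟫ : ℝ) = k + l * φ := by
  induction M generalizing p q with
  | nil =>
    rw [List.sum_nil, inner_zero_right] at hs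
    have := (golden_inj (m := 0) (n := 0) (by simpa using hs)).1
    omega
  | cons a M ih =>
    obtain ⟨k, l, hkl⟩ := h a (by simp)
    by_cases hk : 1 ≤ k
    · exact ⟨a, by simp, k, l, hk, hkl⟩
    · rw [List.sum_cons, inner_add_right, hkl] at hs
      obtain ⟨m, hm, hm'⟩ := ih (fun m hm => h m (by simp [hm])) (p := p - k) (q := q - l)
        (by omega) (by push_cast; linarith)
      exact ⟨m, by simp [hm], hm'⟩

/-- The multiples `r` and `φ r` of a root. -/
def Dbl (r v : V) : Prop := v = r ∨ v = φ • r

theorem exists_sub_dbl_aux {t : ℝ} (ht : t ^ 2 = t + 1) {b r : V} (hb : (⟪b, b⟫ : ℝ) = 2)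
    (hr : (⟪r, r⟫ : ℝ) = 2) :
    ((⟪b, r⟫ : ℝ) = 1 - t → ∃ s, Gen {b, r} s ∧ b - r = t • s ∧ Gen {r, s} b) ∧
    ((⟪b, r⟫ : ℝ) = t - 1 → ∃ s, Gen {b, r} s ∧ b - t • r = t • s ∧ Gen {r, s} b) ∧
    ((⟪b, r⟫ : ℝ) = t → ∃ s, Gen {b, r} s ∧ t • b - r = s ∧ Gen {r, s} b) ∧
    ((⟪b, r⟫ : ℝ) = t → ∃ s, Gen {b, r} s ∧ t • b - t • r = s ∧ Gen {r, s} b) := by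
  have g1 : Gen {b, r} b := .base (by simp)
  have g2 : Gen {b, r} r := .base (by simp)
  have e1 : ∀ s : V, Gen {r, s} r := fun s => .base (by simp)
  have e2 : ∀ s : V, Gen {r, s} s := fun s => .base (by simp)
  have hrb : ∀ c : ℝ, (⟪b, r⟫ : ℝ) = c → rf r b = b - c • r := fun c hc => by
    rw [rf_apply hr, real_inner_comm, hc]
  have hbr : ∀ c : ℝ, (⟪b, r⟫ : ℝ) = c → rf b r = r - c • b := fun c hc => by
    rw [rf_apply hb, hc]
  have key : ∀ s, Gen {b, r} s → ∀ p q c : ℝ, s = p • b + q • r → (⟪b, r⟫ : ℝ) = c →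
      rf r s = s - (c * p + 2 * q) • r ∧ rf s r = r - (c * p + 2 * q) • s := by
    rintro s hs p q c e hc
    have hss : (⟪s, s⟫ : ℝ) = 2 := hs.norm fun a ha => by
      rcases ha with rfl | rfl <;> assumption
    have : (⟪r, s⟫ : ℝ) = c * p + 2 * q := by
      rw [e, inner_add_right, inner_smul_right, inner_smul_right, real_inner_comm, hc, hr]; ring
    rw [rf_apply hr, rf_apply hss, real_inner_comm r s, this]
    exact ⟨rfl, rfl⟩
  refine ⟨fun h => ?_, fun h => ?_, fun h => ?_, fun h => ?_⟩
  · have hs : Gen {b, r} (-rf b (rf r b)) := (g1.step (g2.step g1)).neg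
    have e : -rf b (rf r b) = (t - 1) • b + (1 - t) • r := by
      rw [hrb _ h, map_sub, map_smul, rf_self, hbr _ h]
      match_scalars <;> grind
    refine ⟨_, hs, ?_, ?_⟩
    · rw [e]
      match_scalars <;> grind
    · have := (e2 (-rf b (rf r b))).step (e1 _)
      rw [(key _ hs _ _ _ e h).2] at this
      convert this using 1
      rw [e]
      match_scalars <;> grind
  · have hs : Gen {b, r} (-rf b r) := (g1.step g2).neg
    have e : -rf b r = (t - 1) • b + (-1 : ℝ) • r := by
      rw [hbr _ h]
      match_scalars <;> grind
    refine ⟨_, hs, ?_, ?_⟩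
    · rw [e]
      match_scalars <;> grind
    · have := (e2 (-rf b r)).step ((e1 _).step (e2 (-rf b r)))
      rw [(key _ hs _ _ _ e h).1, map_sub, map_smul, rf_self, (key _ hs _ _ _ e h).2] at this
      convert this using 1
      rw [e]
      match_scalars <;> grind
  · have hs : Gen {b, r} (-rf b r) := (g1.step g2).neg
    have e : -rf b r = t • b + (-1 : ℝ) • r := by
      rw [hbr _ h]
      match_scalars <;> grind
    refine ⟨_, hs, ?_, ?_⟩
    · rw [e]
      match_scalars <;> grind
    · have := ((e2 (-rf b r)).step ((e1 _).step (e2 (-rf b r)))).neg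
      rw [(key _ hs _ _ _ e h).1, map_sub, map_smul, rf_self, (key _ hs _ _ _ e h).2] at this
      convert this using 1
      rw [e]
      match_scalars <;> grind
  · have hs : Gen {b, r} (rf b (rf r b)) := g1.step (g2.step g1)
    have e : rf b (rf r b) = t • b + (-t) • r := by
      rw [hrb _ h, map_sub, map_smul, rf_self, hbr _ h]
      match_scalars <;> grind
    refine ⟨_, hs, ?_, ?_⟩
    · rw [e]
      match_scalars <;> grind
    · have := (e2 (rf b (rf r b))).step (e1 _)
      rw [(key _ hs _ _ _ e h).2] at this
      convert this using 1
      rw [e]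
      match_scalars <;> grind

theorem IsRS.exists_sub_dbl {Θ : Set V} (hΘ : IsRS Θ) (hg : ∀ a ∈ Θ, ∀ b ∈ Θ, GoldVal ⟪a, b⟫)
    {b r u v : V} (hb : b ∈ Θ) (hr : r ∈ Θ) (hu : Dbl b u) (hv : Dbl r v) {m n : ℤ}
    (hm : 1 ≤ m) (h : (⟪u, v⟫ : ℝ) = m + n * φ) :
    b = r ∨ ∃ s ∈ Θ, Dbl s (u - v) ∧ Gen {r, s} b := by
  have hbb := hΘ.norm b hb
  have hrr := hΘ.norm r hr
  have hx := hg b hb r hr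
  have hrb : rf r b = b - (⟪b, r⟫ : ℝ) • r := by rw [rf_apply hrr, real_inner_comm]
  have sub : ∀ s, Gen {b, r} s → s ∈ Θ := fun s hs => hΘ.gen_sub (by
    rintro _ (rfl | rfl) <;> assumption) hs
  have via : Gen {r, rf r b} b := by
    have := Gen.step (X := {r, rf r b}) (a := r) (b := rf r b) (.base (by simp)) (.base (by simp))
    rwa [rf_rf] at this
  obtain ⟨A, B, C, D⟩ := exists_sub_dbl_aux Real.goldenRatio_sq hbb hrr
  rcases hu with rfl | rfl <;> rcases hv with rfl | rfl
  · rcases hx.cases_of_pos h hm with h' | h' | h'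
    · exact .inr ⟨_, hΘ.refl _ hr _ hb, .inl (by rw [hrb, h', one_smul]), via⟩
    · exact .inl (eq_of_inner_eq_two hbb hrr h')
    · obtain ⟨s, h1, h2, h3⟩ := A h'
      exact .inr ⟨s, sub s h1, .inr h2, h3⟩
  · rw [inner_smul_right] at h
    rcases hx.cases_of_pos_mul h hm with h' | h'
    · exact .inr ⟨_, hΘ.refl _ hr _ hb, .inl (by rw [hrb, h']), via⟩
    · obtain ⟨s, h1, h2, h3⟩ := B h'
      exact .inr ⟨s, sub s h1, .inr h2, h3⟩
  · rw [inner_smul_left, conj_trivial] at h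
    rcases hx.cases_of_pos_mul h hm with h' | h'
    · obtain ⟨s, h1, h2, h3⟩ := C h'
      exact .inr ⟨s, sub s h1, .inl h2, h3⟩
    · refine .inr ⟨_, hΘ.refl _ hr _ hb, .inr ?_, via⟩
      rw [hrb, h', smul_sub, smul_smul, show φ * (φ - 1) = 1 by
        linear_combination Real.goldenRatio_sq, one_smul]
  · rw [inner_smul_left, inner_smul_right, conj_trivial] at h
    rcases hx.cases_of_pos_mul_mul h hm with h' | h' | h'
    · exact .inr ⟨_, hΘ.refl _ hr _ hb, .inr (by rw [hrb, h', one_smul, smul_sub]), via⟩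
    · obtain ⟨s, h1, h2, h3⟩ := D h'
      exact .inr ⟨s, sub s h1, .inl h2, h3⟩
    · exact .inl (eq_of_inner_eq_two hbb hrr h')

theorem IsRS.gen_of_sum {Θ : Set V} (hΘ : IsRS Θ) (hg : ∀ a ∈ Θ, ∀ b ∈ Θ, GoldVal ⟪a, b⟫)
    {X : Set V} (hX : X ⊆ Θ) (n : ℕ) : ∀ M : List V, M.length = n →
      (∀ m ∈ M, ∃ r, Gen X r ∧ Dbl r m) → ∀ b ∈ Θ, Dbl b M.sum → Gen X b := by
  induction n with
  | zero =>
    intro M hM _ b hb hd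
    rw [List.length_eq_zero_iff.1 hM, List.sum_nil] at hd
    rcases hd with h | h
    · exact (hΘ.ne_zero hb h.symm).elim
    · rcases smul_eq_zero.1 h.symm with h | h
      · exact (Real.goldenRatio_ne_zero h).elim
      · exact (hΘ.ne_zero hb h).elim
  | succ n ih =>
    intro M hM hMg b hb hd
    have hbb := hΘ.norm b hb
    have hmem : ∀ m ∈ M, (⟪M.sum, m⟫ : ℝ) ∈ goldenInts := by
      intro m hm
      obtain ⟨r, hr, hrm⟩ := hMg m hm
      have h0 := (hg b hb r (hΘ.gen_sub hX hr)).mem_goldenInts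
      have hφ : φ ∈ goldenInts := ⟨0, 1, by simp⟩
      rcases hd with hd | hd <;> rcases hrm with rfl | rfl <;>
        simp only [hd, inner_smul_left, inner_smul_right, conj_trivial]
      · exact h0
      · exact mul_mem hφ h0
      · exact mul_mem hφ h0
      · exact mul_mem hφ (mul_mem hφ h0)
    obtain ⟨p, q, hp, hs⟩ : ∃ p q : ℤ, 1 ≤ p ∧ (⟪M.sum, M.sum⟫ : ℝ) = p + q * φ := by
      rcases hd with hd | hd <;> rw [hd]
      · exact ⟨2, 0, by norm_num, by rw [hbb]; simp⟩
      · refine ⟨2, 2, by norm_num, ?_⟩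
        rw [inner_smul_left, inner_smul_right, conj_trivial, hbb]
        push_cast
        linear_combination 2 * Real.goldenRatio_sq
    obtain ⟨m, hm, k, l, hk, hkl⟩ := exists_pos_of_inner_sum hmem hp hs
    obtain ⟨r, hr, hrm⟩ := hMg m hm
    rcases hΘ.exists_sub_dbl hg hb (hΘ.gen_sub hX hr) hd hrm hk hkl with rfl | ⟨s, hsΘ, hds, hgen⟩
    · exact hr
    · obtain ⟨A, B, rfl⟩ := List.append_of_mem hm
      have hs' : Gen X s := by
        refine ih (A ++ B) (by simp at hM ⊢; omega)
          (fun m hm => hMg m (by simp at hm ⊢; tauto)) s hsΘ ?_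
        convert hds using 1
        simp only [List.sum_append, List.sum_cons]
        abel
      refine hgen.trans ?_
      rintro _ (rfl | rfl) <;> assumption

/-- A root which is a golden-integral combination of roots in `X` lies in the root system
generated by `X`. -/
theorem IsRS.gen_of_mem_span {Θ : Set V} (hΘ : IsRS Θ) (hg : ∀ a ∈ Θ, ∀ b ∈ Θ, GoldVal ⟪a, b⟫)
    {X : Set V} (hX : X ⊆ Θ) {b : V} (hb : b ∈ Θ) (h : b ∈ Submodule.span goldenInts X) :
    Gen X b := by
  let Y : Set V := {v | ∃ r, Gen X r ∧ Dbl r v}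
  have hneg : ∀ v ∈ AddSubmonoid.closure Y, -v ∈ AddSubmonoid.closure Y := by
    intro v hv
    induction hv using AddSubmonoid.closure_induction with
    | mem v hv =>
      obtain ⟨r, hr, h⟩ := hv
      refine AddSubmonoid.subset_closure ⟨-r, hr.neg, ?_⟩
      rcases h with rfl | rfl
      · exact .inl rfl
      · exact .inr (smul_neg _ _).symm
    | zero => simp
    | add x y _ _ hx hy =>
      rw [neg_add]
      exact add_mem hx hy
  have hφ : ∀ v ∈ AddSubmonoid.closure Y, φ • v ∈ AddSubmonoid.closure Y := by
    intro v hv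
    induction hv using AddSubmonoid.closure_induction with
    | mem v hv =>
      obtain ⟨r, hr, h⟩ := hv
      have h2 : φ • r ∈ AddSubmonoid.closure Y := AddSubmonoid.subset_closure ⟨r, hr, .inr rfl⟩
      rcases h with rfl | rfl
      · exact h2
      · rw [smul_smul, ← pow_two, Real.goldenRatio_sq, add_smul, one_smul]
        exact add_mem h2 (AddSubmonoid.subset_closure ⟨r, hr, .inl rfl⟩)
    | zero => simp
    | add x y _ _ hx hy =>
      rw [smul_add]
      exact add_mem hx hy
  have hinn : ∀ (m : ℤ), ∀ v ∈ AddSubmonoid.closure Y, (m : ℝ) • v ∈ AddSubmonoid.closure Y := by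
    intro m v hv
    rw [Int.cast_smul_eq_zsmul]
    obtain ⟨k, rfl | rfl⟩ := m.eq_nat_or_neg
    · rw [natCast_zsmul]
      exact nsmul_mem hv k
    · rw [neg_smul, natCast_zsmul]
      exact hneg _ (nsmul_mem hv k)
  have hbY : b ∈ AddSubmonoid.closure Y := by
    clear hb
    induction h using Submodule.span_induction with
    | mem v hv => exact AddSubmonoid.subset_closure ⟨v, .base hv, .inl rfl⟩
    | zero => exact zero_mem _
    | add x y _ _ hx hy => exact add_mem hx hy
    | smul c x _ hx =>
      obtain ⟨_, m, n, rfl⟩ := c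
      change ((m + n * φ : ℝ)) • x ∈ _
      rw [add_smul, mul_smul]
      exact add_mem (hinn m x hx) (hinn n _ (hφ x hx))
  obtain ⟨M, hM, hs⟩ := AddSubmonoid.exists_list_of_mem_closure hbY
  exact hΘ.gen_of_sum hg hX _ M rfl hM b hb (.inl hs)

end Lattice
end HurwitzRS

namespace HurwitzRS
open scoped RealInnerProductSpace goldenRatio

section Unimodular

theorem setOf_mem_cons {α : Type*} (a : α) (τ : List α) : {x | x ∈ a :: τ} = insert a {x | x ∈ τ} := by
  ext x; simp

variable {V : Type*} [NormedAddCommGroup V] [InnerProductSpace ℝ V]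

theorem HV.front_conj (A : List V) (a : V) (B : List V) :
    HV (A ++ a :: B) (a :: (A.map (rf a) ++ B)) := by
  induction A with
  | nil => exact .refl _
  | cons c A ih =>
    refine (HV.cons c ih).trans ?_
    have := HV.swap a (rf a c) (A.map (rf a) ++ B)
    rw [rf_rf] at this
    exact this.symm

theorem preimage_orth_of_append {A τ : List V} {a x : V} (hi : Ind (A ++ a :: τ))
    (ha : (⟪a, a⟫ : ℝ) = 2) (hx : x - pr (A ++ a :: τ) x = a) : ∀ b ∈ τ, (⟪b, x⟫ : ℝ) = 0 := by
  have h := HV.front_conj A a τ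
  rw [← h.pr] at hx
  exact fun b hb => preimage_orth (h.ind hi) ha hx b (by simp [hb])

theorem inner_preimage_mem [FiniteDimensional ℝ V] {R : Subring ℝ} {L : List V} (hi : Ind L)
    (hn : ∀ a ∈ L, (⟪a, a⟫ : ℝ) = 2) (hR : ∀ a ∈ L, ∀ b ∈ L, (⟪a, b⟫ : ℝ) ∈ R) {a b x : V}
    (ha : a ∈ L) (hb : b ∈ L) (hx : x - pr L x = a) : (⟪x, b⟫ : ℝ) ∈ R := by
  obtain ⟨A, τ, rfl⟩ := List.append_of_mem ha
  rcases List.mem_append.1 hb with hbA | hb'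
  · obtain ⟨y, hy⟩ := exists_preimage hi (mem_sp hb)
    obtain ⟨A, A', rfl⟩ := List.append_of_mem hbA
    have := inner_preimage_add hx hy
    have h0 : (⟪y, a⟫ : ℝ) = 0 := by
      rw [real_inner_comm]
      simp only [List.append_assoc, List.cons_append] at hi hy
      exact preimage_orth_of_append hi (hn b hb) hy a (by simp)
    rw [h0, add_zero] at this
    exact this ▸ hR a ha b hb
  · rcases List.mem_cons.1 hb' with rfl | hb'
    · rw [real_inner_comm, inner_preimage hx (hn b hb)]
      exact one_mem R
    · rw [real_inner_comm, preimage_orth_of_append hi (hn a ha) hx b hb']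
      exact zero_mem R

theorem mem_span_of_preimage [FiniteDimensional ℝ V] {R : Subring ℝ} {L : List V} (hi : Ind L)
    (hn : ∀ a ∈ L, (⟪a, a⟫ : ℝ) = 2) (hR : ∀ a ∈ L, ∀ b ∈ L, (⟪a, b⟫ : ℝ) ∈ R) (τ : List V) :
    ∀ A, A ++ τ = L → ∀ v ∈ sp τ, (∀ a ∈ L, ∃ x, x - pr L x = a ∧ (⟪x, v⟫ : ℝ) ∈ R) →
      v ∈ Submodule.span R {x | x ∈ τ} := by
  induction τ with
  | nil =>
    intro A _ v hv _
    simp [sp] at hv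
    simp [hv]
  | cons a τ ih =>
    intro A hA v hv h
    have haL : a ∈ L := by simp [← hA]
    have hv' := hv
    rw [sp, setOf_mem_cons, Submodule.mem_span_insert] at hv'
    obtain ⟨c, z, hz, rfl⟩ := hv'
    have hc : c ∈ R := by
      obtain ⟨x, hx, hxR⟩ := h a haL
      have h0 : (⟪z, x⟫ : ℝ) = 0 := by
        refine span_orth (B := {x}) (fun b hb y hy => ?_) hz (Submodule.mem_span_singleton_self x)
        rw [Set.mem_singleton_iff.1 hy]
        subst hA
        exact preimage_orth_of_append hi (hn a haL) hx b hb
      rwa [inner_add_right, inner_smul_right, real_inner_comm, inner_preimage hx (hn a haL),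
        real_inner_comm, h0, mul_one, add_zero] at hxR
    rw [setOf_mem_cons]
    refine Submodule.mem_span_insert.2 ⟨⟨c, hc⟩, z, ih (A ++ [a]) (by simp [hA]) z hz ?_, rfl⟩
    intro b hb
    obtain ⟨x, hx, hxR⟩ := h b hb
    refine ⟨x, hx, ?_⟩
    have := sub_mem hxR (mul_mem hc (inner_preimage_mem hi hn hR hb haL hx))
    rwa [inner_add_right, inner_smul_right, add_sub_cancel_left] at this

/-- The lattices spanned by two factorizations of the same isometry agree as soon as one contains
the other. -/
theorem mem_span_of_pr_eq [FiniteDimensional ℝ V] {R : Subring ℝ} {L L' : List V} (hi : Ind L)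
    (hn : ∀ a ∈ L, (⟪a, a⟫ : ℝ) = 2) (hR : ∀ a ∈ L, ∀ b ∈ L, (⟪a, b⟫ : ℝ) ∈ R)
    (hn' : ∀ a ∈ L', (⟪a, a⟫ : ℝ) = 2) (hpr : pr L' = pr L) (hlen : L'.length = L.length)
    (hs : ∀ a ∈ L', a ∈ Submodule.span R {x | x ∈ L}) :
    ∀ a ∈ L, a ∈ Submodule.span R {x | x ∈ L'} := by
  obtain ⟨hsp, hi', -⟩ := ind_of_pr_eq hi hpr.symm hlen.le
  have hR' : ∀ a ∈ L', ∀ b ∈ L', (⟪a, b⟫ : ℝ) ∈ R := fun a ha b hb =>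
    inner_mem_of_mem_span hR (hs a ha) (hs b hb)
  intro v hv
  refine mem_span_of_preimage hi' hn' hR' L' [] rfl v (hsp ▸ mem_sp hv) fun a ha => ?_
  rw [hpr]
  have := hs a ha
  suffices ∃ x, x - pr L x = a ∧ ∀ v ∈ L, (⟪x, v⟫ : ℝ) ∈ R from
    this.imp fun x hx => ⟨hx.1, hx.2 v hv⟩
  clear ha
  induction this using Submodule.span_induction with
  | mem u hu =>
    obtain ⟨x, hx⟩ := exists_preimage hi (mem_sp hu)
    exact ⟨x, hx, fun v hv => inner_preimage_mem hi hn hR hu hv hx⟩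
  | zero => exact ⟨0, by simp, by simp [zero_mem]⟩
  | add u u' _ _ h h' =>
    obtain ⟨x, hx, hx'⟩ := h
    obtain ⟨y, hy, hy'⟩ := h'
    refine ⟨x + y, by rw [map_add, ← hx, ← hy]; abel, fun v hv => ?_⟩
    rw [inner_add_left]
    exact add_mem (hx' v hv) (hy' v hv)
  | smul c u _ h =>
    obtain ⟨x, hx, hx'⟩ := h
    refine ⟨(c : ℝ) • x, by rw [map_smul, ← smul_sub, hx]; rfl, fun v hv => ?_⟩
    rw [inner_smul_left]
    exact mul_mem c.2 (hx' v hv)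

/-- All inner products of roots in the span of `L` are of golden type. -/
def Gold (Φ : Set V) (L : List V) : Prop :=
  ∀ u ∈ Φ, u ∈ sp L → ∀ v ∈ Φ, v ∈ sp L → GoldVal ⟪u, v⟫

theorem Full.mem_span_goldenInts {Φ : Set V} (hΦ : IsRS Φ) {L : List V} (hL : ∀ a ∈ L, a ∈ Φ)
    (hF : Full Φ L) (hg : Gold Φ L) {b : V} (hb : b ∈ Φ) (hbL : b ∈ sp L) :
    b ∈ Submodule.span goldenInts {x | x ∈ L} :=
  (hF b hb hbL).mem_span_subring (fun a ha => hΦ.norm a (hL a ha)) fun a ha b hb =>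
    (hg a (hL a ha) (mem_sp ha) b (hL b hb) (mem_sp hb)).mem_goldenInts

theorem Gold.full_of_span {Φ : Set V} (hΦ : IsRS Φ) {L L' : List V}
    (hL' : ∀ a ∈ L', a ∈ Φ) (hg : Gold Φ L) (hsp : sp L' ≤ sp L)
    (h : ∀ b ∈ Φ, b ∈ sp L' → b ∈ Submodule.span goldenInts {x | x ∈ L'}) : Full Φ L' :=
  fun b hb hbL' => (hΦ.inter (sp L)).gen_of_mem_span (fun u hu v hv => hg u hu.1 hu.2 v hv.1 hv.2)
    (fun a ha => ⟨hL' a ha, hsp (mem_sp ha)⟩) ⟨hb, hsp hbL'⟩ (h b hb hbL')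

theorem Gold.full_of_pr_eq [FiniteDimensional ℝ V] {Φ : Set V} (hΦ : IsRS Φ) {L L' : List V} (hL : ∀ a ∈ L, a ∈ Φ)
    (hi : Ind L) (hF : Full Φ L) (hg : Gold Φ L) (hL' : ∀ a ∈ L', a ∈ Φ) (hpr : pr L' = pr L)
    (hlen : L'.length = L.length) : Full Φ L' := by
  have hsp := (ind_of_pr_eq hi hpr.symm hlen.le).1
  refine hg.full_of_span hΦ hL' hsp.le fun b hb hbL' => ?_
  have h1 := hF.mem_span_goldenInts hΦ hL hg hb (hsp ▸ hbL')
  refine Submodule.span_le.2 (fun a ha => ?_) h1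
  exact mem_span_of_pr_eq hi (fun a ha => hΦ.norm a (hL a ha)) (fun a ha b hb =>
    (hg a (hL a ha) (mem_sp ha) b (hL b hb) (mem_sp hb)).mem_goldenInts)
    (fun a ha => hΦ.norm a (hL' a ha)) hpr hlen (fun a ha =>
      hF.mem_span_goldenInts hΦ hL hg (hL' a ha) (hsp ▸ mem_sp ha)) a ha

theorem Gold.full_tail {Φ : Set V} (hΦ : IsRS Φ) {a : V} {τ : List V} (hL : ∀ b ∈ a :: τ, b ∈ Φ)
    (hi : Ind (a :: τ)) (hF : Full Φ (a :: τ)) (hg : Gold Φ (a :: τ)) : Full Φ τ := by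
  have hle : sp τ ≤ sp (a :: τ) := sp_mono fun b hb => List.mem_cons_of_mem a hb
  refine hg.full_of_span hΦ (fun b hb => hL b (List.mem_cons_of_mem a hb)) hle fun b hb hbτ => ?_
  have h := hF.mem_span_goldenInts hΦ hL hg hb (hle hbτ)
  rw [setOf_mem_cons] at h
  obtain ⟨c, z, hz, rfl⟩ := Submodule.mem_span_insert.1 h
  have hzs : z ∈ sp τ := Submodule.span_le_restrictScalars goldenInts ℝ _ hz
  have hca : (c : ℝ) • a ∈ sp τ := by
    have := sub_mem hbτ hzs
    rwa [add_sub_cancel_right] at this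
  rcases eq_or_ne (c : ℝ) 0 with h0 | h0
  · have : c = 0 := Subtype.ext h0
    simpa [this] using hz
  · exact (hi.1 ((Submodule.smul_mem_iff _ h0).1 hca)).elim

end Unimodular
end HurwitzRS

namespace HurwitzRS
open scoped RealInnerProductSpace goldenRatio

section Levels
variable {V : Type*} [NormedAddCommGroup V] [InnerProductSpace ℝ V]

/-- The integers as a subring of the reals. -/
noncomputable def ints : Subring ℝ := (Int.castRingHom ℝ).range

theorem goldenRatio_bounds : 1.618 < φ ∧ φ < 1.6181 := by
  have h := Real.goldenRatio_sq
  have h0 := Real.one_lt_goldenRatio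
  constructor <;> nlinarith

theorem IsSimple.gold_edge {Ψ : Set V} {Δ : Finset V} (hΨ : IsRS Ψ) (h : IsSimple Ψ Δ)
    (hg : ∀ a ∈ Ψ, ∀ b ∈ Ψ, GoldVal ⟪a, b⟫) {a b : V} (ha : a ∈ Δ) (hb : b ∈ Δ) (hab : a ≠ b) :
    (⟪a, b⟫ : ℝ) = 0 ∨ (⟪a, b⟫ : ℝ) = -1 ∨ (⟪a, b⟫ : ℝ) = -φ := by
  have hs2 : (1.4 : ℝ) < √2 ∧ √2 < 1.5 :=
    ⟨Real.lt_sqrt_of_sq_lt (by norm_num), (Real.sqrt_lt' (by norm_num)).2 (by norm_num)⟩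
  have hs3 : (1.7 : ℝ) < √3 := Real.lt_sqrt_of_sq_lt (by norm_num)
  obtain ⟨h1, h2⟩ := goldenRatio_bounds
  have hlt := abs_inner_lt_two (hΨ.norm a (h.sub a ha)) (hΨ.norm b (h.sub b hb)) hab.symm
    (by
      rintro rfl
      obtain ⟨f, hf⟩ := h.ex
      have := hf _ hb
      rw [inner_neg_left] at this
      linarith [hf _ ha])
  rw [abs_lt] at hlt
  rcases h.edge_values hΨ ha hb hab with e | e | e | e | e
  · exact .inl e
  · exact .inr (.inl e)
  · exfalso
    rcases hg a (h.sub a ha) b (h.sub b hb) with e' | e' | e' | e' | e' | e' | e' | e' | e' <;>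
      rw [e] at e' <;> linarith
  · exact .inr (.inr e)
  · exfalso
    rcases hg a (h.sub a ha) b (h.sub b hb) with e' | e' | e' | e' | e' | e' | e' | e' | e' <;>
      linarith

theorem IsSimple.exists_golden_edge {Ψ : Set V} {Δ : Finset V} (hΨ : IsRS Ψ) (h : IsSimple Ψ Δ)
    (hg : ∀ a ∈ Ψ, ∀ b ∈ Ψ, GoldVal ⟪a, b⟫) (hz : ∃ a ∈ Ψ, ∃ b ∈ Ψ, (⟪a, b⟫ : ℝ) ∉ ints) :
    ∃ a ∈ Δ, ∃ b ∈ Δ, a ≠ b ∧ (⟪a, b⟫ : ℝ) = -φ := by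
  by_contra! hc
  obtain ⟨a, ha, b, hb, hab⟩ := hz
  refine hab (Gen.inner_mem_subring (X := ↑Δ) (fun d hd => hΨ.norm d (h.sub d hd))
    (fun d hd e he => ?_) (h.gen hΨ ha) (h.gen hΨ hb))
  by_cases hde : d = e
  · subst hde
    exact ⟨2, by rw [hΨ.norm d (h.sub d hd)]; norm_num⟩
  · rcases h.gold_edge hΨ hg hd he hde with e' | e' | e'
    · exact ⟨0, by rw [e']; simp⟩
    · exact ⟨-1, by rw [e']; simp⟩
    · exact (hc d hd e he hde e').elim

theorem IsSimple.level {Ψ : Set V} {Δ : Finset V} {d : V} (hΨ : IsRS Ψ) (hd : d ∉ Δ)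
    [DecidableEq V] (h : IsSimple Ψ (insert d Δ)) (hg : ∀ a ∈ Ψ, ∀ b ∈ Ψ, GoldVal ⟪a, b⟫) {y : V}
    (hy : ∀ e ∈ Δ, (⟪y, e⟫ : ℝ) = 0) {b : V} (hb : b ∈ Ψ) (hpos : 0 < (⟪y, b⟫ : ℝ))
    (hyd : 0 < (⟪y, d⟫ : ℝ)) : (⟪y, d⟫ : ℝ) ≤ ⟪y, b⟫ := by
  obtain ⟨c, hc, hb'⟩ := (h.gen hΨ hb).coef_of_edges (fun e he => hΨ.norm e (h.sub e he))
    fun e he e' he' hne => (h.gold_edge hΨ hg he he' hne).imp_right (Or.imp_right .inr)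
  have hsum : (⟪y, ∑ e ∈ insert d Δ, c e • e⟫ : ℝ) = c d * ⟪y, d⟫ := by
    rw [Finset.sum_insert hd, inner_add_right, inner_smul_right, inner_sum,
      Finset.sum_eq_zero, add_zero]
    intro e he
    rw [inner_smul_right, hy e he, mul_zero]
  rcases hb' with hb' | hb'
  · rw [hb', hsum] at hpos ⊢
    rcases hc d (Finset.mem_insert_self _ _) with h0 | h0
    · rw [h0, zero_mul] at hpos
      exact (lt_irrefl _ hpos).elim
    · nlinarith
  · rw [← hb', inner_neg_right] at hsum
    rcases hc d (Finset.mem_insert_self _ _) with h0 | h0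
    · rw [h0, zero_mul] at hsum
      linarith
    · nlinarith

/-- The possible nonpositive inner products of two distinct simple roots. -/
def EdgeVal (x : ℝ) : Prop := x = 0 ∨ x = -1 ∨ x = -φ

theorem pair_normal_aux {t : ℝ} (ht : t ^ 2 = t + 1) (a b d : V) (ha : (⟪a, a⟫ : ℝ) = 2)
    (hb : (⟪b, b⟫ : ℝ) = 2) (hd : (⟪d, d⟫ : ℝ) = 2) (hab : (⟪a, b⟫ : ℝ) = -t) (ht3 : 3 - t ≠ 0)
    (hli : ∀ x y : ℝ, d ≠ x • a + y • b) :
    ∃ y : V, (⟪y, a⟫ : ℝ) = 0 ∧ (⟪y, b⟫ : ℝ) = 0 ∧ 0 < (⟪y, y⟫ : ℝ) ∧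
      (⟪y, d⟫ : ℝ) = 2 * (3 - t) - (2 * ⟪d, a⟫ ^ 2 + 2 * ⟪d, b⟫ ^ 2 + 2 * t * ⟪d, a⟫ * ⟪d, b⟫) ∧
      (⟪y, y⟫ : ℝ) = (3 - t) * ⟪y, d⟫ := by
  set p : ℝ := ⟪d, a⟫ with hp
  set q : ℝ := ⟪d, b⟫ with hq
  have hba : (⟪b, a⟫ : ℝ) = -t := by rw [real_inner_comm, hab]
  have hp' : (⟪a, d⟫ : ℝ) = p := real_inner_comm _ _
  have hq' : (⟪b, d⟫ : ℝ) = q := real_inner_comm _ _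
  set y : V := (3 - t) • d - (2 * p + t * q) • a - (t * p + 2 * q) • b with hy
  have hya : (⟪y, a⟫ : ℝ) = 0 := by
    simp only [hy, inner_sub_left, real_inner_smul_left, ha, hba, ← hp]
    linear_combination p * ht
  have hyb : (⟪y, b⟫ : ℝ) = 0 := by
    simp only [hy, inner_sub_left, real_inner_smul_left, hb, hab, ← hq]
    linear_combination q * ht
  have hyd : (⟪y, d⟫ : ℝ) = 2 * (3 - t) - (2 * p ^ 2 + 2 * q ^ 2 + 2 * t * p * q) := by
    simp only [hy, inner_sub_left, real_inner_smul_left, hd, hp', hq']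
    ring
  refine ⟨y, hya, hyb, real_inner_self_pos.2 fun h0 => ?_, hyd, ?_⟩
  · refine hli ((3 - t)⁻¹ * (2 * p + t * q)) ((3 - t)⁻¹ * (t * p + 2 * q)) ?_
    rw [hy, sub_sub, sub_eq_zero] at h0
    rw [mul_smul, mul_smul, ← smul_add, ← h0, inv_smul_smul₀ ht3]
  · conv_lhs => rw [show (⟪y, y⟫ : ℝ) = ⟪y, (3 - t) • d - (2 * p + t * q) • a - (t * p + 2 * q) • b⟫
      from rfl]
    rw [inner_sub_right, inner_sub_right, real_inner_smul_right, real_inner_smul_right,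
      real_inner_smul_right, hya, hyb]
    ring

theorem golden_pair_normal {a b d : V} (ha : (⟪a, a⟫ : ℝ) = 2) (hb : (⟪b, b⟫ : ℝ) = 2)
    (hd : (⟪d, d⟫ : ℝ) = 2) (hab : (⟪a, b⟫ : ℝ) = -φ) (hda : EdgeVal ⟪d, a⟫)
    (hdb : EdgeVal ⟪d, b⟫) (hli : ∀ s t : ℝ, d ≠ s • a + t • b) :
    ((⟪d, a⟫ : ℝ) = 0 ∨ (⟪d, b⟫ : ℝ) = 0) ∧ (⟪d, a⟫ : ℝ) ≠ -φ ∧ (⟪d, b⟫ : ℝ) ≠ -φ ∧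
    ∃ (y : V) (k : ℝ), (⟪y, a⟫ : ℝ) = 0 ∧ (⟪y, b⟫ : ℝ) = 0 ∧ 0 < (⟪y, d⟫ : ℝ) ∧
      (⟪y, y⟫ : ℝ) = k * ⟪y, d⟫ ∧ 2 * k < (2 * φ) ^ 2 * ⟪y, d⟫ := by
  obtain ⟨h1, h2⟩ := goldenRatio_bounds
  have hsq := Real.goldenRatio_sq
  obtain ⟨y, hya, hyb, hyy, hyd, hk⟩ :=
    pair_normal_aux hsq a b d ha hb hd hab (by linarith) hli
  have hpos : 0 < (⟪y, d⟫ : ℝ) := by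
    rw [hk] at hyy
    exact pos_of_mul_pos_right hyy (by linarith)
  unfold EdgeVal at hda hdb
  generalize (⟪d, a⟫ : ℝ) = p at *
  generalize (⟪d, b⟫ : ℝ) = q at *
  generalize φ = t at *
  have key : (p = 0 ∧ q = 0) ∨ (p = -1 ∧ q = 0) ∨ (p = 0 ∧ q = -1) := by
    rcases hda with rfl | rfl | rfl <;> rcases hdb with rfl | rfl | rfl <;>
      first
        | exact .inl ⟨rfl, rfl⟩
        | exact .inr (.inl ⟨rfl, rfl⟩)
        | exact .inr (.inr ⟨rfl, rfl⟩)
        | (exfalso; nlinarith)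
  refine ⟨?_, ?_, ?_, y, 3 - t, hya, hyb, hpos, hk, ?_⟩
  · rcases key with h | h | h
    exacts [.inl h.1, .inr h.2, .inl h.1]
  · rcases key with h | h | h <;> rw [h.1] <;> intro h <;> linarith
  · rcases key with h | h | h <;> rw [h.2] <;> intro h <;> linarith
  · rw [hyd]
    rcases key with h | h | h <;> rw [h.1, h.2] <;> nlinarith

theorem triple_normal_aux {t : ℝ} (ht : t ^ 2 = t + 1) (a b c d : V) (ha : (⟪a, a⟫ : ℝ) = 2)
    (hb : (⟪b, b⟫ : ℝ) = 2) (hc : (⟪c, c⟫ : ℝ) = 2) (hd : (⟪d, d⟫ : ℝ) = 2)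
    (hab : (⟪a, b⟫ : ℝ) = -t) (hbc : (⟪b, c⟫ : ℝ) = -1) (hac : (⟪a, c⟫ : ℝ) = 0)
    (ht2 : 4 - 2 * t ≠ 0) (hli : ∀ x y z : ℝ, d ≠ x • a + y • b + z • c) :
    ∃ y : V, (⟪y, a⟫ : ℝ) = 0 ∧ (⟪y, b⟫ : ℝ) = 0 ∧ (⟪y, c⟫ : ℝ) = 0 ∧ 0 < (⟪y, y⟫ : ℝ) ∧
      (⟪y, d⟫ : ℝ) = 2 * (4 - 2 * t) - (3 * ⟪d, a⟫ ^ 2 + 4 * ⟪d, b⟫ ^ 2 + (3 - t) * ⟪d, c⟫ ^ 2 +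
        4 * t * ⟪d, a⟫ * ⟪d, b⟫ + 2 * t * ⟪d, a⟫ * ⟪d, c⟫ + 4 * ⟪d, b⟫ * ⟪d, c⟫) ∧
      (⟪y, y⟫ : ℝ) = (4 - 2 * t) * ⟪y, d⟫ := by
  set p : ℝ := ⟪d, a⟫ with hp
  set q : ℝ := ⟪d, b⟫ with hq
  set r : ℝ := ⟪d, c⟫ with hr
  have hba : (⟪b, a⟫ : ℝ) = -t := by rw [real_inner_comm, hab]
  have hcb : (⟪c, b⟫ : ℝ) = -1 := by rw [real_inner_comm, hbc]
  have hca : (⟪c, a⟫ : ℝ) = 0 := by rw [real_inner_comm, hac]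
  have hp' : (⟪a, d⟫ : ℝ) = p := real_inner_comm _ _
  have hq' : (⟪b, d⟫ : ℝ) = q := real_inner_comm _ _
  have hr' : (⟪c, d⟫ : ℝ) = r := real_inner_comm _ _
  set A : ℝ := 3 * p + 2 * t * q + t * r with hA
  set B : ℝ := 2 * t * p + 4 * q + 2 * r with hB
  set C : ℝ := t * p + 2 * q + (3 - t) * r with hC
  set y : V := (4 - 2 * t) • d - A • a - B • b - C • c with hy
  have hya : (⟪y, a⟫ : ℝ) = 0 := by
    simp only [hy, inner_sub_left, real_inner_smul_left, ha, hba, hca, ← hp, hA, hB, hC]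
    linear_combination 2 * p * ht
  have hyb : (⟪y, b⟫ : ℝ) = 0 := by
    simp only [hy, inner_sub_left, real_inner_smul_left, hb, hab, hcb, ← hq, hA, hB, hC]
    linear_combination (2 * q + r) * ht
  have hyc : (⟪y, c⟫ : ℝ) = 0 := by
    simp only [hy, inner_sub_left, real_inner_smul_left, hc, hac, hbc, ← hr, hA, hB, hC]
    ring
  have hyd : (⟪y, d⟫ : ℝ) = 2 * (4 - 2 * t) - (3 * p ^ 2 + 4 * q ^ 2 + (3 - t) * r ^ 2 +
      4 * t * p * q + 2 * t * p * r + 4 * q * r) := by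
    simp only [hy, inner_sub_left, real_inner_smul_left, hd, hp', hq', hr', hA, hB, hC]
    ring
  refine ⟨y, hya, hyb, hyc, real_inner_self_pos.2 fun h0 => ?_, hyd, ?_⟩
  · refine hli ((4 - 2 * t)⁻¹ * A) ((4 - 2 * t)⁻¹ * B) ((4 - 2 * t)⁻¹ * C) ?_
    rw [hy, sub_sub, sub_sub, sub_eq_zero] at h0
    rw [mul_smul, mul_smul, mul_smul, ← smul_add, ← smul_add, add_assoc, ← h0,
      inv_smul_smul₀ ht2]
  · conv_lhs => rw [show (⟪y, y⟫ : ℝ) = ⟪y, (4 - 2 * t) • d - A • a - B • b - C • c⟫ from rfl]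
    rw [inner_sub_right, inner_sub_right, inner_sub_right, real_inner_smul_right,
      real_inner_smul_right, real_inner_smul_right, real_inner_smul_right, hya, hyb, hyc]
    ring

theorem golden_triple_normal {a b c d : V} (ha : (⟪a, a⟫ : ℝ) = 2) (hb : (⟪b, b⟫ : ℝ) = 2)
    (hc : (⟪c, c⟫ : ℝ) = 2) (hd : (⟪d, d⟫ : ℝ) = 2) (hab : (⟪a, b⟫ : ℝ) = -φ)
    (hbc : (⟪b, c⟫ : ℝ) = -1) (hac : (⟪a, c⟫ : ℝ) = 0) (hda : EdgeVal ⟪d, a⟫)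
    (hdb : EdgeVal ⟪d, b⟫) (hdc : EdgeVal ⟪d, c⟫)
    (hli : ∀ s t u : ℝ, d ≠ s • a + t • b + u • c) :
    ∃ (y : V) (k : ℝ), (⟪y, a⟫ : ℝ) = 0 ∧ (⟪y, b⟫ : ℝ) = 0 ∧ (⟪y, c⟫ : ℝ) = 0 ∧
      0 < (⟪y, d⟫ : ℝ) ∧ (⟪y, y⟫ : ℝ) = k * ⟪y, d⟫ ∧ 2 * k < (3 * φ) ^ 2 * ⟪y, d⟫ := by
  obtain ⟨h1, h2⟩ := goldenRatio_bounds
  have hsq := Real.goldenRatio_sq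
  obtain ⟨y, hya, hyb, hyc, hyy, hyd, hk⟩ :=
    triple_normal_aux hsq a b c d ha hb hc hd hab hbc hac (by linarith) hli
  have hpos : 0 < (⟪y, d⟫ : ℝ) := by
    rw [hk] at hyy
    exact pos_of_mul_pos_right hyy (by linarith)
  unfold EdgeVal at hda hdb hdc
  generalize (⟪d, a⟫ : ℝ) = p at *
  generalize (⟪d, b⟫ : ℝ) = q at *
  generalize (⟪d, c⟫ : ℝ) = r at *
  generalize φ = t at *
  have key : p = 0 ∧ q = 0 ∧ (r = 0 ∨ r = -1) := by
    rcases hda with rfl | rfl | rfl <;> rcases hdb with rfl | rfl | rfl <;>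
      rcases hdc with rfl | rfl | rfl <;>
      first
        | exact ⟨rfl, rfl, .inl rfl⟩
        | exact ⟨rfl, rfl, .inr rfl⟩
        | (exfalso; nlinarith)
  refine ⟨y, 4 - 2 * t, hya, hyb, hyc, hpos, hk, ?_⟩
  rw [hyd]
  rcases key with ⟨rfl, rfl, rfl | rfl⟩ <;> nlinarith

end Levels
end HurwitzRS

namespace HurwitzRS
open scoped RealInnerProductSpace goldenRatio

section CommonRoot
variable {V : Type*} [NormedAddCommGroup V] [InnerProductSpace ℝ V]

theorem IsSimple.notMem_span [DecidableEq V] {Ψ : Set V} {Δ : Finset V} {d : V} (hd : d ∉ Δ)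
    (h : IsSimple Ψ (insert d Δ)) : d ∉ Submodule.span ℝ (Δ : Set V) := by
  intro hs
  obtain ⟨c, -, hc⟩ := Submodule.mem_span_finset.1 hs
  have := h.li (fun e => if e = d then -1 else c e) (by
    rw [Finset.sum_insert hd, if_pos rfl]
    have e1 : ∑ e ∈ Δ, (if e = d then (-1 : ℝ) else c e) • e = ∑ e ∈ Δ, c e • e :=
      Finset.sum_congr rfl fun e he => by rw [if_neg (by rintro rfl; exact hd he)]
    rw [e1, hc]
    simp) d (Finset.mem_insert_self _ _)
  simp at this

theorem IsSimple.gold_normal [DecidableEq V] {Ψ : Set V} {Δ : Finset V} {d : V} {U : Submodule ℝ V}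
    (hΨ : IsRS Ψ) (hd : d ∉ Δ) (h : IsSimple Ψ (insert d Δ)) (h' : IsSimple (Ψ ∩ U) Δ)
    (hg : ∀ a ∈ Ψ, ∀ b ∈ Ψ, GoldVal ⟪a, b⟫) (hI : Irr (Ψ ∩ U))
    (hz : ∃ a ∈ Ψ ∩ U, ∃ b ∈ Ψ ∩ U, (⟪a, b⟫ : ℝ) ∉ ints) (hc : Δ.card = 2 ∨ Δ.card = 3) :
    ∃ (y : V) (k : ℝ), (∀ e ∈ Δ, (⟪y, e⟫ : ℝ) = 0) ∧ 0 < (⟪y, d⟫ : ℝ) ∧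
      (⟪y, y⟫ : ℝ) = k * ⟪y, d⟫ ∧ 2 * k < (Δ.card * φ) ^ 2 * ⟪y, d⟫ := by
  have hn : ∀ e ∈ insert d Δ, (⟪e, e⟫ : ℝ) = 2 := fun e he => hΨ.norm e (h.sub e he)
  have hE : ∀ e ∈ insert d Δ, ∀ e' ∈ insert d Δ, e ≠ e' → EdgeVal ⟪e, e'⟫ :=
    fun e he e' he' hne => h.gold_edge hΨ hg he he' hne
  have hdm := Finset.mem_insert_self d Δ
  have hm : ∀ {e}, e ∈ Δ → e ∈ insert d Δ := fun he => Finset.mem_insert_of_mem he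
  have hne : ∀ {e}, e ∈ Δ → d ≠ e := fun he h => hd (h ▸ he)
  have hsp := h.notMem_span hd
  have hspan : ∀ {e}, e ∈ Δ → e ∈ Submodule.span ℝ (Δ : Set V) := fun he =>
    Submodule.subset_span he
  obtain ⟨a, ha, b, hb, hab, habv⟩ := h'.exists_golden_edge (hΨ.inter U)
    (fun a ha b hb => hg a ha.1 b hb.1) hz
  rcases hc with hc | hc
  · have hΔ : ({a, b} : Finset V) = Δ := Finset.eq_of_subset_of_card_le
      (by simp [Finset.insert_subset_iff, ha, hb]) (by rw [Finset.card_pair hab, hc])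
    obtain ⟨-, -, -, y, k, hya, hyb, hyd, hk, hlt⟩ := golden_pair_normal (hn a (hm ha))
      (hn b (hm hb)) (hn d hdm) habv (hE d hdm a (hm ha) (hne ha)) (hE d hdm b (hm hb) (hne hb))
      (fun s t e => hsp (e ▸ add_mem (Submodule.smul_mem _ _ (hspan ha))
        (Submodule.smul_mem _ _ (hspan hb))))
    refine ⟨y, k, fun e he => ?_, hyd, hk, by rw [hc]; exact_mod_cast hlt⟩
    rw [← hΔ] at he
    rcases Finset.mem_insert.1 he with rfl | he
    · exact hya
    · rw [Finset.mem_singleton.1 he]; exact hyb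
  · obtain ⟨a', ha'S, ha', c, hcΔ, hcS, hac⟩ := h'.exists_neighbor (hΨ.inter U) hI {a, b}
      ⟨a, by simp, ha⟩ (by rw [Finset.card_pair hab, hc]; norm_num)
    have hca : c ≠ a := fun e => hcS (by simp [e])
    have hcb : c ≠ b := fun e => hcS (by simp [e])
    have hspc : c ∉ Submodule.span ℝ ((Δ.erase c : Finset V) : Set V) := by
      have := h'
      rw [← Finset.insert_erase hcΔ] at this
      exact this.notMem_span (Finset.notMem_erase c Δ)
    have hspe : ∀ {e}, e ∈ Δ → c ≠ e → e ∈ Submodule.span ℝ ((Δ.erase c : Finset V) : Set V) :=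
      fun he hce => Submodule.subset_span (by simp [he, hce.symm])
    obtain ⟨h0, h1, h2, -⟩ := golden_pair_normal (hn a (hm ha))
      (hn b (hm hb)) (hn c (hm hcΔ)) habv (hE c (hm hcΔ) a (hm ha) hca)
      (hE c (hm hcΔ) b (hm hb) hcb)
      (fun s t e => hspc (by
        have h3 := add_mem (Submodule.smul_mem _ s (hspe ha hca))
          (Submodule.smul_mem _ t (hspe hb hcb))
        rwa [← e] at h3))
    have hΔ : ({a, b, c} : Finset V) = Δ := Finset.eq_of_subset_of_card_le
      (by simp [Finset.insert_subset_iff, ha, hb, hcΔ])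
      (by rw [Finset.card_eq_three.2 ⟨a, b, c, hab, hca.symm, hcb.symm, rfl⟩, hc])
    have main : ∀ a b : V, a ∈ Δ → b ∈ Δ → (⟪a, b⟫ : ℝ) = -φ → (⟪b, c⟫ : ℝ) = -1 →
        (⟪a, c⟫ : ℝ) = 0 → (∀ e ∈ Δ, e = a ∨ e = b ∨ e = c) →
        ∃ (y : V) (k : ℝ), (∀ e ∈ Δ, (⟪y, e⟫ : ℝ) = 0) ∧ 0 < (⟪y, d⟫ : ℝ) ∧
          (⟪y, y⟫ : ℝ) = k * ⟪y, d⟫ ∧ 2 * k < (Δ.card * φ) ^ 2 * ⟪y, d⟫ := by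
      intro a b ha hb hab hbc hac hcov
      obtain ⟨y, k, hya, hyb, hyc, hyd, hk, hlt⟩ := golden_triple_normal (hn a (hm ha))
        (hn b (hm hb)) (hn c (hm hcΔ)) (hn d hdm) hab hbc hac (hE d hdm a (hm ha) (hne ha))
        (hE d hdm b (hm hb) (hne hb)) (hE d hdm c (hm hcΔ) (hne hcΔ))
        (fun s t u e => hsp (by
          have h3 := add_mem (add_mem (Submodule.smul_mem _ s (hspan ha))
            (Submodule.smul_mem _ t (hspan hb))) (Submodule.smul_mem _ u (hspan hcΔ))
          rwa [← e] at h3))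
      refine ⟨y, k, fun e he => ?_, hyd, hk, by rw [hc]; exact_mod_cast hlt⟩
      rcases hcov e he with rfl | rfl | rfl
      exacts [hya, hyb, hyc]
    have hcov : ∀ e ∈ Δ, e = a ∨ e = b ∨ e = c := fun e he => by
      rw [← hΔ] at he; simpa using he
    rw [real_inner_comm] at hac
    have hE' := hE c (hm hcΔ)
    rcases Finset.mem_insert.1 ha'S with e | e
    · rw [e] at hac
      refine main b a hb ha (by rw [real_inner_comm, habv]) ?_ ?_ fun e he => ?_
      · rw [real_inner_comm]
        exact ((hE' a (hm ha) hca).resolve_left hac).resolve_right h1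
      · rw [real_inner_comm]
        exact h0.resolve_left hac
      · rcases hcov e he with h | h | h <;> simp [h]
    · rw [Finset.mem_singleton.1 e] at hac
      refine main a b ha hb habv ?_ ?_ hcov
      · rw [real_inner_comm]
        exact ((hE' b (hm hb) hcb).resolve_left hac).resolve_right h2
      · rw [real_inner_comm]
        exact h0.resolve_right hac

theorem rf_rf_golden {t : ℝ} (ht : t ^ 2 = t + 1) {a b : V} (ha : (⟪a, a⟫ : ℝ) = 2)
    (hb : (⟪b, b⟫ : ℝ) = 2) (hab : (⟪a, b⟫ : ℝ) = -t) : rf a (rf b a) = t • a + t • b := by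
  have hba : (⟪b, a⟫ : ℝ) = -t := by rw [real_inner_comm, hab]
  rw [rf_apply hb, hba, neg_smul, sub_neg_eq_add, rf_apply ha, inner_add_right,
    real_inner_smul_right, ha, hab]
  have : (2 + t * -t : ℝ) = 1 - t := by linear_combination -ht
  rw [this]
  module

theorem IsSimple.exists_high [DecidableEq V] {Ψ : Set V} {Δ : Finset V} (hΨ : IsRS Ψ)
    (h : IsSimple Ψ Δ) (hg : ∀ a ∈ Ψ, ∀ b ∈ Ψ, GoldVal ⟪a, b⟫) (hI : Irr Ψ)
    (hz : ∃ a ∈ Ψ, ∃ b ∈ Ψ, (⟪a, b⟫ : ℝ) ∉ ints) (hc : Δ.card = 2 ∨ Δ.card = 3) {y : V} {l : ℝ}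
    (hl : 0 < l) (hy : ∀ e ∈ Δ, l ≤ ⟪y, e⟫) : ∃ v ∈ Ψ, Δ.card * φ * l ≤ ⟪y, v⟫ := by
  obtain ⟨hφ, -⟩ := goldenRatio_bounds
  obtain ⟨a, ha, b, hb, hab, habv⟩ := h.exists_golden_edge hΨ hg hz
  have hv := rf_rf_golden Real.goldenRatio_sq (hΨ.norm a (h.sub a ha)) (hΨ.norm b (h.sub b hb))
    habv
  have hvm : φ • a + φ • b ∈ Ψ :=
    hv ▸ hΨ.refl a (h.sub a ha) _ (hΨ.refl b (h.sub b hb) a (h.sub a ha))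
  have hlev : 2 * φ * l ≤ (⟪y, φ • a + φ • b⟫ : ℝ) := by
    rw [inner_add_right, real_inner_smul_right, real_inner_smul_right]
    nlinarith [hy a ha, hy b hb]
  rcases hc with hc | hc
  · exact ⟨_, hvm, by rw [hc]; exact_mod_cast hlev⟩
  · obtain ⟨a', ha'S, ha', c, hcΔ, hcS, hac⟩ := h.exists_neighbor hΨ hI {a, b}
      ⟨a, by simp, ha⟩ (by rw [Finset.card_pair hab, hc]; norm_num)
    have hca : c ≠ a := fun e => hcS (by simp [e])
    have hcb : c ≠ b := fun e => hcS (by simp [e])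
    have hca' := h.gold_edge hΨ hg hcΔ ha hca
    have hcb' := h.gold_edge hΨ hg hcΔ hb hcb
    rw [real_inner_comm] at hac
    have hneg : (⟪c, a⟫ : ℝ) + ⟪c, b⟫ ≤ -1 := by
      rcases Finset.mem_insert.1 ha'S with e | e
      · rw [e] at hac
        rcases hca' with h1 | h1 | h1 <;> rcases hcb' with h2 | h2 | h2 <;>
          first | exact (hac h1).elim | linarith
      · rw [Finset.mem_singleton.1 e] at hac
        rcases hca' with h1 | h1 | h1 <;> rcases hcb' with h2 | h2 | h2 <;>
          first | exact (hac h2).elim | linarith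
    refine ⟨rf c (φ • a + φ • b), hΨ.refl c (h.sub c hcΔ) _ hvm, ?_⟩
    rw [rf_apply (hΨ.norm c (h.sub c hcΔ)), inner_sub_right, real_inner_smul_right,
      inner_add_right c, real_inner_smul_right, real_inner_smul_right, hc]
    push_cast
    have h3 : φ ≤ -(φ * ⟪c, a⟫ + φ * ⟪c, b⟫) := by nlinarith
    nlinarith [mul_le_mul h3 (hy c hcΔ) hl.le (by linarith)]

theorem IsRS.exists_common_root [FiniteDimensional ℝ V] {Ψ : Set V} (hΨ : IsRS Ψ)
    (hg : ∀ a ∈ Ψ, ∀ b ∈ Ψ, GoldVal ⟪a, b⟫) {U U' : Submodule ℝ V} (hI : Irr (Ψ ∩ U))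
    (hI' : Irr (Ψ ∩ U')) (hz : ∃ a ∈ Ψ ∩ U, ∃ b ∈ Ψ ∩ U, (⟪a, b⟫ : ℝ) ∉ ints)
    (hz' : ∃ a ∈ Ψ ∩ U', ∃ b ∈ Ψ ∩ U', (⟪a, b⟫ : ℝ) ∉ ints) {n : ℕ} (hn : n = 2 ∨ n = 3)
    (hr : Module.finrank ℝ (Submodule.span ℝ Ψ) = n + 1)
    (hrU : Module.finrank ℝ (Submodule.span ℝ (Ψ ∩ U)) = n)
    (hrU' : Module.finrank ℝ (Submodule.span ℝ (Ψ ∩ U')) = n) :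
    ∃ b ∈ Ψ, b ∈ U ∧ b ∈ U' := by
  classical
  obtain ⟨Δ₀, Δ, h, hsub, h'⟩ := hΨ.exists_flat U
  have hc : Δ.card = n := by rw [← h'.finrank_eq, hrU]
  have hc₀ : Δ₀.card = n + 1 := by rw [← h.finrank_eq, hr]
  obtain ⟨d, hd, rfl⟩ := (Finset.exists_eq_insert_iff (s := Δ) (t := Δ₀)).2 ⟨hsub, by omega⟩
  obtain ⟨y, k, hye, hyd, hk, hlt⟩ := h.gold_normal hΨ hd h' hg hI hz (by omega)
  have hyU : ∀ b ∈ Ψ, (⟪y, b⟫ : ℝ) = 0 → b ∈ U := by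
    intro b hb h0
    obtain ⟨c, -, hc⟩ := Submodule.mem_span_finset.1
      (show b ∈ Submodule.span ℝ ((insert d Δ : Finset V) : Set V) by
        rw [h.span_eq]; exact Submodule.subset_span hb)
    rw [Finset.sum_insert hd] at hc
    rw [← hc, inner_add_right, real_inner_smul_right, inner_sum, Finset.sum_eq_zero, add_zero,
      mul_eq_zero, or_iff_left hyd.ne'] at h0
    · rw [← hc, h0, zero_smul, zero_add]
      exact sum_mem fun e he => U.smul_mem _ (h'.sub e he).2
    · intro e he
      rw [real_inner_smul_right, hye e he, mul_zero]
  by_contra! hno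
  have hreg : ∀ b ∈ Ψ ∩ U', (⟪b, y⟫ : ℝ) ≠ 0 := fun b hb h0 =>
    hno b hb.1 (hyU b hb.1 (by rw [real_inner_comm, h0])) hb.2
  obtain ⟨Δ', hΔ', hpos⟩ := (hΨ.inter U').exists_simple hreg
  have hc' : Δ'.card = n := by rw [← hΔ'.finrank_eq, hrU']
  obtain ⟨v, hv, hlev⟩ := hΔ'.exists_high (hΨ.inter U') (fun a ha b hb => hg a ha.1 b hb.1) hI' hz'
    (by omega) hyd fun e he => h.level hΨ hd hg hye (hΔ'.sub e he).1
      (by rw [real_inner_comm]; exact hpos e he) hyd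
  have hCS := real_inner_mul_inner_self_le y v
  rw [hΨ.norm v hv.1, hk] at hCS
  rw [hc] at hlt
  rw [hc'] at hlev
  have hφ := goldenRatio_bounds.1
  have h1 : 0 ≤ (n * φ * ⟪y, d⟫ : ℝ) := by positivity
  have h2 := mul_le_mul hlev hlev h1 (h1.trans hlev)
  nlinarith [mul_lt_mul_of_pos_right hlt hyd]

end CommonRoot
end HurwitzRS

namespace HurwitzRS
open scoped RealInnerProductSpace goldenRatio

section GoldFront
variable {V : Type*} [NormedAddCommGroup V] [InnerProductSpace ℝ V]

theorem Irr.insert {X : Set V} (hX : Irr X) {x c : V} (hx : x ∈ X) (hxc : (⟪x, c⟫ : ℝ) ≠ 0) :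
    Irr (insert c X) := by
  have hcx : (⟪c, x⟫ : ℝ) ≠ 0 := by rwa [real_inner_comm]
  rintro p ⟨a, ha, hpa⟩ ⟨b, hb, hpb⟩
  by_cases h1 : ∃ a ∈ X, p a
  · by_cases h2 : ∃ b ∈ X, ¬ p b
    · obtain ⟨u, hu, v, hv, h⟩ := hX p h1 h2
      exact ⟨u, .inr hu, v, .inr hv, h⟩
    · push Not at h2
      rcases hb with rfl | hb
      · exact ⟨x, .inr hx, b, .inl rfl, h2 x hx, hpb, hxc⟩
      · exact (hpb (h2 b hb)).elim
  · push Not at h1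
    rcases ha with rfl | ha
    · exact ⟨a, .inl rfl, x, .inr hx, hpa, h1 x hx, hcx⟩
    · exact (h1 a ha hpa).elim

theorem irr_pair {a b : V} (h : (⟪a, b⟫ : ℝ) ≠ 0) : Irr {b, a} :=
  Irr.insert (X := {a}) (by
    rintro p ⟨_, rfl, h1⟩ ⟨_, rfl, h2⟩
    exact (h2 h1).elim) rfl h

theorem Ind.nodup {L : List V} (h : Ind L) : L.Nodup := by
  induction L with
  | nil => exact List.nodup_nil
  | cons a L ih => exact List.nodup_cons.2 ⟨fun ha => h.1 (mem_sp ha), ih h.2⟩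

theorem Full.setOf_gen_eq {Φ : Set V} (hΦ : IsRS Φ) {L : List V} (hL : ∀ a ∈ L, a ∈ Φ)
    (hF : Full Φ L) : {v | Gen {x | x ∈ L} v} = Φ ∩ sp L :=
  Set.ext fun v => ⟨fun hv => ⟨hΦ.gen_sub hL hv, hv.mem_span⟩, fun hv => hF v hv.1 hv.2⟩

theorem span_inter_sp {Φ : Set V} {L : List V} (hL : ∀ a ∈ L, a ∈ Φ) :
    Submodule.span ℝ (Φ ∩ sp L) = sp L :=
  le_antisymm (Submodule.span_le.2 fun _ h => h.2)
    (Submodule.span_mono fun a ha => ⟨hL a ha, mem_sp ha⟩)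

theorem exists_split_irr {L : List V} (hn : L.Nodup) (hI : Irr {x | x ∈ L})
    (h3 : 3 ≤ L.length) (h4 : L.length ≤ 4) {a b : V} (ha : a ∈ L) (hb : b ∈ L) (hab : a ≠ b)
    (h0 : (⟪a, b⟫ : ℝ) ≠ 0) : ∃ A e B, L = A ++ e :: B ∧ a ∈ A ++ B ∧ b ∈ A ++ B ∧
      Irr {x | x ∈ A ++ B} := by
  classical
  have hcard := List.toFinset_card_of_nodup hn
  suffices h : ∃ (e : V) (S : Finset V), e ∉ S ∧ insert e S = L.toFinset ∧ a ∈ S ∧ b ∈ S ∧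
      Irr (S : Set V) by
    obtain ⟨e, S, heS, hS, haS, hbS, hIS⟩ := h
    have he : e ∈ L := by rw [← List.mem_toFinset, ← hS]; exact Finset.mem_insert_self _ _
    obtain ⟨A, B, rfl⟩ := List.append_of_mem he
    rw [List.nodup_middle, List.nodup_cons] at hn
    have hmem : ∀ x, x ∈ A ++ B ↔ x ∈ S := by
      intro x
      have h1 : x ∈ insert e S ↔ x ∈ A ++ e :: B := by rw [hS, List.mem_toFinset]
      rw [Finset.mem_insert] at h1
      by_cases hx : x = e
      · subst hx
        exact ⟨fun h => (hn.1 h).elim, fun h => (heS h).elim⟩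
      · simp only [List.mem_append, List.mem_cons, hx, false_or] at h1 ⊢
        exact h1.symm
    refine ⟨A, e, B, rfl, (hmem a).2 haS, (hmem b).2 hbS, ?_⟩
    rwa [show {x | x ∈ A ++ B} = (S : Set V) from Set.ext hmem]
  have key : ∀ S : Finset V, S ⊆ L.toFinset → S.card + 1 = L.length → a ∈ S → b ∈ S →
      Irr (S : Set V) → ∃ (e : V) (S : Finset V), e ∉ S ∧ insert e S = L.toFinset ∧ a ∈ S ∧ b ∈ S ∧
      Irr (S : Set V) := by
    intro S hS hc haS hbS hIS
    obtain ⟨e, he, h⟩ := Finset.exists_eq_insert_iff.2 ⟨hS, by rw [hc, hcard]⟩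
    exact ⟨e, S, he, h, haS, hbS, hIS⟩
  have hsub : ({b, a} : Finset V) ⊆ L.toFinset := by
    simp [Finset.insert_subset_iff, ha, hb]
  have hc2 : ({b, a} : Finset V).card = 2 := Finset.card_pair hab.symm
  have hI2 : Irr ((({b, a} : Finset V)) : Set V) := by simpa using irr_pair h0
  rcases (by omega : L.length = 3 ∨ L.length = 4) with hl | hl
  · exact key {b, a} hsub (by omega) (by simp) (by simp) hI2
  · obtain ⟨d, hd, hdS⟩ := Finset.exists_mem_notMem_of_card_lt_card
      (s := {b, a}) (t := L.toFinset) (by omega)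
    obtain ⟨x, -, c, hc, hx, hcn, hxc⟩ := hI (fun v => v ∈ ({b, a} : Finset V))
      ⟨a, ha, by simp⟩ ⟨d, by simpa using hd, hdS⟩
    refine key (insert c {b, a}) (Finset.insert_subset (by simpa using hc) hsub)
      (by rw [Finset.card_insert_of_notMem hcn]; omega) (by simp) (by simp) ?_
    rw [Finset.coe_insert]
    exact hI2.insert hx hxc


theorem exists_golden_tail {Φ : Set V} (hΦ : IsRS Φ) {L : List V} (hL : ∀ a ∈ L, a ∈ Φ)
    (hi : Ind L) (hF : Full Φ L) (hg : Gold Φ L) (hI : Irr (Φ ∩ sp L)) (h3 : 3 ≤ L.length)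
    (h4 : L.length ≤ 4) (hz : ∃ a ∈ Φ ∩ sp L, ∃ b ∈ Φ ∩ sp L, (⟪a, b⟫ : ℝ) ∉ ints) :
    ∃ e τ, HV L (e :: τ) ∧ (∀ x ∈ τ, x ∈ L) ∧ Irr (Φ ∩ sp τ) ∧
      ∃ a ∈ Φ ∩ sp τ, ∃ b ∈ Φ ∩ sp τ, (⟪a, b⟫ : ℝ) ∉ ints := by
  have hn : ∀ a ∈ {x | x ∈ L}, (⟪a, a⟫ : ℝ) = 2 := fun a ha => hΦ.norm a (hL a ha)
  have hIL : Irr {x | x ∈ L} := Irr.of_gen (fun a ha => hΦ.ne_zero (hL a ha))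
    (by rwa [hF.setOf_gen_eq hΦ hL])
  obtain ⟨a, ha, b, hb, hab⟩ : ∃ a ∈ L, ∃ b ∈ L, (⟪a, b⟫ : ℝ) ∉ ints := by
    by_contra! hc
    obtain ⟨u, hu, v, hv, huv⟩ := hz
    exact huv (Gen.inner_mem_subring hn hc (hF u hu.1 hu.2) (hF v hv.1 hv.2))
  have hne : a ≠ b := by
    rintro rfl
    exact hab ⟨2, by rw [hn a ha]; norm_num⟩
  have h0 : (⟪a, b⟫ : ℝ) ≠ 0 := fun h => hab ⟨0, by rw [h]; simp⟩
  obtain ⟨A, e, B, rfl, haA, hbA, hIr⟩ := exists_split_irr hi.nodup hIL h3 h4 ha hb hne h0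
  have hv := HV.front A e B
  have hsub : ∀ x ∈ A ++ B, x ∈ A ++ e :: B := fun x hx => by
    rcases List.mem_append.1 hx with h | h
    · exact List.mem_append_left _ h
    · exact List.mem_append_right _ (List.mem_cons_of_mem _ h)
  have hΦτ : ∀ x ∈ A ++ B, x ∈ Φ := fun x hx => hL x (hsub x hx)
  have hFτ : Full Φ (A ++ B) := Gold.full_tail hΦ (hv.sub hΦ hL) (hv.ind hi) (hF.of_hv hv)
    (by unfold Gold; rw [hv.sp]; exact hg)
  refine ⟨_, A ++ B, hv, hsub, ?_, a, ⟨hΦτ a haA, mem_sp haA⟩, b, ⟨hΦτ b hbA, mem_sp hbA⟩, hab⟩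
  rw [← hFτ.setOf_gen_eq hΦ hΦτ]
  exact Irr.gen (fun a ha => hΦ.ne_zero (hΦτ a ha)) hIr

variable [FiniteDimensional ℝ V]

theorem Ctx.front_of_gold {Φ : Set V} {L : List V} (h : Ctx Φ L) (hF : Full Φ L)
    (hg : Gold Φ L) (hI : Irr (Φ ∩ sp L)) (h3 : 3 ≤ L.length) (h4 : L.length ≤ 4)
    (hz : ∃ a ∈ Φ ∩ sp L, ∃ b ∈ Φ ∩ sp L, (⟪a, b⟫ : ℝ) ∉ ints) : Front Φ L := by
  intro c hc hcL
  by_contra hcn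
  obtain ⟨σ, hσ, hpr, hlen⟩ := h.rs.carter_front h.sub h.ind hc hcL
  obtain ⟨hsp, hind, -⟩ := ind_of_pr_eq h.ind hpr.symm hlen.le
  have hsub : ∀ x ∈ c :: σ, x ∈ Φ := by simpa using ⟨hc, hσ⟩
  have hF' := hg.full_of_pr_eq h.rs h.sub h.ind hF hsub hpr hlen
  obtain ⟨x, hx⟩ := exists_preimage h.ind hcL
  have hnot : ∀ b ∈ c :: σ, ¬ ∃ τ, HV L (b :: τ) := by
    intro b hb
    rcases List.mem_cons.1 hb with rfl | hb'
    · exact hcn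
    · refine (h.compl_closed hc hcL hcn hx (hsub b hb) (hsp ▸ mem_sp hb) ?_).1
      rw [real_inner_comm]
      exact preimage_orth hind (h.rs.norm c hc) (by rwa [hpr]) b hb'
  obtain ⟨e, τ, hτ, -, hIτ, hzτ⟩ := exists_golden_tail h.rs h.sub h.ind hF hg hI h3 h4 hz
  obtain ⟨e', τ', hτ', hτs, hIτ', hzτ'⟩ := exists_golden_tail h.rs hsub hind hF'
    (by unfold Gold; rw [hsp]; exact hg) (by rwa [hsp]) (by omega) (by omega) (by rwa [hsp])
  have hlτ := hτ.length
  have hlτ' := hτ'.length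
  rw [List.length_cons] at hlτ hlτ'
  have hΦτ := hτ.sub h.rs h.sub
  have hΦτ' := hτ'.sub h.rs hsub
  have hindτ := hτ.ind h.ind
  have hindτ' := hτ'.ind hind
  have hle : sp τ ≤ sp L := hτ.sp ▸ sp_mono fun b hb => List.mem_cons_of_mem _ hb
  have hle' : sp τ' ≤ sp L := (hτ'.sp.trans hsp) ▸ sp_mono fun b hb => List.mem_cons_of_mem _ hb
  have hinn : ∀ {ρ : List V}, sp ρ ≤ sp L → Φ ∩ (sp L : Set V) ∩ sp ρ = Φ ∩ sp ρ := fun hρ => by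
    rw [Set.inter_assoc, Set.inter_eq_self_of_subset_right (SetLike.coe_subset_coe.2 hρ)]
  have hτΦ : ∀ a ∈ τ, a ∈ Φ := fun a ha => hΦτ a (List.mem_cons_of_mem _ ha)
  have hτΦ' : ∀ a ∈ τ', a ∈ Φ := fun a ha => hΦτ' a (List.mem_cons_of_mem _ ha)
  obtain ⟨b, hb, hbτ, hbτ'⟩ := (h.rs.inter (sp L)).exists_common_root (U := sp τ) (U' := sp τ')
    (n := τ.length) (fun a ha b hb => hg a ha.1 ha.2 b hb.1 hb.2) (by rwa [hinn hle])
    (by rwa [hinn hle']) (by rwa [hinn hle]) (by rwa [hinn hle']) (by omega)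
    (by rw [span_inter_sp h.sub, (ind_iff L).1 h.ind]; omega)
    (by rw [hinn hle, span_inter_sp hτΦ, (ind_iff τ).1 hindτ.2])
    (by rw [hinn hle', span_inter_sp hτΦ', (ind_iff τ').1 hindτ'.2]; omega)
  refine absurd (h.closed hτ hb.1 hbτ).1 ?_
  have hprτ' : pr (e' :: τ') = pr L := hτ'.pr.trans hpr
  have heL : e' ∈ sp L := by rw [← hsp, ← hτ'.sp]; exact mem_sp List.mem_cons_self
  have heΦ : e' ∈ Φ := hΦτ' e' List.mem_cons_self
  obtain ⟨z, hz'⟩ := exists_preimage h.ind heL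
  have horth : ∀ v ∈ sp τ', (⟪z, v⟫ : ℝ) = 0 := by
    have h1 := preimage_orth hindτ' (h.rs.norm e' heΦ) (x := z) (by rwa [hprτ'])
    have h2 : z ∈ (sp τ')ᗮ := mem_sp_orth.2 h1
    exact fun v hv => by rw [real_inner_comm]; exact h2 v hv
  have hen : ¬ ∃ ρ, HV L (e' :: ρ) := by
    rintro ⟨ρ, hρ⟩
    obtain ⟨m, hm⟩ := List.exists_mem_of_ne_nil τ' (by rintro rfl; rw [List.length_nil] at hlτ'; omega)
    exact hnot m (hτs m hm) (h.closed' hρ hz' (hτΦ' m hm) (hle' (mem_sp hm))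
      (horth m (mem_sp hm))).1
  exact (h.compl_closed heΦ heL hen hz' hb.1 hb.2 (horth b hbτ')).1

theorem GoldVal.crysVal {x : ℝ} (h : GoldVal x) (hx : x ∈ ints) : CrysVal x := by
  obtain ⟨n, rfl⟩ := hx
  obtain ⟨h1, h2⟩ := goldenRatio_bounds
  have hlt : ∀ m : ℤ, (m : ℝ) ≠ φ := fun m hm => by
    rw [← hm] at h1 h2
    have h3 : (1 : ℝ) < m := by linarith
    have h4 : (m : ℝ) < 2 := by linarith
    norm_cast at h3 h4
    omega
  simp only [eq_intCast] at h ⊢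
  unfold CrysVal
  rcases h with h | h | h | h | h | h | h | h | h
  · rw [h]; norm_num
  · rw [h]; norm_num
  · rw [h]; norm_num
  · exact (hlt n h).elim
  · exact (hlt (-n) (by push_cast; linarith)).elim
  · exact (hlt (n + 1) (by push_cast; linarith)).elim
  · exact (hlt (1 - n) (by push_cast; linarith)).elim
  · rw [h]; norm_num
  · rw [h]; norm_num

theorem crys_or_gold_of_full {Φ : Set V} (hΦ : IsRS Φ) {L : List V} (hL : ∀ a ∈ L, a ∈ Φ)
    (hi : Ind L) (hF : Full Φ L) (hI : Irr {x | x ∈ L}) (h3 : 3 ≤ L.length) :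
    Irr (Φ ∩ sp L) ∧ ((∀ u ∈ Φ, u ∈ sp L → ∀ v ∈ Φ, v ∈ sp L → CrysVal ⟪u, v⟫) ∨
      (L.length ≤ 4 ∧ Gold Φ L)) := by
  have hI' : Irr (Φ ∩ sp L) := by
    rw [← hF.setOf_gen_eq hΦ hL]
    exact Irr.gen (fun a ha => hΦ.ne_zero (hL a ha)) hI
  have hr : Module.finrank ℝ (Submodule.span ℝ (Φ ∩ sp L)) = L.length := by
    rw [span_inter_sp hL, (ind_iff L).1 hi]
  refine ⟨hI', ?_⟩
  rcases (hΦ.inter (sp L)).crys_or_gold hI' (by rwa [hr]) with h | ⟨h4, h⟩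
  · exact .inl fun u hu hu' v hv hv' => h u ⟨hu, hu'⟩ v ⟨hv, hv'⟩
  · exact .inr ⟨hr ▸ h4, fun u hu hu' v hv hv' => h u ⟨hu, hu'⟩ v ⟨hv, hv'⟩⟩

theorem IsRS.hv_of_pr_eq {Φ : Set V} (hΦ : IsRS Φ) {L L' : List V} (hL : ∀ a ∈ L, a ∈ Φ)
    (hi : Ind L) (hF : Full Φ L) (hL' : ∀ a ∈ L', a ∈ Φ) (hlen : L'.length = L.length)
    (hpr : pr L' = pr L) : HV L L' := by
  refine hv_of_pr_eq_aux hΦ ?_ ?_ _ L L' rfl hL hi hF hL' hlen hpr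
  · intro L hL hi hF hI h3 a τ hv
    have hsub := hv.sub hΦ hL
    have hF' := hF.of_hv hv
    rcases (crys_or_gold_of_full hΦ hL hi hF hI h3).2 with hc | ⟨-, hg⟩
    · exact (crys_tail hΦ hsub (hv.ind hi) hF' (by rwa [hv.sp])).1
    · exact Gold.full_tail hΦ hsub (hv.ind hi) hF' (by unfold Gold; rwa [hv.sp])
  · intro L h hF hI h3
    obtain ⟨hI', hc | ⟨h4, hg⟩⟩ := crys_or_gold_of_full h.rs h.sub h.ind hF hI h3
    · exact h.front_of_crys hF (by omega) hc
    · by_cases hz : ∃ a ∈ Φ ∩ sp L, ∃ b ∈ Φ ∩ sp L, (⟪a, b⟫ : ℝ) ∉ ints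
      · exact h.front_of_gold hF hg hI' h3 h4 hz
      · push Not at hz
        exact h.front_of_crys hF (by omega) fun u hu hu' v hv hv' =>
          (hg u hu hu' v hv hv').crysVal (hz u ⟨hu, hu'⟩ v ⟨hv, hv'⟩)

end GoldFront

theorem transitive_iff {B W : Type*} [Group W] [Finite W] {M : CoxeterMatrix B}
    (cs : CoxeterSystem M W) (w : W) :
    (∀ l₁ ∈ RedT cs w, ∀ l₂ ∈ RedT cs w, HurwitzEquiv l₁ l₂) ↔
    ∃ l ∈ RedT cs w, IsParabolic cs (Subgroup.closure {t | t ∈ l}) := by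
  have := finite_of_finite cs
  obtain ⟨ι, _, a, hli, ha⟩ := exists_geometric cs
  obtain ⟨ρ, hinj, hs, hbig⟩ := exists_isometric_rep cs hli ha
  have h : IsGeo cs a ρ := ⟨hli, fun i => by rw [ha]; simp, hinj, hs, hbig⟩
  exact h.transitive_iff (fun L L' hL hi hF hL' hlen hpr =>
    h.isRS.hv_of_pr_eq hL hi hF hL' hlen hpr) w

end HurwitzRS

/-- Let `(W, S)` be a finite (spherical) Coxeter system and `w ∈ W`.  The Hurwitz action
of the braid group is transitive on `Red_T w` if and only if `w` is a parabolic
quasi-Coxeter element, i.e. some reduced reflection factorization of `w` generates a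
parabolic subgroup of `W`. -/
theorem hurwitz_transitive_iff_parabolic_quasi_coxeter
    {B W : Type*} [Group W] [Finite W] {M : CoxeterMatrix B} (cs : CoxeterSystem M W)
    (w : W) :
    (∀ l₁ ∈ RedT cs w, ∀ l₂ ∈ RedT cs w, HurwitzEquiv l₁ l₂) ↔
    ∃ l ∈ RedT cs w, IsParabolic cs (Subgroup.closure {t | t ∈ l}) := by
  exact HurwitzRS.transitive_iff cs w
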